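/- Let k be an algebraically closed field of characteristic 2 and let G = SO(2n, k) with n ≥ 4. A non-trivial unipotent conjugacy class O of G is spherical if and only if O consists of involutions, i.e. if and only if every u ∈ O satisfies u² = 1. -/

import Mathlib

open scoped Matrix

section SphericalDefs

variable (G : Type*) [Group G] [TopologicalSpace G]

/-- A Borel subgroup of an algebraic group: a maximal closed connected solvable subgroup. -/
def IsBorel (B : Subgroup G) : Prop :=
  IsClosed (B : Set G) ∧ IsConnected (B : Set G) ∧ IsSolvable B ∧
    ∀ B' : Subgroup G, IsClosed (B' : Set G) → IsConnected (B' : Set G) → IsSolvable B' →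
      B ≤ B' → B' = B

variable {G}

/-- The orbit of `x` under conjugation by elements of a subgroup `B`. -/
def conjOrbit (B : Subgroup G) (x : G) : Set G := {g | ∃ b ∈ B, g = b * x * b⁻¹}

/-- The conjugacy class of `u`. -/
def conjClass (u : G) : Set G := {v | IsConj u v}

variable (G)

/-- A subset (typically a conjugacy class) of `G` is *spherical* if a Borel subgroup of `G`
has a dense orbit on it (acting by conjugation). -/
def IsSphericalClass (O : Set G) : Prop :=
  ∃ B : Subgroup G, IsBorel G B ∧ ∃ x ∈ O, O ⊆ closure (conjOrbit B x)

/-- A subgroup `H ≤ G` is a *spherical subgroup* if a Borel subgroup of `G` has a dense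
orbit on the homogeneous space `G ⧸ H`, i.e. `G ⧸ H` is a spherical homogeneous space. -/
def IsSphericalSubgroup (H : Subgroup G) : Prop :=
  ∃ B : Subgroup G, IsBorel G B ∧ ∃ x : G ⧸ H, Dense {y : G ⧸ H | ∃ b ∈ B, y = b • x}

end SphericalDefs

/-- The (classical) Zariski topology on the affine space `ι → k`:
a basis of open sets is given by the nonvanishing loci of polynomials. -/
def zariskiTopology (k : Type*) [CommRing k] (ι : Type*) : TopologicalSpace (ι → k) :=
  TopologicalSpace.generateFrom
    {s | ∃ p : MvPolynomial ι k, s = {v | MvPolynomial.eval v p ≠ 0}}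

/-- The Zariski topology on the general linear group `GL m k`, viewing it as an affine
variety via `g ↦ (g, g⁻¹)`. -/
instance glZariskiTopology (m k : Type*) [DecidableEq m] [Fintype m] [CommRing k] :
    TopologicalSpace (GL m k) :=
  TopologicalSpace.induced
    (fun g => Sum.elim (fun p : m × m => ((g : Matrix m m k)) p.1 p.2)
      (fun p : m × m => (((g⁻¹ : GL m k) : Matrix m m k)) p.1 p.2))
    (zariskiTopology k ((m × m) ⊕ (m × m)))

noncomputable section

variable (k : Type*) [Field k] (n : ℕ)

private lemma glInvVec {k : Type*} [Field k] {m : Type*} [DecidableEq m] [Fintype m]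
    (g : GL m k) (u : m → k) :
    (g : Matrix m m k) *ᵥ (((g⁻¹ : GL m k) : Matrix m m k) *ᵥ u) = u := by
  rw [Matrix.mulVec_mulVec, ← Units.val_mul, mul_inv_cancel, Units.val_one,
    Matrix.one_mulVec]

/-- The standard nondegenerate alternating bilinear form on `k^{2n}`. -/
def sympForm (v w : (Fin n ⊕ Fin n) → k) : k :=
  ∑ i : Fin n, (v (Sum.inl i) * w (Sum.inr i) - v (Sum.inr i) * w (Sum.inl i))

/-- The symplectic group `Sp(2n, k)`: the subgroup of `GL(2n, k)` preserving the
standard nondegenerate alternating bilinear form. -/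
def SpGroup : Subgroup (GL (Fin n ⊕ Fin n) k) where
  carrier := {g : GL (Fin n ⊕ Fin n) k | ∀ v w : (Fin n ⊕ Fin n) → k,
      sympForm k n ((g : Matrix (Fin n ⊕ Fin n) (Fin n ⊕ Fin n) k) *ᵥ v)
        ((g : Matrix (Fin n ⊕ Fin n) (Fin n ⊕ Fin n) k) *ᵥ w) = sympForm k n v w}
  mul_mem' := by
    intro a b ha hb v w
    simp only [Units.val_mul, ← Matrix.mulVec_mulVec]
    rw [ha, hb]
  one_mem' := by
    intro v w
    simp [Matrix.one_mulVec]
  inv_mem' := by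
    intro g hg v w
    conv_rhs => rw [← glInvVec g v, ← glInvVec g w, hg]

/-- The standard quadratic form of maximal Witt index on `k^{2n}`. -/
def quadForm (v : (Fin n ⊕ Fin n) → k) : k :=
  ∑ i : Fin n, v (Sum.inl i) * v (Sum.inr i)

/-- The (even) orthogonal group `O(2n, k)`: the subgroup of `GL(2n, k)` preserving the
standard quadratic form of maximal Witt index. -/
def evenOrthGroup : Subgroup (GL (Fin n ⊕ Fin n) k) where
  carrier := {g : GL (Fin n ⊕ Fin n) k | ∀ v : (Fin n ⊕ Fin n) → k,
      quadForm k n ((g : Matrix (Fin n ⊕ Fin n) (Fin n ⊕ Fin n) k) *ᵥ v) = quadForm k n v}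
  mul_mem' := by
    intro a b ha hb v
    simp only [Units.val_mul, ← Matrix.mulVec_mulVec]
    rw [ha, hb]
  one_mem' := by
    intro v
    simp [Matrix.one_mulVec]
  inv_mem' := by
    intro g hg v
    conv_rhs => rw [← glInvVec g v, hg]

/-- The special orthogonal group `SO(2n, k)` in characteristic 2: the connected component
of the identity of `O(2n, k)` in the Zariski topology.  (The connected component of the
identity of a group with translation-continuous topology is a subgroup, so taking
`Subgroup.closure` does not change the underlying set.) -/
def evenSOGroup : Subgroup (GL (Fin n ⊕ Fin n) k) :=
  Subgroup.closure ((↑) '' (connectedComponent (1 : evenOrthGroup k n)))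

section

variable {k n}

section RegularFunctions

open Topology TopologicalSpace

variable {m : Type*} [DecidableEq m] [Fintype m]

/-- The matrix entries of `g` and of `g⁻¹`, as functions on `GL m k`. -/
def glCoord (c : (m × m) ⊕ (m × m)) (g : GL m k) : k :=
  Sum.elim (fun p : m × m => (g : Matrix m m k) p.1 p.2)
    (fun p : m × m => ((g⁻¹ : GL m k) : Matrix m m k) p.1 p.2) c

/-- The algebra of regular functions on `GL m k`. -/
def glReg (m k : Type*) [DecidableEq m] [Fintype m] [Field k] : Subalgebra k (GL m k → k) :=
  Algebra.adjoin k (Set.range glCoord)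

lemma glCoord_mem_glReg (c : (m × m) ⊕ (m × m)) : (glCoord c : GL m k → k) ∈ glReg m k :=
  Algebra.subset_adjoin ⟨c, rfl⟩

lemma entry_mem_glReg (i j : m) : (fun g : GL m k => (g : Matrix m m k) i j) ∈ glReg m k :=
  glCoord_mem_glReg (Sum.inl (i, j))

lemma inv_entry_mem_glReg (i j : m) :
    (fun g : GL m k => ((g⁻¹ : GL m k) : Matrix m m k) i j) ∈ glReg m k :=
  glCoord_mem_glReg (Sum.inr (i, j))

lemma mem_glReg_iff {f : GL m k → k} :
    f ∈ glReg m k ↔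
      ∃ p : MvPolynomial ((m × m) ⊕ (m × m)) k,
        ∀ g, f g = MvPolynomial.eval (fun c => glCoord c g) p := by
  have key : ∀ (p : MvPolynomial ((m × m) ⊕ (m × m)) k) (g : GL m k),
      MvPolynomial.aeval (R := k) (fun c => (glCoord c : GL m k → k)) p g
        = MvPolynomial.eval (fun c => glCoord c g) p := by
    intro p g
    induction p using MvPolynomial.induction_on with
    | C a => simp
    | add p q hp hq => simp [hp, hq]
    | mul_X p i hp => simp [hp]
  rw [glReg, Algebra.adjoin_range_eq_range_aeval]
  constructor
  · rintro ⟨p, rfl⟩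
    exact ⟨p, fun g => key p g⟩
  · rintro ⟨p, hp⟩
    exact ⟨p, funext fun g => (key p g).trans (hp g).symm⟩

lemma comp_mem_glReg {φ : GL m k → GL m k}
    (hφ : ∀ c, (fun g => glCoord c (φ g)) ∈ glReg m k) {f : GL m k → k} (hf : f ∈ glReg m k) :
    (fun g => f (φ g)) ∈ glReg m k := by
  induction hf using Algebra.adjoin_induction with
  | mem x hx => obtain ⟨c, rfl⟩ := hx; exact hφ c
  | algebraMap r => exact (glReg m k).algebraMap_mem r
  | add x y _ _ hx hy => exact (glReg m k).add_mem hx hy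
  | mul x y _ _ hx hy => exact (glReg m k).mul_mem hx hy

lemma sum_mem_glReg {ι : Type*} (s : Finset ι) {f : ι → GL m k → k}
    (hf : ∀ i ∈ s, f i ∈ glReg m k) : (fun g => ∑ i ∈ s, f i g) ∈ glReg m k := by
  have : (fun g => ∑ i ∈ s, f i g) = ∑ i ∈ s, f i := by
    ext g; simp
  rw [this]
  exact (glReg m k).sum_mem hf

lemma prod_mem_glReg {ι : Type*} (s : Finset ι) {f : ι → GL m k → k}
    (hf : ∀ i ∈ s, f i ∈ glReg m k) : (fun g => ∏ i ∈ s, f i g) ∈ glReg m k := by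
  have : (fun g => ∏ i ∈ s, f i g) = ∏ i ∈ s, f i := by
    ext g; simp
  rw [this]
  exact (glReg m k).prod_mem hf

lemma const_mem_glReg (c : k) : (fun _ : GL m k => c) ∈ glReg m k :=
  (glReg m k).algebraMap_mem c

lemma sub_mem_glReg {f g : GL m k → k} (hf : f ∈ glReg m k) (hg : g ∈ glReg m k) :
    (fun x => f x - g x) ∈ glReg m k := (glReg m k).sub_mem hf hg

lemma mul_mem_glReg {f g : GL m k → k} (hf : f ∈ glReg m k) (hg : g ∈ glReg m k) :
    (fun x => f x * g x) ∈ glReg m k := (glReg m k).mul_mem hf hg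

lemma pow_mem_glReg {f : GL m k → k} (hf : f ∈ glReg m k) (d : ℕ) :
    (fun x => f x ^ d) ∈ glReg m k := (glReg m k).pow_mem hf d

/-- A matrix-valued function on `GL m k` with regular entries. -/
def IsRegMatrix (M : GL m k → Matrix m m k) : Prop := ∀ i j, (fun g => M g i j) ∈ glReg m k

lemma IsRegMatrix.mul {M N : GL m k → Matrix m m k} (hM : IsRegMatrix M) (hN : IsRegMatrix N) :
    IsRegMatrix fun g => M g * N g := by
  intro i j
  simp only [Matrix.mul_apply]
  exact sum_mem_glReg _ fun l _ => mul_mem_glReg (hM i l) (hN l j)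

lemma isRegMatrix_const (M : Matrix m m k) : IsRegMatrix fun _ : GL m k => M :=
  fun _ _ => const_mem_glReg _

lemma isRegMatrix_val : IsRegMatrix fun g : GL m k => (g : Matrix m m k) := entry_mem_glReg

lemma isRegMatrix_inv : IsRegMatrix fun g : GL m k => ((g⁻¹ : GL m k) : Matrix m m k) :=
  inv_entry_mem_glReg

/-- A self-map of `GL m k` given by regular functions. -/
def IsRegMap (φ : GL m k → GL m k) : Prop :=
  IsRegMatrix (fun g => (φ g : Matrix m m k)) ∧
    IsRegMatrix (fun g => (((φ g)⁻¹ : GL m k) : Matrix m m k))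

lemma isRegMap_id : IsRegMap fun g : GL m k => g := ⟨isRegMatrix_val, isRegMatrix_inv⟩

lemma isRegMap_const (a : GL m k) : IsRegMap fun _ : GL m k => a :=
  ⟨isRegMatrix_const _, isRegMatrix_const _⟩

lemma IsRegMap.inv {φ : GL m k → GL m k} (hφ : IsRegMap φ) : IsRegMap fun g => (φ g)⁻¹ :=
  ⟨hφ.2, by simpa using hφ.1⟩

lemma IsRegMap.mul {φ ψ : GL m k → GL m k} (hφ : IsRegMap φ) (hψ : IsRegMap ψ) :
    IsRegMap fun g => φ g * ψ g := by
  refine ⟨?_, ?_⟩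
  · simpa using hφ.1.mul hψ.1
  · simpa using hψ.2.mul hφ.2

lemma IsRegMap.comp_mem {φ : GL m k → GL m k} (hφ : IsRegMap φ) {f : GL m k → k}
    (hf : f ∈ glReg m k) : (fun g => f (φ g)) ∈ glReg m k := by
  refine comp_mem_glReg ?_ hf
  rintro (⟨i, j⟩ | ⟨i, j⟩)
  · exact hφ.1 i j
  · exact hφ.2 i j

lemma isTopologicalBasis_zariski (ι : Type*) :
    @IsTopologicalBasis _ (zariskiTopology k ι)
      {s | ∃ p : MvPolynomial ι k, s = {v | MvPolynomial.eval v p ≠ 0}} := by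
  let _ := zariskiTopology k ι
  refine ⟨?_, ?_, rfl⟩
  · rintro _ ⟨p, rfl⟩ _ ⟨q, rfl⟩ x hx
    refine ⟨_, ⟨p * q, rfl⟩, ?_, ?_⟩
    · simpa using hx
    · intro y hy
      simpa using hy
  · refine Set.eq_univ_of_forall fun x => ?_
    exact Set.mem_sUnion.2 ⟨_, ⟨1, rfl⟩, by simp⟩

lemma isTopologicalBasis_glReg :
    IsTopologicalBasis {s : Set (GL m k) | ∃ f ∈ glReg m k, s = {g | f g ≠ 0}} := by
  have h := @IsTopologicalBasis.induced _ (GL m k) (zariskiTopology k ((m × m) ⊕ (m × m)))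
    (fun g => fun c => glCoord c g) _ (isTopologicalBasis_zariski (k := k) _)
  refine (congrArg (IsTopologicalBasis (α := GL m k)) ?_).mpr h
  ext s
  constructor
  · rintro ⟨f, hf, rfl⟩
    obtain ⟨p, hp⟩ := mem_glReg_iff.1 hf
    exact ⟨_, ⟨p, rfl⟩, by ext g; simp [hp]⟩
  · rintro ⟨_, ⟨p, rfl⟩, rfl⟩
    exact ⟨_, mem_glReg_iff.2 ⟨p, fun g => rfl⟩, by ext g; simp⟩

lemma isOpen_glReg_ne {f : GL m k → k} (hf : f ∈ glReg m k) : IsOpen {g | f g ≠ 0} :=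
  isTopologicalBasis_glReg.isOpen ⟨f, hf, rfl⟩

lemma isClosed_glReg_eq {f : GL m k → k} (hf : f ∈ glReg m k) (c : k) :
    IsClosed {g | f g = c} := by
  rw [← isOpen_compl_iff]
  convert isOpen_glReg_ne (sub_mem_glReg hf (const_mem_glReg c)) using 1
  ext g
  simp [sub_eq_zero]

lemma mem_closure_glReg_iff {S : Set (GL m k)} {x : GL m k} :
    x ∈ closure S ↔ ∀ f ∈ glReg m k, (∀ s ∈ S, f s = 0) → f x = 0 := by
  rw [isTopologicalBasis_glReg.mem_closure_iff]
  constructor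
  · intro h f hf hS
    by_contra hx
    obtain ⟨y, hy, hyS⟩ := h _ ⟨f, hf, rfl⟩ hx
    exact hy (hS y hyS)
  · rintro h _ ⟨f, hf, rfl⟩ hx
    by_contra hne
    refine hx (h f hf fun s hs => ?_)
    by_contra hs0
    exact hne ⟨s, hs0, hs⟩

lemma IsRegMap.continuous {φ : GL m k → GL m k} (hφ : IsRegMap φ) : Continuous φ := by
  rw [isTopologicalBasis_glReg.continuous_iff]
  rintro _ ⟨f, hf, rfl⟩
  exact isOpen_glReg_ne (hφ.comp_mem hf)

instance noetherianSpace_gl : NoetherianSpace (GL m k) := by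
  let σ := (m × m) ⊕ (m × m)
  let i : GL m k → PrimeSpectrum (MvPolynomial σ k) := fun g =>
    ⟨RingHom.ker (MvPolynomial.eval fun c => glCoord c g), RingHom.ker_isPrime _⟩
  have hi : IsInducing i := by
    refine ⟨?_⟩
    have h2 := PrimeSpectrum.isTopologicalBasis_basic_opens (R := MvPolynomial σ k)
    have h3 := h2.induced i
    refine isTopologicalBasis_glReg.eq_generateFrom.trans (Eq.trans ?_
      (@IsTopologicalBasis.eq_generateFrom _ (_) _ h3).symm)
    congr 1
    ext s
    constructor
    · rintro ⟨f, hf, rfl⟩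
      obtain ⟨p, hp⟩ := mem_glReg_iff.1 hf
      refine ⟨_, ⟨p, rfl⟩, ?_⟩
      ext g
      simp [hp, i, RingHom.mem_ker]
    · rintro ⟨_, ⟨p, rfl⟩, rfl⟩
      refine ⟨_, mem_glReg_iff.2 ⟨p, fun g => rfl⟩, ?_⟩
      ext g
      simp [i, RingHom.mem_ker]
  exact hi.noetherianSpace

/-- A function that takes finitely many values on a connected set, with closed fibres, is
constant there. -/
lemma IsPreconnected.glReg_eq_of_finite {S : Set (GL m k)} (hS : IsPreconnected S)
    {f : GL m k → k} (hf : f ∈ glReg m k) (hfin : (f '' S).Finite) {x y : GL m k}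
    (hx : x ∈ S) (hy : y ∈ S) : f x = f y := by
  by_contra hne
  have hfin' : (f '' S \ {f x}).Finite := hfin.subset Set.sdiff_subset
  have hcl : IsClosed (⋃ c ∈ f '' S \ {f x}, {g | f g = c}) :=
    hfin'.isClosed_biUnion fun c _ => isClosed_glReg_eq hf c
  have hcl' := isClosed_glReg_eq hf (f x)
  have hcov : S ⊆ {g | f g = f x} ∪ ⋃ c ∈ f '' S \ {f x}, {g | f g = c} := by
    intro g hg
    by_cases h : f g = f x
    · exact Or.inl h
    · refine Or.inr (Set.mem_biUnion (x := f g) ⟨⟨g, hg, rfl⟩, h⟩ rfl)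
  have := isPreconnected_closed_iff.1 hS _ _ hcl' hcl hcov ⟨x, hx, rfl⟩
    ⟨y, hy, Set.mem_biUnion (x := f y) ⟨⟨y, hy, rfl⟩, fun h => hne h.symm⟩ rfl⟩
  obtain ⟨z, -, hz1, hz2⟩ := this
  simp only [Set.mem_iUnion] at hz2
  obtain ⟨c, hc, hzc⟩ := hz2
  exact hc.2 ((hzc : f z = c).symm.trans hz1)

/-- The image of a rational curve in `GL m k` is irreducible. -/
lemma isPreirreducible_rational_curve [Infinite k] (γ : k → GL m k) (d : Polynomial k)
    (hd : d ≠ 0)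
    (hγ : ∀ c, ∃ P : Polynomial k, ∀ t, d.eval t ≠ 0 → glCoord c (γ t) * d.eval t = P.eval t) :
    IsPreirreducible (γ '' {t | d.eval t ≠ 0}) := by
  have key : ∀ f ∈ glReg m k, ∃ (P : Polynomial k) (e : ℕ), ∀ t, d.eval t ≠ 0 →
      f (γ t) * d.eval t ^ e = P.eval t := by
    intro f hf
    induction hf using Algebra.adjoin_induction with
    | mem x hx =>
      obtain ⟨c, rfl⟩ := hx
      obtain ⟨P, hP⟩ := hγ c
      exact ⟨P, 1, by simpa using hP⟩
    | algebraMap r => exact ⟨Polynomial.C r, 0, by simp⟩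
    | add x y _ _ hx hy =>
      obtain ⟨P, e, hP⟩ := hx
      obtain ⟨P', e', hP'⟩ := hy
      refine ⟨P * d ^ e' + P' * d ^ e, e + e', fun t ht => ?_⟩
      simp only [Pi.add_apply, Polynomial.eval_add, Polynomial.eval_mul, Polynomial.eval_pow,
        ← hP t ht, ← hP' t ht]
      ring
    | mul x y _ _ hx hy =>
      obtain ⟨P, e, hP⟩ := hx
      obtain ⟨P', e', hP'⟩ := hy
      refine ⟨P * P', e + e', fun t ht => ?_⟩
      simp only [Pi.mul_apply, Polynomial.eval_mul, ← hP t ht, ← hP' t ht]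
      ring
  rintro U V hU hV ⟨_, ⟨t₁, ht₁, rfl⟩, hU₁⟩ ⟨_, ⟨t₂, ht₂, rfl⟩, hV₂⟩
  obtain ⟨_, ⟨f₁, hf₁, rfl⟩, hx₁, hs₁⟩ := isTopologicalBasis_glReg.exists_subset_of_mem_open hU₁ hU
  obtain ⟨_, ⟨f₂, hf₂, rfl⟩, hx₂, hs₂⟩ := isTopologicalBasis_glReg.exists_subset_of_mem_open hV₂ hV
  obtain ⟨P₁, e₁, hP₁⟩ := key f₁ hf₁
  obtain ⟨P₂, e₂, hP₂⟩ := key f₂ hf₂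
  have hP₁0 : P₁ ≠ 0 := by
    rintro rfl
    have := hP₁ t₁ ht₁
    simp only [Polynomial.eval_zero, mul_eq_zero] at this
    exact this.elim hx₁ fun h => ht₁ (eq_zero_of_pow_eq_zero h)
  have hP₂0 : P₂ ≠ 0 := by
    rintro rfl
    have := hP₂ t₂ ht₂
    simp only [Polynomial.eval_zero, mul_eq_zero] at this
    exact this.elim hx₂ fun h => ht₂ (eq_zero_of_pow_eq_zero h)
  have hne : P₁ * P₂ * d ≠ 0 := mul_ne_zero (mul_ne_zero hP₁0 hP₂0) hd
  obtain ⟨t, ht⟩ : ∃ t, (P₁ * P₂ * d).eval t ≠ 0 := by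
    by_contra hall
    push Not at hall
    exact hne (Polynomial.funext fun t => by simpa using hall t)
  simp only [Polynomial.eval_mul, mul_ne_zero_iff] at ht
  obtain ⟨⟨h1, h2⟩, h3⟩ := ht
  refine ⟨γ t, ⟨t, h3, rfl⟩, hs₁ ?_, hs₂ ?_⟩
  · intro h0
    exact h1 (by rw [← hP₁ t h3, h0, zero_mul])
  · intro h0
    exact h2 (by rw [← hP₂ t h3, h0, zero_mul])

/-- A subgroup generated by elements lying in connected subsets through `1` is connected. -/
lemma isPreconnected_closure_of_generators {S : Set (GL m k)}
    (hS : ∀ s ∈ S, ∃ C ⊆ (Subgroup.closure S : Set (GL m k)), 1 ∈ C ∧ s ∈ C ∧ IsPreconnected C) :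
    IsPreconnected (Subgroup.closure S : Set (GL m k)) := by
  have key : ∀ s ∈ Subgroup.closure S, ∃ C ⊆ (Subgroup.closure S : Set (GL m k)),
      1 ∈ C ∧ s ∈ C ∧ IsPreconnected C := by
    intro s hs
    induction hs using Subgroup.closure_induction with
    | mem x hx => exact hS x hx
    | one => exact ⟨{1}, by simp, rfl, rfl, isPreconnected_singleton⟩
    | mul x y hx hy ihx ihy =>
      obtain ⟨C, hC, h1, hxC, hpC⟩ := ihx
      obtain ⟨D, hD, h1', hyD, hpD⟩ := ihy
      refine ⟨C ∪ (fun g => x * g) '' D, ?_, Or.inl h1, Or.inr ⟨y, hyD, rfl⟩, ?_⟩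
      · rintro _ (h | ⟨d, hd, rfl⟩)
        · exact hC h
        · exact mul_mem hx (hD hd)
      · exact IsPreconnected.union x hxC ⟨1, h1', by simp⟩ hpC
          (hpD.image _ ((isRegMap_const x).mul isRegMap_id).continuous.continuousOn)
    | inv x hx ih =>
      obtain ⟨C, hC, h1, hxC, hpC⟩ := ih
      refine ⟨(fun g => g⁻¹) '' C, ?_, ⟨1, h1, by simp⟩, ⟨x, hxC, rfl⟩,
        hpC.image _ isRegMap_id.inv.continuous.continuousOn⟩
      rintro _ ⟨c, hc, rfl⟩
      exact inv_mem (hC hc)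
  refine isPreconnected_of_forall 1 fun y hy => ?_
  obtain ⟨C, hC, h1, hyC, hpC⟩ := key y hy
  exact ⟨C, hC, h1, hyC, hpC⟩

/-- A connected subgroup of `GL m k` is irreducible. -/
lemma Subgroup.isPreirreducible_of_isPreconnected {H : Subgroup (GL m k)}
    (hH : IsPreconnected (H : Set (GL m k))) : IsPreirreducible (H : Set (GL m k)) := by
  have : PreconnectedSpace H := isPreconnected_iff_preconnectedSpace.1 hH
  have : NoetherianSpace H := IsInducing.subtypeVal.noetherianSpace
  have hfin := NoetherianSpace.finite_irreducibleComponents (α := H)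
  have hcont : ∀ a : H, Continuous fun g : H => a * g := fun a =>
    Continuous.subtype_mk
      (((isRegMap_const (a : GL m k)).mul isRegMap_id).continuous.comp continuous_subtype_val) _
  let τ : H → H ≃ₜ H := fun a =>
    { toEquiv := Equiv.mulLeft a
      continuous_toFun := hcont a
      continuous_invFun := hcont a⁻¹ }
  have hτ : ∀ (a : H) (Z : Set H), Z ∈ irreducibleComponents H →
      (τ a) ⁻¹' Z ∈ irreducibleComponents H := by
    intro a Z hZ
    refine ⟨?_, ?_⟩
    · have := hZ.1.image (τ a).symm (τ a).symm.continuous.continuousOn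
      rwa [(τ a).symm.image_eq_preimage_symm, Homeomorph.symm_symm] at this
    · intro Y hY hle
      have h1 : Z ⊆ (τ a) '' Y := by
        intro z hz
        exact ⟨(τ a).symm z, hle (by simpa using hz), by simp⟩
      have h2 := hZ.2 (hY.image (τ a) (τ a).continuous.continuousOn) h1
      intro y hy
      exact h2 ⟨y, hy, rfl⟩
  -- some point lies in only one component, hence every point does
  let X := irreducibleComponent (1 : H)
  have hX : X ∈ irreducibleComponents H := irreducibleComponent_mem_irreducibleComponents 1
  have hfin' : (irreducibleComponents H \ {X}).Finite := hfin.subset Set.sdiff_subset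
  have hcl : IsClosed (⋃ Z ∈ irreducibleComponents H \ {X}, Z) :=
    hfin'.isClosed_biUnion fun Z hZ => isClosed_of_mem_irreducibleComponents Z hZ.1
  obtain ⟨x, hxX, hx⟩ : ∃ x ∈ X, x ∉ ⋃ Z ∈ irreducibleComponents H \ {X}, Z := by
    by_contra hcon
    push Not at hcon
    have hsub : X ⊆ ⋃₀ (irreducibleComponents H \ {X}) := by
      intro x hx
      have := hcon x hx
      simpa using this
    obtain ⟨Z, hZ, hXZ⟩ := (isIrreducible_iff_sUnion_isClosed.1 hX.1) hfin'.toFinset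
      (fun Z hZ => isClosed_of_mem_irreducibleComponents Z
        ((hfin'.mem_toFinset.1 hZ).1)) (by simpa using hsub)
    have hZ' := hfin'.mem_toFinset.1 hZ
    exact hZ'.2 (Set.Subset.antisymm (hX.2 hZ'.1.1 hXZ) hXZ)
  have huniq : ∀ (y : H) (Z : Set H), Z ∈ irreducibleComponents H → y ∈ X → y ∈ Z → Z = X := by
    intro y Z hZ hyX hyZ
    have hxu : ∀ Z ∈ irreducibleComponents H, x ∈ Z → Z = X := by
      intro Z hZ hxZ
      by_contra hne
      exact hx (Set.mem_biUnion (x := Z) ⟨hZ, hne⟩ hxZ)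
    let a : H := y * x⁻¹
    have hax : τ a x = y := by simp [τ, a]
    have e1 := hxu _ (hτ a Z hZ) (by simpa [hax] using hyZ)
    have e2 := hxu _ (hτ a X hX) (by simpa [hax] using hyX)
    exact (τ a).surjective.preimage_injective (e1.trans e2.symm)
  have hclopen : IsClopen X := by
    refine ⟨isClosed_of_mem_irreducibleComponents X hX, ?_⟩
    have : X = (⋃ Z ∈ irreducibleComponents H \ {X}, Z)ᶜ := by
      ext y
      constructor
      · intro hy hy'
        simp only [Set.mem_iUnion] at hy'
        obtain ⟨Z, hZ, hyZ⟩ := hy'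
        exact hZ.2 (huniq y Z hZ.1 hy hyZ)
      · intro hy
        by_contra hyX
        refine hy (Set.mem_biUnion (x := irreducibleComponent y)
          ⟨irreducibleComponent_mem_irreducibleComponents y, ?_⟩ mem_irreducibleComponent)
        intro h
        exact hyX ((show irreducibleComponent y = X from h) ▸ mem_irreducibleComponent)
    rw [this]
    exact hcl.isOpen_compl
  have huniv : X = Set.univ := hclopen.eq_univ ⟨x, hxX⟩
  have := hX.1.2.image ((↑) : H → GL m k) continuous_subtype_val.continuousOn
  rw [huniv] at this
  simpa using this

lemma Subgroup.glReg_eq_zero_or {H : Subgroup (GL m k)}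
    (hH : IsPreconnected (H : Set (GL m k))) {f₁ f₂ : GL m k → k} (hf₁ : f₁ ∈ glReg m k)
    (hf₂ : f₂ ∈ glReg m k) (h : ∀ g ∈ H, f₁ g * f₂ g = 0) {x : GL m k} (hx : x ∈ H)
    (hx₂ : f₂ x ≠ 0) : ∀ g ∈ H, f₁ g = 0 := by
  intro g hg
  by_contra hne
  obtain ⟨y, hy, h1, h2⟩ := Subgroup.isPreirreducible_of_isPreconnected hH _ _
    (isOpen_glReg_ne hf₁) (isOpen_glReg_ne hf₂) ⟨g, hg, hne⟩ ⟨x, hx, hx₂⟩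
  exact (mul_ne_zero h1 h2) (h y hy)

end RegularFunctions

section LinearAction

variable {m : Type*} [DecidableEq m] [Fintype m]

/-- The natural representation of `GL m k`. -/
def glAct (m k : Type*) [DecidableEq m] [Fintype m] [Field k] :
    GL m k →* Module.End k (m → k) :=
  (Matrix.toLinAlgEquiv' (R := k) (n := m)).toAlgHom.toMonoidHom.comp (Units.coeHom _)

@[simp] lemma glAct_apply (g : GL m k) (v : m → k) :
    glAct m k g v = (g : Matrix m m k) *ᵥ v := rfl

lemma glAct_mul_apply (g h : GL m k) (v : m → k) :
    glAct m k (g * h) v = glAct m k g (glAct m k h v) := by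
  rw [map_mul]; rfl

lemma glAct_inv_self (g : GL m k) (v : m → k) : glAct m k g⁻¹ (glAct m k g v) = v := by
  rw [← glAct_mul_apply, inv_mul_cancel, map_one]; rfl

lemma glAct_self_inv (g : GL m k) (v : m → k) : glAct m k g (glAct m k g⁻¹ v) = v := by
  rw [← glAct_mul_apply, mul_inv_cancel, map_one]; rfl

lemma glAct_injective : Function.Injective (glAct m k) := by
  intro g h hgh
  apply Units.ext
  exact (Matrix.toLinAlgEquiv' (R := k) (n := m)).injective hgh

lemma glAct_ext {g h : GL m k} (H : ∀ v, glAct m k g v = glAct m k h v) : g = h :=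
  glAct_injective (LinearMap.ext H)

lemma exists_glAct_eq (T : Module.End k (m → k)) (hT : Function.Injective T) :
    ∃ g : GL m k, glAct m k g = T := by
  have hu : IsUnit T := by
    rw [Module.End.isUnit_iff]
    exact ⟨hT, LinearMap.injective_iff_surjective.1 hT⟩
  have hu' : IsUnit ((Matrix.toLinAlgEquiv' (R := k) (n := m)).symm T) :=
    hu.map (Matrix.toLinAlgEquiv' (R := k) (n := m)).symm
  obtain ⟨g, hg⟩ := hu'
  refine ⟨g, ?_⟩
  change Matrix.toLinAlgEquiv' (R := k) (n := m) (g : Matrix m m k) = T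
  rw [hg, AlgEquiv.apply_symm_apply]

lemma glAct_entry (g : GL m k) (i j : m) :
    (g : Matrix m m k) i j = glAct m k g (Pi.single j 1) i := by
  simp

lemma dotProduct_glAct_mem (a b : m → k) : (fun g => a ⬝ᵥ glAct m k g b) ∈ glReg m k := by
  simp only [glAct_apply, Matrix.mulVec, dotProduct]
  exact sum_mem_glReg _ fun i _ => mul_mem_glReg (const_mem_glReg _)
    (sum_mem_glReg _ fun j _ => mul_mem_glReg (entry_mem_glReg i j) (const_mem_glReg _))

lemma linear_glAct_mem (φ : Module.Dual k (m → k)) (b : m → k) :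
    (fun g => φ (glAct m k g b)) ∈ glReg m k := by
  have : ∀ v, φ v = (fun i => φ (Pi.single i 1)) ⬝ᵥ v := by
    intro v
    conv_lhs => rw [LinearMap.pi_apply_eq_sum_univ φ v]
    simp only [dotProduct, smul_eq_mul, mul_comm]
    refine Finset.sum_congr rfl fun i _ => ?_
    congr 2
    ext j
    simp [Pi.single_apply, eq_comm]
  have h2 : (fun g : GL m k => φ (glAct m k g b)) =
      fun g => (fun i => φ (Pi.single i 1)) ⬝ᵥ glAct m k g b := funext fun g => this _
  rw [h2]
  exact dotProduct_glAct_mem _ _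

end LinearAction

section PolynomialFunctions

/-- Polynomial functions of one variable. -/
def IsPolyFun (f : k → k) : Prop := ∃ P : Polynomial k, ∀ t, f t = P.eval t

lemma isPolyFun_const (c : k) : IsPolyFun fun _ => c := ⟨Polynomial.C c, by simp⟩

lemma isPolyFun_id : IsPolyFun fun t : k => t := ⟨Polynomial.X, by simp⟩

lemma IsPolyFun.add {f g : k → k} (hf : IsPolyFun f) (hg : IsPolyFun g) :
    IsPolyFun fun t => f t + g t := by
  obtain ⟨P, hP⟩ := hf
  obtain ⟨R, hR⟩ := hg
  exact ⟨P + R, by simp [hP, hR]⟩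

lemma IsPolyFun.sub {f g : k → k} (hf : IsPolyFun f) (hg : IsPolyFun g) :
    IsPolyFun fun t => f t - g t := by
  obtain ⟨P, hP⟩ := hf
  obtain ⟨R, hR⟩ := hg
  exact ⟨P - R, by simp [hP, hR]⟩

lemma IsPolyFun.mul {f g : k → k} (hf : IsPolyFun f) (hg : IsPolyFun g) :
    IsPolyFun fun t => f t * g t := by
  obtain ⟨P, hP⟩ := hf
  obtain ⟨R, hR⟩ := hg
  exact ⟨P * R, by simp [hP, hR]⟩

lemma IsPolyFun.sum {ι : Type*} (s : Finset ι) {f : ι → k → k} (hf : ∀ i ∈ s, IsPolyFun (f i)) :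
    IsPolyFun fun t => ∑ i ∈ s, f i t := by
  choose! P hP using hf
  refine ⟨∑ i ∈ s, P i, fun t => ?_⟩
  rw [Polynomial.eval_finsetSum]
  exact Finset.sum_congr rfl fun i hi => hP i hi t

lemma IsPolyFun.prod {ι : Type*} (s : Finset ι) {f : ι → k → k} (hf : ∀ i ∈ s, IsPolyFun (f i)) :
    IsPolyFun fun t => ∏ i ∈ s, f i t := by
  choose! P hP using hf
  refine ⟨∏ i ∈ s, P i, fun t => ?_⟩
  rw [Polynomial.eval_prod]
  exact Finset.prod_congr rfl fun i hi => hP i hi t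

end PolynomialFunctions

section QuadraticForm

/-- The polar form of the quadratic form `quadForm`. -/
def polForm (k : Type*) [Field k] (n : ℕ) : LinearMap.BilinForm k (Fin n ⊕ Fin n → k) :=
  LinearMap.mk₂ k
    (fun v w => ∑ i : Fin n, (v (Sum.inl i) * w (Sum.inr i) + v (Sum.inr i) * w (Sum.inl i)))
    (fun v w x => by
      rw [← Finset.sum_add_distrib]
      exact Finset.sum_congr rfl fun i _ => by simp only [Pi.add_apply]; ring)
    (fun c v w => by
      rw [Finset.smul_sum]
      exact Finset.sum_congr rfl fun i _ => by simp only [Pi.smul_apply, smul_eq_mul]; ring)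
    (fun v w x => by
      rw [← Finset.sum_add_distrib]
      exact Finset.sum_congr rfl fun i _ => by simp only [Pi.add_apply]; ring)
    (fun c v w => by
      rw [Finset.smul_sum]
      exact Finset.sum_congr rfl fun i _ => by simp only [Pi.smul_apply, smul_eq_mul]; ring)

lemma polForm_apply (v w : Fin n ⊕ Fin n → k) : polForm k n v w =
    ∑ i : Fin n, (v (Sum.inl i) * w (Sum.inr i) + v (Sum.inr i) * w (Sum.inl i)) := rfl

lemma quadForm_add (v w : Fin n ⊕ Fin n → k) :
    quadForm k n (v + w) = quadForm k n v + quadForm k n w + polForm k n v w := by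
  simp only [quadForm, polForm_apply, ← Finset.sum_add_distrib]
  exact Finset.sum_congr rfl fun i _ => by simp only [Pi.add_apply]; ring

lemma quadForm_smul (c : k) (v : Fin n ⊕ Fin n → k) :
    quadForm k n (c • v) = c ^ 2 * quadForm k n v := by
  simp only [quadForm, Finset.mul_sum]
  exact Finset.sum_congr rfl fun i _ => by simp only [Pi.smul_apply, smul_eq_mul]; ring

@[simp] lemma quadForm_zero : quadForm k n 0 = 0 := by simp [quadForm]

lemma polForm_comm (v w : Fin n ⊕ Fin n → k) : polForm k n v w = polForm k n w v := by
  simp only [polForm_apply]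
  exact Finset.sum_congr rfl fun i _ => by ring

lemma polForm_self [CharP k 2] (v : Fin n ⊕ Fin n → k) : polForm k n v v = 0 := by
  simp only [polForm_apply]
  exact Finset.sum_eq_zero fun i _ => by rw [mul_comm]; exact CharTwo.add_self_eq_zero _

/-- The isotropic basis vectors of the first kind. -/
def eVec (k : Type*) [Field k] {n : ℕ} (i : Fin n) : Fin n ⊕ Fin n → k := Pi.single (Sum.inl i) 1

/-- The isotropic basis vectors of the second kind. -/
def fVec (k : Type*) [Field k] {n : ℕ} (i : Fin n) : Fin n ⊕ Fin n → k := Pi.single (Sum.inr i) 1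

@[simp] lemma eVec_inl (i j : Fin n) : eVec k i (Sum.inl j) = if j = i then 1 else 0 := by
  simp [eVec, Pi.single_apply]

@[simp] lemma eVec_inr (i j : Fin n) : eVec k i (Sum.inr j) = 0 := by
  simp [eVec]

@[simp] lemma fVec_inr (i j : Fin n) : fVec k i (Sum.inr j) = if j = i then 1 else 0 := by
  simp [fVec, Pi.single_apply]

@[simp] lemma fVec_inl (i j : Fin n) : fVec k i (Sum.inl j) = 0 := by
  simp [fVec]

lemma polForm_eVec (v : Fin n ⊕ Fin n → k) (i : Fin n) :
    polForm k n v (eVec k i) = v (Sum.inr i) := by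
  simp [polForm_apply]

lemma polForm_fVec (v : Fin n ⊕ Fin n → k) (i : Fin n) :
    polForm k n v (fVec k i) = v (Sum.inl i) := by
  simp [polForm_apply]

@[simp] lemma quadForm_eVec (i : Fin n) : quadForm k n (eVec k i) = 0 := by simp [quadForm]

@[simp] lemma quadForm_fVec (i : Fin n) : quadForm k n (fVec k i) = 0 := by simp [quadForm]

lemma eq_sum_eVec_fVec (v : Fin n ⊕ Fin n → k) :
    v = ∑ i, v (Sum.inl i) • eVec k i + ∑ i, v (Sum.inr i) • fVec k i := by
  ext (j | j) <;> simp [Finset.sum_apply]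

lemma eq_zero_of_polForm {v : Fin n ⊕ Fin n → k} (h : ∀ w, polForm k n v w = 0) : v = 0 := by
  ext (i | i)
  · simpa [polForm_fVec] using h (fVec k i)
  · simpa [polForm_eVec] using h (eVec k i)

lemma polForm_isRefl : (polForm k n).IsRefl := fun v w h => by rw [polForm_comm, h]

lemma polForm_nondegenerate : (polForm k n).Nondegenerate := by
  refine ⟨fun v h => eq_zero_of_polForm h, fun v h => eq_zero_of_polForm fun w => ?_⟩
  rw [polForm_comm, h]

lemma mem_evenOrthGroup {g : GL (Fin n ⊕ Fin n) k} :
    g ∈ evenOrthGroup k n ↔ ∀ v, quadForm k n (glAct _ k g v) = quadForm k n v := Iff.rfl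

lemma polForm_map_of_quadForm {T : Module.End k (Fin n ⊕ Fin n → k)}
    (hT : ∀ v, quadForm k n (T v) = quadForm k n v) (v w : Fin n ⊕ Fin n → k) :
    polForm k n (T v) (T w) = polForm k n v w := by
  have h1 := hT (v + w)
  rw [map_add, quadForm_add, quadForm_add, hT, hT] at h1
  exact add_left_cancel h1

lemma polForm_glAct {g : GL (Fin n ⊕ Fin n) k} (hg : g ∈ evenOrthGroup k n)
    (v w : Fin n ⊕ Fin n → k) :
    polForm k n (glAct _ k g v) (glAct _ k g w) = polForm k n v w :=
  polForm_map_of_quadForm (mem_evenOrthGroup.1 hg) v w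

lemma polForm_glAct_left {g : GL (Fin n ⊕ Fin n) k} (hg : g ∈ evenOrthGroup k n)
    (v w : Fin n ⊕ Fin n → k) :
    polForm k n (glAct _ k g v) w = polForm k n v (glAct _ k g⁻¹ w) := by
  rw [← polForm_glAct hg v, glAct_self_inv]

lemma exists_mem_evenOrthGroup (T : Module.End k (Fin n ⊕ Fin n → k))
    (hT : ∀ v, quadForm k n (T v) = quadForm k n v) :
    ∃ g ∈ evenOrthGroup k n, glAct _ k g = T := by
  obtain ⟨g, hg⟩ := exists_glAct_eq T (by
    rw [injective_iff_map_eq_zero]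
    intro v hv
    refine eq_zero_of_polForm fun w => ?_
    rw [← polForm_map_of_quadForm hT, hv, map_zero, LinearMap.zero_apply])
  exact ⟨g, mem_evenOrthGroup.2 fun v => by rw [hg, hT], hg⟩

end QuadraticForm

section Reflections

variable [CharP k 2]

/-- The orthogonal reflection (transvection) along `a`, in characteristic two. -/
def reflMap (a : Fin n ⊕ Fin n → k) : Module.End k (Fin n ⊕ Fin n → k) :=
  LinearMap.id + ((quadForm k n a)⁻¹ • (polForm k n a)).smulRight a

omit [CharP k 2] in
lemma reflMap_apply (a v : Fin n ⊕ Fin n → k) :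
    reflMap a v = v + ((quadForm k n a)⁻¹ * polForm k n a v) • a := rfl

lemma quadForm_reflMap {a : Fin n ⊕ Fin n → k} (ha : quadForm k n a ≠ 0)
    (v : Fin n ⊕ Fin n → k) : quadForm k n (reflMap a v) = quadForm k n v := by
  rw [reflMap_apply, quadForm_add, quadForm_smul, map_smul, smul_eq_mul, polForm_comm v a,
    add_assoc, add_eq_left]
  have h2 : (1 + 1 : k) = 0 := CharTwo.add_self_eq_zero (1 : k)
  field_simp
  rw [h2]
  ring

lemma reflMap_reflMap (a : Fin n ⊕ Fin n → k) (v : Fin n ⊕ Fin n → k) :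
    reflMap a (reflMap a v) = v := by
  rw [reflMap_apply a (reflMap a v), reflMap_apply, map_add, map_smul, polForm_self, smul_zero,
    add_zero, add_assoc, ← add_smul, CharTwo.add_self_eq_zero (R := k), zero_smul, add_zero]

/-- The reflection along `a` as an element of the general linear group. -/
def reflGL (a : Fin n ⊕ Fin n → k) : GL (Fin n ⊕ Fin n) k where
  val := LinearMap.toMatrix' (reflMap a)
  inv := LinearMap.toMatrix' (reflMap a)
  val_inv := by
    rw [← LinearMap.toMatrix'_comp, ← LinearMap.toMatrix'_id]
    exact congrArg _ (LinearMap.ext (reflMap_reflMap a))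
  inv_val := by
    rw [← LinearMap.toMatrix'_comp, ← LinearMap.toMatrix'_id]
    exact congrArg _ (LinearMap.ext (reflMap_reflMap a))

lemma glAct_reflGL (a v : Fin n ⊕ Fin n → k) : glAct _ k (reflGL a) v = reflMap a v := by
  rw [glAct_apply]
  exact LinearMap.toMatrix'_mulVec (reflMap a) v

lemma reflGL_inv (a : Fin n ⊕ Fin n → k) : (reflGL a)⁻¹ = reflGL a := Units.ext rfl

lemma reflGL_mem {a : Fin n ⊕ Fin n → k} (ha : quadForm k n a ≠ 0) :
    reflGL a ∈ evenOrthGroup k n :=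
  mem_evenOrthGroup.2 fun v => by rw [glAct_reflGL, quadForm_reflMap ha]

end Reflections

section SpecialOrthogonal

lemma evenSOGroup_le : evenSOGroup k n ≤ evenOrthGroup k n := by
  rw [evenSOGroup, Subgroup.closure_le]
  rintro _ ⟨x, -, rfl⟩
  exact x.2

lemma subset_evenSOGroup {S : Set (GL (Fin n ⊕ Fin n) k)} (hS : IsPreconnected S) (h1 : 1 ∈ S)
    (hO : S ⊆ evenOrthGroup k n) : S ⊆ evenSOGroup k n := by
  intro g hg
  refine Subgroup.subset_closure ⟨⟨g, hO hg⟩, ?_, rfl⟩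
  have hpre : IsPreconnected ((↑) ⁻¹' S : Set (evenOrthGroup k n)) := by
    rw [← Topology.IsInducing.subtypeVal.isPreconnected_image]
    convert hS using 1
    exact (Subtype.image_preimage_coe _ _).trans (Set.inter_eq_right.2 hO)
  exact hpre.subset_connectedComponent (x := 1) h1 hg

lemma isPreconnected_evenSOGroup :
    IsPreconnected (evenSOGroup k n : Set (GL (Fin n ⊕ Fin n) k)) := by
  refine isPreconnected_closure_of_generators fun s hs => ⟨_, Subgroup.subset_closure,
    ⟨1, mem_connectedComponent, rfl⟩, hs, ?_⟩
  exact isPreconnected_connectedComponent.image _ continuous_subtype_val.continuousOn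

lemma conj_mem_evenSOGroup {g s : GL (Fin n ⊕ Fin n) k} (hg : g ∈ evenOrthGroup k n)
    (hs : s ∈ evenSOGroup k n) : g * s * g⁻¹ ∈ evenSOGroup k n := by
  refine subset_evenSOGroup (S := (fun x => g * x * g⁻¹) '' evenSOGroup k n) ?_ ?_ ?_ ⟨s, hs, rfl⟩
  · exact isPreconnected_evenSOGroup.image _
      (((isRegMap_const g).mul isRegMap_id).mul (isRegMap_const g⁻¹)).continuous.continuousOn
  · exact ⟨1, one_mem _, by simp⟩
  · rintro _ ⟨x, hx, rfl⟩
    exact mul_mem (mul_mem hg (evenSOGroup_le hx)) (inv_mem hg)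

lemma reflGL_mul_reflGL_mem [CharP k 2] [Infinite k] {a b : Fin n ⊕ Fin n → k}
    (ha : quadForm k n a ≠ 0) (hb : quadForm k n b ≠ 0) :
    reflGL a * reflGL b ∈ evenSOGroup k n := by
  have hlin : ∀ i, IsPolyFun fun t : k => (b + t • (a - b)) i := fun i =>
    (isPolyFun_const _).add (isPolyFun_id.mul (isPolyFun_const _))
  obtain ⟨d, hd⟩ : ∃ P : Polynomial k, ∀ t, quadForm k n (b + t • (a - b)) = P.eval t :=
    IsPolyFun.sum _ fun i _ => (hlin _).mul (hlin _)
  have hd0 : d ≠ 0 := by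
    rintro rfl
    have := hd 0
    simp [hb] at this
  have hpol : ∀ i, IsPolyFun fun t : k => polForm k n (b + t • (a - b)) (Pi.single i 1) := fun i =>
    IsPolyFun.sum Finset.univ fun l _ =>
      ((hlin (Sum.inl l)).mul (isPolyFun_const ((Pi.single i 1 : Fin n ⊕ Fin n → k) (Sum.inr l)))).add
        ((hlin (Sum.inr l)).mul (isPolyFun_const ((Pi.single i 1 : Fin n ⊕ Fin n → k) (Sum.inl l))))
  have hentry : ∀ i j, IsPolyFun fun t : k =>
      d.eval t * (if i = j then 1 else 0)
        + polForm k n (b + t • (a - b)) (Pi.single j 1) * (b + t • (a - b)) i := fun i j =>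
    (IsPolyFun.mul ⟨d, fun _ => rfl⟩ (isPolyFun_const _)).add ((hpol j).mul (hlin i))
  have heq : ∀ (t : k) (i j : Fin n ⊕ Fin n), d.eval t ≠ 0 →
      LinearMap.toMatrix' (reflMap (b + t • (a - b))) i j * d.eval t =
      d.eval t * (if i = j then 1 else 0)
        + polForm k n (b + t • (a - b)) (Pi.single j 1) * (b + t • (a - b)) i := by
    intro t i j ht
    rw [LinearMap.toMatrix'_apply, reflMap_apply, hd t]
    rw [Pi.add_apply, Pi.smul_apply, smul_eq_mul, Pi.single_apply]
    field_simp
  let γ : k → GL (Fin n ⊕ Fin n) k := fun t => reflGL (b + t • (a - b)) * reflGL b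
  have hirr := isPreirreducible_rational_curve γ d hd0 (by
    rintro (⟨i, j⟩ | ⟨i, j⟩)
    · obtain ⟨P, hP⟩ := IsPolyFun.sum Finset.univ fun l _ => (hentry i l).mul
        (isPolyFun_const ((LinearMap.toMatrix' (reflMap b)) l j))
      refine ⟨P, fun t ht => ?_⟩
      rw [← hP t]
      change (LinearMap.toMatrix' (reflMap (b + t • (a - b))) * LinearMap.toMatrix' (reflMap b) :
        Matrix _ _ k) i j * _ = _
      rw [Matrix.mul_apply, Finset.sum_mul]
      exact Finset.sum_congr rfl fun l _ => by rw [← heq t i l ht]; ring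
    · obtain ⟨P, hP⟩ := IsPolyFun.sum Finset.univ fun l _ =>
        (isPolyFun_const ((LinearMap.toMatrix' (reflMap b)) i l)).mul (hentry l j)
      refine ⟨P, fun t ht => ?_⟩
      rw [← hP t]
      change (LinearMap.toMatrix' (reflMap b) * LinearMap.toMatrix' (reflMap (b + t • (a - b))) :
        Matrix _ _ k) i j * _ = _
      rw [Matrix.mul_apply, Finset.sum_mul]
      exact Finset.sum_congr rfl fun l _ => by rw [← heq t l j ht]; ring)
  refine subset_evenSOGroup hirr.isPreconnected ⟨0, ?_, ?_⟩ ?_ ⟨1, ?_, ?_⟩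
  · simpa [← hd 0] using hb
  · simp only [γ, zero_smul, add_zero]
    nth_rw 1 [← reflGL_inv b]
    exact inv_mul_cancel _
  · rintro _ ⟨t, ht, rfl⟩
    exact mul_mem (reflGL_mem (by rwa [hd t])) (reflGL_mem hb)
  · simpa [← hd 1] using ha
  · simp [γ]

/-- The group generated by reflections. -/
def reflGroup (k : Type*) [Field k] [CharP k 2] (n : ℕ) : Subgroup (GL (Fin n ⊕ Fin n) k) :=
  Subgroup.closure {g | ∃ a, quadForm k n a ≠ 0 ∧ g = reflGL a}

lemma reflGL_mem_reflGroup [CharP k 2] {a : Fin n ⊕ Fin n → k} (ha : quadForm k n a ≠ 0) :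
    reflGL a ∈ reflGroup k n := Subgroup.subset_closure ⟨a, ha, rfl⟩

lemma reflGroup_le [CharP k 2] : reflGroup k n ≤ evenOrthGroup k n := by
  rw [reflGroup, Subgroup.closure_le]
  rintro _ ⟨a, ha, rfl⟩
  exact reflGL_mem ha

lemma mem_evenSOGroup_or [CharP k 2] [Infinite k] {a : Fin n ⊕ Fin n → k}
    (ha : quadForm k n a ≠ 0) {h : GL (Fin n ⊕ Fin n) k} (hh : h ∈ reflGroup k n) :
    h ∈ evenSOGroup k n ∨ h * reflGL a ∈ evenSOGroup k n := by
  have hr := reflGL_mem ha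
  have hrr : reflGL a * reflGL a = 1 := by
    nth_rw 1 [← reflGL_inv a]
    exact inv_mul_cancel _
  induction hh using Subgroup.closure_induction with
  | mem x hx =>
    obtain ⟨b, hb, rfl⟩ := hx
    exact Or.inr (reflGL_mul_reflGL_mem hb ha)
  | one => exact Or.inl (one_mem _)
  | mul x y _ _ hx hy =>
    rcases hx with hx | hx <;> rcases hy with hy | hy
    · exact Or.inl (mul_mem hx hy)
    · exact Or.inr (by rw [mul_assoc]; exact mul_mem hx hy)
    · refine Or.inr ?_
      have := mul_mem hx (conj_mem_evenSOGroup hr hy)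
      rw [reflGL_inv] at this
      convert this using 1
      simp only [mul_assoc]
      rw [← mul_assoc (reflGL a) (reflGL a), hrr, one_mul]
    · refine Or.inl ?_
      have := mul_mem hx (conj_mem_evenSOGroup hr hy)
      rw [reflGL_inv] at this
      convert this using 1
      simp only [mul_assoc]
      rw [hrr, ← mul_assoc (reflGL a) (reflGL a), hrr, one_mul, mul_one]
  | inv x _ hx =>
    rcases hx with hx | hx
    · exact Or.inl (inv_mem hx)
    · refine Or.inr ?_
      have := conj_mem_evenSOGroup hr (inv_mem hx)
      rw [mul_inv_rev, reflGL_inv, ← mul_assoc, hrr, one_mul] at this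
      exact this

end SpecialOrthogonal

section OrthogonalGeometry

lemma finrank_span_triple_le {V : Type*} [AddCommGroup V] [Module k V] (a b c : V) :
    Module.finrank k (Submodule.span k {a, b, c}) ≤ 3 := by
  classical
  have h := finrank_span_finset_le_card (R := k) ({a, b, c} : Finset V)
  rw [Finset.coe_insert, Finset.coe_insert, Finset.coe_singleton] at h
  exact h.trans Finset.card_le_three

lemma finrank_span_pair_le {V : Type*} [AddCommGroup V] [Module k V] (a b : V) :
    Module.finrank k (Submodule.span k {a, b}) ≤ 2 := by
  classical
  have h := finrank_span_finset_le_card (R := k) ({a, b} : Finset V)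
  rw [Finset.coe_insert, Finset.coe_singleton] at h
  exact h.trans Finset.card_le_two

lemma vec_add_self [CharP k 2] {ι : Type*} (v : ι → k) : v + v = 0 := by
  ext i
  exact CharTwo.add_self_eq_zero _

lemma exists_quadratic_root [IsAlgClosed k] (a : k) {b : k} (hb : b ≠ 0) (c : k) :
    ∃ s, a * s ^ 2 + b * s + c = 0 := by
  have hdeg : (Polynomial.C a * Polynomial.X ^ 2 + Polynomial.C b * Polynomial.X
      + Polynomial.C c).degree ≠ 0 := by
    intro h
    have h1 := Polynomial.natDegree_eq_of_degree_eq_some h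
    have h2 := Polynomial.coeff_eq_zero_of_natDegree_lt
      (p := Polynomial.C a * Polynomial.X ^ 2 + Polynomial.C b * Polynomial.X
      + Polynomial.C c) (n := 1) (by rw [h1]; exact one_pos)
    simp [Polynomial.coeff_X_pow, Polynomial.coeff_C] at h2
    exact hb h2
  obtain ⟨s, hs⟩ := IsAlgClosed.exists_root _ hdeg
  exact ⟨s, by simpa using hs⟩

lemma exists_polForm_ne {W : Submodule k (Fin n ⊕ Fin n → k)} {y : Fin n ⊕ Fin n → k}
    (hy : y ∉ W) : ∃ x, (∀ w ∈ W, polForm k n x w = 0) ∧ polForm k n x y ≠ 0 := by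
  rw [← LinearMap.BilinForm.orthogonal_orthogonal polForm_nondegenerate polForm_isRefl W,
    LinearMap.BilinForm.mem_orthogonal_iff] at hy
  push Not at hy
  obtain ⟨x, hx, hxy⟩ := hy
  refine ⟨x, fun w hw => ?_, hxy⟩
  rw [polForm_comm]
  exact hx w hw

lemma mem_span_singleton_of_polForm {e y : Fin n ⊕ Fin n → k}
    (h : ∀ x, polForm k n x e = 0 → polForm k n x y = 0) : ∃ c : k, y = c • e := by
  by_contra hcon
  have hy : y ∉ Submodule.span k {e} := fun hy => by
    obtain ⟨c, hc⟩ := Submodule.mem_span_singleton.1 hy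
    exact hcon ⟨c, hc.symm⟩
  obtain ⟨x, hx, hxy⟩ := exists_polForm_ne hy
  exact hxy (h x (hx e (Submodule.mem_span_singleton_self e)))

lemma exists_polForm_ne_of_ne_zero {y : Fin n ⊕ Fin n → k} (hy : y ≠ 0) :
    ∃ x, polForm k n y x ≠ 0 := by
  by_contra h
  push Not at h
  exact hy (eq_zero_of_polForm h)

lemma exists_nonsingular_perp [CharP k 2] {W : Submodule k (Fin n ⊕ Fin n → k)}
    (hW : Module.finrank k W < n) :
    ∃ z, (∀ w ∈ W, polForm k n z w = 0) ∧ quadForm k n z ≠ 0 := by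
  by_contra hcon
  push Not at hcon
  have h1 := LinearMap.BilinForm.finrank_orthogonal (B := polForm k n)
    polForm_nondegenerate W
  have hle : (polForm k n).orthogonal W ≤ W := by
    intro x hx
    have hsing : ∀ z ∈ (polForm k n).orthogonal W, quadForm k n z = 0 := fun z hz =>
      hcon z fun w hw => by rw [polForm_comm]; exact hz w hw
    rw [← LinearMap.BilinForm.orthogonal_orthogonal polForm_nondegenerate polForm_isRefl W]
    intro z hz
    have h2 := hsing _ (add_mem hz hx)
    rw [quadForm_add, hsing z hz, hsing x hx, zero_add, zero_add] at h2
    exact h2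
  have h2 := Submodule.finrank_mono hle
  rw [Module.finrank_fintype_fun_eq_card, Fintype.card_sum, Fintype.card_fin] at h1
  omega

lemma exists_reflGroup_map [CharP k 2] [IsAlgClosed k] {S : Set (Fin n ⊕ Fin n → k)}
    {v e y y' : Fin n ⊕ Fin n → k} (hQ : quadForm k n v = quadForm k n e)
    (hv : ∀ s ∈ S, polForm k n v s = 0) (he : ∀ s ∈ S, polForm k n e s = 0)
    (hy : ∀ s ∈ S, polForm k n y s = 0) (hy' : ∀ s ∈ S, polForm k n y' s = 0)
    (hvy : polForm k n v y ≠ 0) (hey' : polForm k n e y' ≠ 0) :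
    ∃ h ∈ reflGroup k n, (∀ s ∈ S, glAct _ k h s = s) ∧ glAct _ k h v = e := by
  have key : ∀ a b : Fin n ⊕ Fin n → k, quadForm k n a = quadForm k n b →
      (∀ s ∈ S, polForm k n a s = 0) → (∀ s ∈ S, polForm k n b s = 0) → polForm k n a b ≠ 0 →
      ∃ h ∈ reflGroup k n, (∀ s ∈ S, glAct _ k h s = s) ∧ glAct _ k h a = b := by
    intro a b hab ha hb hne
    have hQab : quadForm k n (a + b) = polForm k n a b := by
      rw [quadForm_add, hab, CharTwo.add_self_eq_zero, zero_add]
    refine ⟨reflGL (a + b), reflGL_mem_reflGroup (by rwa [hQab]), fun s hs => ?_, ?_⟩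
    · rw [glAct_reflGL, reflMap_apply, map_add, LinearMap.add_apply, ha s hs, hb s hs, add_zero,
        mul_zero, zero_smul, add_zero]
    · rw [glAct_reflGL, reflMap_apply, hQab, map_add, LinearMap.add_apply, polForm_self, zero_add,
        polForm_comm b a, inv_mul_cancel₀ hne, one_smul, ← add_assoc,
        vec_add_self, zero_add]
  by_cases hve : polForm k n v e = 0
  swap
  · exact key v e hQ hv he hve
  obtain ⟨w₀, hw₀, hvw, hew⟩ : ∃ w₀, (∀ s ∈ S, polForm k n w₀ s = 0) ∧ polForm k n v w₀ ≠ 0 ∧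
      polForm k n e w₀ ≠ 0 := by
    by_cases h1 : polForm k n e y = 0
    swap
    · exact ⟨y, hy, hvy, h1⟩
    by_cases h2 : polForm k n v y' = 0
    swap
    · exact ⟨y', hy', h2, hey'⟩
    refine ⟨y + y', fun s hs => ?_, ?_, ?_⟩
    · rw [map_add, LinearMap.add_apply, hy s hs, hy' s hs, add_zero]
    · rwa [map_add, h2, add_zero]
    · rwa [map_add, h1, zero_add]
  obtain ⟨s, hs⟩ := exists_quadratic_root (quadForm k n e) hew
    (quadForm k n w₀ - quadForm k n v)
  have hQw : quadForm k n v = quadForm k n (w₀ + s • e) := by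
    rw [quadForm_add, quadForm_smul, map_smul, smul_eq_mul, polForm_comm w₀ e]
    linear_combination -hs
  have hwS : ∀ x ∈ S, polForm k n (w₀ + s • e) x = 0 := fun x hx => by
    rw [map_add, LinearMap.add_apply, map_smul, LinearMap.smul_apply, hw₀ x hx, he x hx,
      smul_zero, add_zero]
  obtain ⟨h₁, hm₁, hS₁, hv₁⟩ := key v (w₀ + s • e) hQw hv hwS (by
    rwa [map_add, map_smul, hve, smul_zero, add_zero])
  obtain ⟨h₂, hm₂, hS₂, hv₂⟩ := key (w₀ + s • e) e (hQw.symm.trans hQ) hwS he (by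
    rw [polForm_comm, map_add, map_smul, polForm_self, smul_zero, add_zero]
    exact hew)
  exact ⟨h₂ * h₁, mul_mem hm₂ hm₁, fun x hx => by rw [glAct_mul_apply, hS₁ x hx, hS₂ x hx],
    by rw [glAct_mul_apply, hv₁, hv₂]⟩

lemma exists_evenSOGroup_map [CharP k 2] [IsAlgClosed k] {v w : Fin n ⊕ Fin n → k}
    (hv : quadForm k n v ≠ 0) (hQ : quadForm k n v = quadForm k n w) :
    ∃ h ∈ evenSOGroup k n, glAct _ k h v = w := by
  have hne : ∀ x : Fin n ⊕ Fin n → k, quadForm k n x ≠ 0 → x ≠ 0 := by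
    rintro _ h rfl
    exact h quadForm_zero
  obtain ⟨y, hy⟩ := exists_polForm_ne_of_ne_zero (hne v hv)
  obtain ⟨y', hy'⟩ := exists_polForm_ne_of_ne_zero (hne w (hQ ▸ hv))
  obtain ⟨h, hh, -, hvw⟩ := exists_reflGroup_map (S := ∅) hQ (by simp) (by simp) (by simp)
    (by simp) hy hy'
  have := IsAlgClosed.instInfinite (K := k)
  rcases mem_evenSOGroup_or hv hh with h1 | h1
  · exact ⟨h, h1, hvw⟩
  · refine ⟨_, h1, ?_⟩
    rw [glAct_mul_apply, glAct_reflGL, reflMap_apply, polForm_self, mul_zero, zero_smul, add_zero,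
      hvw]

lemma exists_evenSOGroup_map_pair [CharP k 2] [IsAlgClosed k] (hn : 2 < n)
    {e₁ e₂ e w : Fin n ⊕ Fin n → k} (he₁ : quadForm k n e₁ = 0) (he₁0 : e₁ ≠ 0)
    (he : quadForm k n e = 0) (he0 : e ≠ 0) (h₁₂ : polForm k n e₂ e₁ = 0)
    (hew : polForm k n w e = 0) (hind : ∀ c : k, e₂ ≠ c • e₁) (hind' : ∀ c : k, w ≠ c • e)
    (hQ : quadForm k n e₂ = quadForm k n w) :
    ∃ h ∈ evenSOGroup k n, glAct _ k h e₁ = e ∧ glAct _ k h e₂ = w := by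
  have := IsAlgClosed.instInfinite (K := k)
  obtain ⟨y, hy⟩ := exists_polForm_ne_of_ne_zero he₁0
  obtain ⟨y', hy'⟩ := exists_polForm_ne_of_ne_zero he0
  obtain ⟨h₁, hh₁, -, hv₁⟩ := exists_reflGroup_map (S := ∅) (he₁.trans he.symm) (by simp)
    (by simp) (by simp) (by simp) hy hy'
  have hO := reflGroup_le hh₁
  have hperp : ∀ x : Fin n ⊕ Fin n → k, (∀ c : k, x ≠ c • e) →
      ∃ y, polForm k n y e = 0 ∧ polForm k n x y ≠ 0 := by
    intro x hx
    obtain ⟨y, hy1, hy2⟩ := exists_polForm_ne (W := Submodule.span k {e}) (y := x) (by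
      rw [Submodule.mem_span_singleton]
      rintro ⟨c, hc⟩
      exact hx c hc.symm)
    exact ⟨y, hy1 e (Submodule.mem_span_singleton_self e), by rwa [polForm_comm]⟩
  obtain ⟨x, hx1, hx2⟩ := hperp (glAct _ k h₁ e₂) (by
    intro c hc
    refine hind c ?_
    rw [← hv₁, ← map_smul] at hc
    rw [← glAct_inv_self h₁ e₂, hc, glAct_inv_self])
  obtain ⟨x', hx1', hx2'⟩ := hperp w hind'
  obtain ⟨h₂, hh₂, hS₂, hv₂⟩ := exists_reflGroup_map (S := {e}) (v := glAct _ k h₁ e₂) (e := w)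
    (y := x) (y' := x') (by rw [mem_evenOrthGroup.1 hO, hQ])
    (by simp only [Set.mem_singleton_iff, forall_eq]; rw [← hv₁, polForm_glAct hO, h₁₂])
    (by simpa only [Set.mem_singleton_iff, forall_eq] using hew)
    (by simpa only [Set.mem_singleton_iff, forall_eq] using hx1)
    (by simpa only [Set.mem_singleton_iff, forall_eq] using hx1') hx2 hx2'
  obtain ⟨z, hz, hQz⟩ := exists_nonsingular_perp (W := Submodule.span k {e₁, e₂})
    (lt_of_le_of_lt (finrank_span_pair_le e₁ e₂) hn)
  have hz₁ := hz e₁ (Submodule.subset_span (by simp))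
  have hz₂ := hz e₂ (Submodule.subset_span (by simp))
  have ha : glAct _ k (h₂ * h₁) e₁ = e := by
    rw [glAct_mul_apply, hv₁, hS₂ e rfl]
  have hb : glAct _ k (h₂ * h₁) e₂ = w := by
    rw [glAct_mul_apply, hv₂]
  rcases mem_evenSOGroup_or hQz (mul_mem hh₂ hh₁) with h | h
  · exact ⟨_, h, ha, hb⟩
  · refine ⟨_, h, ?_, ?_⟩
    · rw [glAct_mul_apply, glAct_reflGL, reflMap_apply, hz₁, mul_zero, zero_smul, add_zero, ha]
    · rw [glAct_mul_apply, glAct_reflGL, reflMap_apply, hz₂, mul_zero, zero_smul, add_zero, hb]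

end OrthogonalGeometry

section LinearFormsOnQuadrics

omit [Field k] in
lemma exists_ne_ne_ne [Infinite k] (a b c : k) : ∃ s, s ≠ a ∧ s ≠ b ∧ s ≠ c := by
  classical
  obtain ⟨s, hs⟩ := Infinite.exists_notMem_finset ({a, b, c} : Finset k)
  simp only [Finset.mem_insert, Finset.mem_singleton, not_or] at hs
  exact ⟨s, hs⟩

variable {e : Fin n ⊕ Fin n → k}

lemma dual_eq_zero_of_singular [CharP k 2] [IsAlgClosed k] (heQ : quadForm k n e = 0)
    (φ : Module.Dual k (Fin n ⊕ Fin n → k))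
    (h : ∀ w, polForm k n w e = 0 → quadForm k n w = 0 → φ w = 0) {w : Fin n ⊕ Fin n → k}
    (hw : polForm k n w e = 0) : φ w = 0 := by
  by_cases hQw : quadForm k n w = 0
  · exact h w hw hQw
  obtain ⟨x₀, hx₀, hx₀w⟩ : ∃ x₀, polForm k n x₀ e = 0 ∧ polForm k n x₀ w ≠ 0 := by
    by_contra hcon
    push Not at hcon
    obtain ⟨c, rfl⟩ := mem_span_singleton_of_polForm hcon
    rw [quadForm_smul, heQ, mul_zero] at hQw
    exact hQw rfl
  obtain ⟨s, hs⟩ := exists_quadratic_root (quadForm k n w) hx₀w (quadForm k n x₀)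
  set x := x₀ + s • w with hx
  have hxe : polForm k n x e = 0 := by simp [hx, hx₀, hw]
  have hxQ : quadForm k n x = 0 := by
    rw [hx, quadForm_add, quadForm_smul, map_smul, smul_eq_mul]
    linear_combination hs
  have hxw : polForm k n x w ≠ 0 := by simpa [hx, polForm_self] using hx₀w
  have h1 := h x hxe hxQ
  have h2 := h (w + (-(quadForm k n w) / polForm k n x w) • x) (by simp [hxe, hw]) (by
    rw [quadForm_add, quadForm_smul, map_smul, smul_eq_mul, polForm_comm w x, hxQ]
    field_simp
    ring)
  rwa [map_add, map_smul, h1, smul_zero, add_zero] at h2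

lemma dual_eq_zero_of_nonsingular [CharP k 2] [IsAlgClosed k] (hn : 1 < n)
    (φ : Module.Dual k (Fin n ⊕ Fin n → k))
    (h : ∀ w, polForm k n w e = 0 → quadForm k n w ≠ 0 → φ w = 0) {w : Fin n ⊕ Fin n → k}
    (hw : polForm k n w e = 0) : φ w = 0 := by
  by_cases hQw : quadForm k n w = 0
  swap
  · exact h w hw hQw
  obtain ⟨z, hz, hQz⟩ := exists_nonsingular_perp (W := Submodule.span k {e})
    (lt_of_le_of_lt (finrank_span_le_card _) (by simpa using hn))
  have hze := hz e (Submodule.mem_span_singleton_self e)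
  have h1 := h z hze hQz
  have hQ : ∀ t : k, quadForm k n (z + t • w) = quadForm k n z + t * polForm k n z w := by
    intro t
    rw [quadForm_add, quadForm_smul, hQw, map_smul, smul_eq_mul]
    ring
  have := IsAlgClosed.instInfinite (K := k)
  obtain ⟨t, ht⟩ := exists_ne_ne_ne 0 (-(quadForm k n z) / polForm k n z w) 0
  have h2 := h (z + t • w) (by simp [hze, hw]) (by
    rw [hQ]
    intro h0
    by_cases hzw : polForm k n z w = 0
    · rw [hzw, mul_zero, add_zero] at h0
      exact hQz h0
    · refine ht.2.1 ?_
      field_simp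
      linear_combination h0)
  rw [map_add, map_smul, h1, zero_add, smul_eq_mul] at h2
  exact (mul_eq_zero.1 h2).resolve_left ht.1

lemma dual_mul_eq_zero_of_singular [CharP k 2] [IsAlgClosed k] (hn : 3 < n)
    (heQ : quadForm k n e = 0) (φ ψ : Module.Dual k (Fin n ⊕ Fin n → k))
    (h : ∀ w, polForm k n w e = 0 → quadForm k n w = 0 → φ w * ψ w = 0) :
    (∀ w, polForm k n w e = 0 → φ w = 0) ∨ (∀ w, polForm k n w e = 0 → ψ w = 0) := by
  by_contra hcon
  rw [not_or] at hcon
  obtain ⟨x, hxe, hxQ, hx⟩ : ∃ x, polForm k n x e = 0 ∧ quadForm k n x = 0 ∧ φ x ≠ 0 := by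
    by_contra h'
    push Not at h'
    exact hcon.1 fun w hw => dual_eq_zero_of_singular heQ φ h' hw
  obtain ⟨y, hye, hyQ, hy⟩ : ∃ y, polForm k n y e = 0 ∧ quadForm k n y = 0 ∧ ψ y ≠ 0 := by
    by_contra h'
    push Not at h'
    exact hcon.2 fun w hw => dual_eq_zero_of_singular heQ ψ h' hw
  have hψx := (mul_eq_zero.1 (h x hxe hxQ)).resolve_left hx
  have hφy := (mul_eq_zero.1 (h y hye hyQ)).resolve_right hy
  by_cases hxy : polForm k n x y = 0
  · have := h (x + y) (by simp [hxe, hye]) (by rw [quadForm_add, hxQ, hyQ, hxy]; ring)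
    rw [map_add, map_add, hψx, hφy, add_zero, zero_add] at this
    exact mul_ne_zero hx hy this
  obtain ⟨z, hz, hQz⟩ := exists_nonsingular_perp (W := Submodule.span k {e, x, y})
    (lt_of_le_of_lt (finrank_span_triple_le e x y) hn)
  have hze := hz e (Submodule.subset_span (by simp))
  have hzx := hz x (Submodule.subset_span (by simp))
  have hzy := hz y (Submodule.subset_span (by simp))
  have := IsAlgClosed.instInfinite (K := k)
  set C := quadForm k n z * ψ y / polForm k n x y with hC
  have hC0 : C ≠ 0 := div_ne_zero (mul_ne_zero hQz hy) hxy
  obtain ⟨s, hs⟩ := exists_ne_ne_ne 0 (-φ x / φ z) (ψ z / C)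
  have h1 := h (x + (-(s ^ 2 * quadForm k n z) / polForm k n x y) • y + s • z)
    (by simp [hxe, hye, hze]) (by
      rw [quadForm_add, quadForm_add, quadForm_smul, quadForm_smul, hxQ, hyQ]
      simp only [map_add, map_smul, LinearMap.add_apply, LinearMap.smul_apply, smul_eq_mul,
        polForm_comm x z, polForm_comm y z, hzx, hzy]
      field_simp
      ring)
  simp only [map_add, map_smul, smul_eq_mul, hψx, hφy, mul_zero, add_zero, zero_add] at h1
  have h2 : -(s ^ 2 * quadForm k n z) / polForm k n x y * ψ y = -(s ^ 2 * C) := by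
    rw [hC]; ring
  rw [h2] at h1
  rcases mul_eq_zero.1 h1 with h3 | h3
  · by_cases hφz : φ z = 0
    · rw [hφz, mul_zero, add_zero] at h3
      exact hx h3
    · refine hs.2.1 ?_
      field_simp
      linear_combination h3
  · refine hs.2.2 ?_
    have h4 : s * (ψ z - s * C) = 0 := by linear_combination h3
    have h5 := (mul_eq_zero.1 h4).resolve_left hs.1
    field_simp
    linear_combination -h5

end LinearFormsOnQuadrics

section LieKolchin

open scoped commutatorElement

/-- A set of functions on a group which is stable under the substitutions `x ↦ a x⁻¹ y x b` and
for which the group is connected. -/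
structure IsConnectedFunctionSet {H : Type*} [Group H] (A : Set (H → k)) : Prop where
  conj_mem : ∀ f ∈ A, ∀ a y b, (fun x => f (a * x⁻¹ * y * x * b)) ∈ A
  eq_of_finite : ∀ f ∈ A, (Set.range f).Finite → ∀ x y, f x = f y

omit [Field k] in
lemma IsConnectedFunctionSet.restrict_commutator {H : Type*} [Group H] {A : Set (H → k)}
    (hA : IsConnectedFunctionSet A) :
    IsConnectedFunctionSet {g : commutator H → k | ∃ f ∈ A, ∀ x, g x = f x} where
  conj_mem := by
    rintro g ⟨f, hf, hg⟩ a y b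
    refine ⟨fun x => f (a * x⁻¹ * y * x * b), hA.conj_mem f hf a y b, fun x => hg _⟩
  eq_of_finite := by
    rintro g ⟨f, hf, hg⟩ hfin
    have h1 : ∀ y ∈ commutator H, ∀ a ∈ commutator H, f (a * y) = f a := by
      intro y hy
      have hy' := hy
      rw [commutator_eq_closure] at hy
      induction hy using Subgroup.closure_induction with
      | mem x hx =>
        obtain ⟨p, q, rfl⟩ := hx
        intro a ha
        have hfin' : (Set.range fun x => f (a * x⁻¹ * q * x * q⁻¹)).Finite := by
          refine hfin.subset ?_
          rintro _ ⟨x, rfl⟩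
          have hmem : a * x⁻¹ * q * x * q⁻¹ ∈ commutator H := by
            have h2 : ⁅x⁻¹, q⁆ ∈ commutator H :=
              Subgroup.commutator_mem_commutator (Subgroup.mem_top _) (Subgroup.mem_top _)
            have h3 := mul_mem ha h2
            rw [commutatorElement_def, inv_inv] at h3
            simpa only [mul_assoc] using h3
          exact ⟨⟨_, hmem⟩, hg _⟩
        have h4 := hA.eq_of_finite _ (hA.conj_mem f hf a q q⁻¹) hfin' p⁻¹ 1
        simpa [commutatorElement_def, mul_assoc] using h4
      | one => simp
      | mul x y hx hy ihx ihy =>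
        intro a ha
        rw [← commutator_eq_closure] at hx hy
        rw [← mul_assoc, ihy hy _ (mul_mem ha hx), ihx hx a ha]
      | inv x hx ih =>
        intro a ha
        rw [← commutator_eq_closure] at hx
        rw [← ih hx _ (mul_mem ha (inv_mem hx)), inv_mul_cancel_right]
    intro x y
    rw [hg, hg]
    have h2 := h1 x x.2 1 (one_mem _)
    have h3 := h1 y y.2 1 (one_mem _)
    rw [one_mul] at h2 h3
    rw [h2, h3]

lemma map_derivedSeries_commutator (H : Type*) [Group H] (d : ℕ) :
    (derivedSeries (commutator H) d).map (commutator H).subtype = derivedSeries H (d + 1) := by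
  induction d with
  | zero =>
    rw [derivedSeries_zero, derivedSeries_one, ← MonoidHom.range_eq_map, Subgroup.range_subtype]
  | succ d ih =>
    rw [derivedSeries_succ, Subgroup.map_commutator, ih, ← derivedSeries_succ]

lemma exists_common_eigenvector [IsAlgClosed k] {W : Type*} [AddCommGroup W] [Module k W]
    [FiniteDimensional k W] (d : ℕ) :
    ∀ (H : Type*) [Group H] (A : Set (H → k)), IsConnectedFunctionSet A → derivedSeries H d = ⊥ →
    ∀ (ρ : H →* Module.End k W), (∀ (φ : Module.Dual k W) w, (fun h => φ (ρ h w)) ∈ A) →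
    ∀ W₀ : Submodule k W, W₀ ≠ ⊥ → (∀ h, ∀ w ∈ W₀, ρ h w ∈ W₀) →
    ∃ w ∈ W₀, w ≠ 0 ∧ ∀ h, ∃ c : k, ρ h w = c • w := by
  induction d with
  | zero =>
    intro H _ A _ hd ρ _ W₀ hW₀ _
    obtain ⟨w, hw, hw0⟩ := Submodule.exists_mem_ne_zero_of_ne_bot hW₀
    refine ⟨w, hw, hw0, fun h => ⟨1, ?_⟩⟩
    have : h ∈ derivedSeries H 0 := by simp
    rw [hd, Subgroup.mem_bot] at this
    simp [this]
  | succ d ih =>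
    intro H _ A hA hd ρ hρ W₀ hW₀ hst
    obtain ⟨W₁, ⟨hW₁, hle, hst₁⟩, hmin⟩ := IsArtinian.set_has_minimal
      {U : Submodule k W | U ≠ ⊥ ∧ U ≤ W₀ ∧ ∀ h, ∀ w ∈ U, ρ h w ∈ U} ⟨W₀, hW₀, le_rfl, hst⟩
    have hmin' : ∀ U : Submodule k W, U ≠ ⊥ → U ≤ W₁ → (∀ h, ∀ w ∈ U, ρ h w ∈ U) → W₁ ≤ U := by
      intro U hU hUW hUst
      by_contra hcon
      exact hmin U ⟨hU, hUW.trans hle, hUst⟩ (lt_of_le_not_ge hUW hcon)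
    have hmul : ∀ a b w, ρ (a * b) w = ρ a (ρ b w) := fun a b w => by rw [map_mul]; rfl
    have hne : ∀ h w, w ≠ 0 → ρ h w ≠ 0 := by
      intro h w hw h0
      apply hw
      have h1 : ρ (h⁻¹ * h) w = 0 := by rw [hmul, h0, map_zero]
      simpa using h1
    have hswap : ∀ b h w, ρ b (ρ h w) = ρ h (ρ (h⁻¹ * b * h) w) := fun b h w => by
      rw [← hmul, ← hmul]; congr 2; group
    -- scalars by which conjugates act are constant
    have key : ∀ (b : H) (v : W), v ≠ 0 → (∀ h, ∃ c : k, ρ (h⁻¹ * b * h) v = c • v) →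
        ∀ c : k, ρ b v = c • v → ∀ h, ρ b (ρ h v) = c • ρ h v := by
      intro b v hv hsc c hc h
      choose χ hχ using hsc
      obtain ⟨φ, hφ⟩ : ∃ φ : Module.Dual k W, φ v ≠ 0 := by
        by_contra hcon
        push Not at hcon
        exact hv ((Module.forall_dual_apply_eq_zero_iff k v).1 hcon)
      have hmem := hA.conj_mem _ (hρ φ v) 1 b 1
      simp only [one_mul, mul_one, hχ, map_smul, smul_eq_mul] at hmem
      have hfin : (Set.range fun x => χ x * φ v).Finite := by
        refine ((Module.End.finite_hasEigenvalue (ρ b)).image (fun c => c * φ v)).subset ?_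
        rintro _ ⟨x, rfl⟩
        refine ⟨χ x, ?_, rfl⟩
        refine Module.End.hasEigenvalue_of_hasEigenvector (x := ρ x v)
          ⟨Module.End.mem_eigenspace_iff.2 ?_, hne x v hv⟩
        rw [hswap, hχ, map_smul]
      have h1 := mul_right_cancel₀ hφ (hA.eq_of_finite _ hmem hfin h 1)
      have h2 := hχ 1
      simp only [inv_one, one_mul, mul_one, hc] at h2
      rw [hswap, hχ, h1, ← smul_left_injective k hv h2, map_smul]
    -- the commutator subgroup acts by scalars on `W₁`
    have hK : ∀ y ∈ commutator H, ∃ c : k, ∀ w ∈ W₁, ρ y w = c • w := by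
      have hd' : derivedSeries (commutator H) d = ⊥ := by
        have h1 := map_derivedSeries_commutator H d
        rw [hd, Subgroup.map_eq_bot_iff_of_injective _ (Subgroup.subtype_injective _)] at h1
        exact h1
      obtain ⟨w, hw, hw0, hχ⟩ := ih (commutator H) _ hA.restrict_commutator hd'
        (ρ.comp (commutator H).subtype) (fun φ w => ⟨_, hρ φ w, fun x => rfl⟩) W₁ hW₁
        (fun h => hst₁ h)
      choose χ hχ using hχ
      let U : Submodule k W := ⨅ y : commutator H, (Module.End.eigenspace (ρ y) (χ y)) ⊓ W₁
      have hU : ∀ v, v ∈ U ↔ ∀ y : commutator H, ρ y v = χ y • v ∧ v ∈ W₁ := by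
        intro v
        simp [U, Submodule.mem_iInf]
      have hW₁U := hmin' U (by
        rw [Submodule.ne_bot_iff]
        exact ⟨w, (hU w).2 fun y => ⟨hχ y, hw⟩, hw0⟩) (fun v hv => ((hU v).1 hv 1).2) (by
        intro h v hv
        rw [hU] at hv ⊢
        intro y
        refine ⟨?_, hst₁ h v (hv 1).2⟩
        by_cases hv0 : v = 0
        · simp [hv0]
        · refine key y v hv0 (fun h => ?_) _ (hv y).1 h
          have hmem : h⁻¹ * y * h ∈ commutator H := by
            simpa using (inferInstance : (commutator H).Normal).conj_mem y y.2 h⁻¹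
          exact ⟨_, (hv ⟨_, hmem⟩).1⟩)
      exact fun y hy => ⟨χ ⟨y, hy⟩, fun w hw => ((hU w).1 (hW₁U hw) ⟨y, hy⟩).1⟩
    have hscal : ∀ b, ∃ c : k, ∀ w ∈ W₁, ρ b w = c • w := by
      intro b
      have : Nontrivial W₁ := Submodule.nontrivial_iff_ne_bot.2 hW₁
      obtain ⟨c, hc⟩ := Module.End.exists_eigenvalue ((ρ b).restrict (hst₁ b))
      obtain ⟨v, hv, hv0⟩ := hc.exists_hasEigenvector
      have hv' := congrArg Subtype.val (Module.End.mem_eigenspace_iff.1 hv)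
      have hW₁U := hmin' (Module.End.eigenspace (ρ b) c ⊓ W₁) (by
        rw [Submodule.ne_bot_iff]
        exact ⟨v, ⟨Module.End.mem_eigenspace_iff.2 hv', v.2⟩, by simpa using hv0⟩)
        inf_le_right (by
        rintro h w ⟨hw1, hw2⟩
        refine ⟨Module.End.mem_eigenspace_iff.2 ?_, hst₁ h w hw2⟩
        have hw1' := Module.End.mem_eigenspace_iff.1 hw1
        by_cases hw0 : w = 0
        · simp [hw0]
        · refine key b w hw0 (fun h => ?_) c hw1' h
          obtain ⟨c', hc'⟩ := hK ⁅h⁻¹, b⁆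
            (Subgroup.commutator_mem_commutator (Subgroup.mem_top _) (Subgroup.mem_top _))
          refine ⟨c' * c, ?_⟩
          have h1 : h⁻¹ * b * h = (⁅h⁻¹, b⁆ : H) * b := by
            rw [commutatorElement_def]; group
          rw [h1, hmul, hw1', map_smul, hc' w hw2, smul_smul, mul_comm])
      exact ⟨c, fun w hw => Module.End.mem_eigenspace_iff.1 (hW₁U hw).1⟩
    obtain ⟨w, hw, hw0⟩ := Submodule.exists_mem_ne_zero_of_ne_bot hW₁
    exact ⟨w, hle hw, hw0, fun h => (hscal h).imp fun c hc => hc w hw⟩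

variable {m : Type*} [DecidableEq m] [Fintype m]

/-- The Lie-Kolchin theorem, for a subquotient of the natural module. -/
lemma exists_eigenvector_mod [IsAlgClosed k] {B : Subgroup (GL m k)}
    (hB : IsPreconnected (B : Set (GL m k))) [Group.IsSolvable B] {F U : Submodule k (m → k)}
    (hF : ∀ b ∈ B, ∀ v ∈ F, glAct m k b v ∈ F) (hU : ∀ b ∈ B, ∀ v ∈ U, glAct m k b v ∈ U)
    (hUF : ¬ U ≤ F) :
    ∃ w ∈ U, w ∉ F ∧ ∀ b ∈ B, ∃ c : k, glAct m k b w - c • w ∈ F := by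
  let ρ : B →* Module.End k ((m → k) ⧸ F) :=
    { toFun := fun b => F.mapQ F (glAct m k b) (hF b b.2)
      map_one' := by
        ext v
        simp
      map_mul' := fun a b => by
        apply LinearMap.ext
        intro v
        obtain ⟨v, rfl⟩ := F.mkQ_surjective v
        simp }
  have hρ : ∀ (b : B) v, ρ b (F.mkQ v) = F.mkQ (glAct m k b v) := fun b v => rfl
  obtain ⟨d, hd⟩ := (Group.isSolvable_def B).1 inferInstance
  obtain ⟨w, hw, hw0, hev⟩ := exists_common_eigenvector d B
    {g : B → k | ∃ f ∈ glReg m k, ∀ b, g b = f b}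
    { conj_mem := by
        rintro g ⟨f, hf, hg⟩ a y b
        refine ⟨fun x => f (a * x⁻¹ * y * x * b), ?_, fun x => hg _⟩
        exact (((((isRegMap_const _).mul isRegMap_id.inv).mul (isRegMap_const _)).mul
          isRegMap_id).mul (isRegMap_const _)).comp_mem hf
      eq_of_finite := by
        rintro g ⟨f, hf, hg⟩ hfin x y
        rw [hg, hg]
        refine hB.glReg_eq_of_finite hf (hfin.subset ?_) x.2 y.2
        rintro _ ⟨b, hb, rfl⟩
        exact ⟨⟨b, hb⟩, hg _⟩ } hd ρ (by
      intro φ w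
      obtain ⟨w, rfl⟩ := F.mkQ_surjective w
      exact ⟨_, linear_glAct_mem (φ.comp F.mkQ) w, fun b => rfl⟩) (U.map F.mkQ) (by
      rw [Ne, ← le_bot_iff, Submodule.map_le_iff_le_comap, ← LinearMap.ker, Submodule.ker_mkQ]
      exact hUF) (by
      rintro b _ ⟨v, hv, rfl⟩
      exact ⟨_, hU b b.2 v hv, rfl⟩)
  obtain ⟨v, hv, rfl⟩ := hw
  refine ⟨v, hv, fun hvF => hw0 (by simpa using hvF), fun b hb => ?_⟩
  obtain ⟨c, hc⟩ := hev ⟨b, hb⟩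
  refine ⟨c, ?_⟩
  rw [hρ, ← map_smul, ← sub_eq_zero, ← map_sub] at hc
  exact (Submodule.Quotient.mk_eq_zero F).1 hc

end LieKolchin

section Flags

open scoped commutatorElement

variable {m : Type*} [DecidableEq m] [Fintype m]

/-- A chain of subspaces with steps of dimension at most one, which exhausts `k ^ m` in
`d` steps and is stabilised by `S`. -/
structure IsStableFlag (d : ℕ) (F : ℕ → Submodule k (m → k)) (S : Set (GL m k)) : Prop where
  zero : F 0 = ⊥
  top : F d = ⊤
  mono : ∀ i, F i ≤ F (i + 1)
  step : ∀ i, ∃ w ∈ F (i + 1), F (i + 1) ≤ F i ⊔ Submodule.span k {w}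
  stable : ∀ g ∈ S, ∀ i, ∀ v ∈ F i, glAct m k g v ∈ F i

variable {d : ℕ} {F : ℕ → Submodule k (m → k)}

/-- The elements of a group stabilising a flag which lower the filtration by `s`. -/
def flagLowering {H : Type*} [Group H] {ρ : H →* GL m k}
    (hF : IsStableFlag d F (Set.range ρ)) (s : ℕ) : Subgroup H where
  carrier := {h | ∀ i, ∀ v ∈ F i, glAct m k (ρ h) v - v ∈ F (i - s)}
  mul_mem' := by
    intro a b ha hb i v hv
    have h1 : glAct m k (ρ (a * b)) v - v
        = glAct m k (ρ a) (glAct m k (ρ b) v - v) + (glAct m k (ρ a) v - v) := by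
      rw [map_mul, glAct_mul_apply, map_sub]; abel
    rw [h1]
    exact add_mem (hF.stable _ ⟨a, rfl⟩ _ _ (hb i v hv)) (ha i v hv)
  one_mem' := by
    intro i v _
    simp
  inv_mem' := by
    intro a ha i v hv
    have h1 : glAct m k (ρ a⁻¹) v - v = - glAct m k (ρ a⁻¹) (glAct m k (ρ a) v - v) := by
      rw [map_inv, map_sub, glAct_inv_self]; abel
    rw [h1]
    exact neg_mem (hF.stable _ ⟨a⁻¹, rfl⟩ _ _ (ha i v hv))

lemma IsStableFlag.derivedSeries_le {H : Type*} [Group H] {ρ : H →* GL m k}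
    (hF : IsStableFlag d F (Set.range ρ)) (s : ℕ) : derivedSeries H s ≤ flagLowering hF s := by
  have key : ∀ (s : ℕ) (a b : H),
      (∀ i, ∀ v ∈ F i, glAct m k (ρ a) (glAct m k (ρ b) v) - glAct m k (ρ b) (glAct m k (ρ a) v)
        ∈ F (i - s)) → ⁅a, b⁆ ∈ flagLowering hF s := by
    intro s a b hab i v hv
    have h1 := hab i _ (hF.stable _ ⟨a⁻¹, rfl⟩ _ _ (hF.stable _ ⟨b⁻¹, rfl⟩ _ _ hv))
    have h2 : glAct m k (ρ ⁅a, b⁆) v - v =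
        glAct m k (ρ a) (glAct m k (ρ b) (glAct m k (ρ a⁻¹) (glAct m k (ρ b⁻¹) v)))
        - glAct m k (ρ b) (glAct m k (ρ a) (glAct m k (ρ a⁻¹) (glAct m k (ρ b⁻¹) v))) := by
      rw [commutatorElement_def, map_mul ρ, map_mul ρ, map_mul ρ, glAct_mul_apply,
        glAct_mul_apply, glAct_mul_apply, map_inv ρ, map_inv ρ, glAct_self_inv (ρ a), glAct_self_inv]
    rw [h2]
    exact h1
  have hanti : ∀ a b, a ≤ b → F a ≤ F b := fun a b h => monotone_nat_of_le_succ hF.mono h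
  induction s with
  | zero =>
    intro h _ i v hv
    exact sub_mem (hF.stable _ ⟨h, rfl⟩ _ _ hv) hv
  | succ s ih =>
    rw [derivedSeries_succ, Subgroup.commutator_le]
    intro a ha b hb
    have ha' := ih ha
    have hb' := ih hb
    apply key
    intro i v hv
    rcases s.eq_zero_or_pos with rfl | hs
    · cases i with
      | zero =>
        rw [hF.zero, Submodule.mem_bot] at hv
        simp [hv]
      | succ i =>
        have hscal : ∀ a : H, ∃ c : k, ∀ x ∈ F (i + 1), glAct m k (ρ a) x - c • x ∈ F i := by
          intro a
          obtain ⟨w, hw, hle⟩ := hF.step i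
          obtain ⟨y, hy, z, hz, hyz⟩ :=
            Submodule.mem_sup.1 (hle (hF.stable _ ⟨a, rfl⟩ _ _ hw))
          obtain ⟨c, rfl⟩ := Submodule.mem_span_singleton.1 hz
          refine ⟨c, fun x hx => ?_⟩
          obtain ⟨y', hy', z', hz', rfl⟩ := Submodule.mem_sup.1 (hle hx)
          obtain ⟨t, rfl⟩ := Submodule.mem_span_singleton.1 hz'
          have : glAct m k (ρ a) (y' + t • w) - c • (y' + t • w)
              = (glAct m k (ρ a) y' - c • y') + t • y := by
            rw [map_add, map_smul, ← hyz]; module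
          rw [this]
          exact add_mem (sub_mem (hF.stable _ ⟨a, rfl⟩ _ _ hy') ((F i).smul_mem _ hy'))
            ((F i).smul_mem _ hy)
        obtain ⟨c, hc⟩ := hscal a
        obtain ⟨c', hc'⟩ := hscal b
        have h1 := hF.stable _ ⟨a, rfl⟩ _ _ (hc' v hv)
        have h2 := hF.stable _ ⟨b, rfl⟩ _ _ (hc v hv)
        have h3 := (F i).smul_mem c' (hc v hv)
        have h4 := (F i).smul_mem c (hc' v hv)
        have h5 := sub_mem (add_mem h1 h3) (add_mem h2 h4)
        rw [map_sub, map_sub, map_smul, map_smul] at h5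
        simp only [zero_add, Nat.add_sub_cancel]
        convert h5 using 1
        module
    · have h1 := ha' _ _ (hb' i v hv)
      have h2 := hb' _ _ (ha' i v hv)
      have h3 := sub_mem h1 h2
      rw [map_sub, map_sub] at h3
      refine hanti _ _ (by omega : i - s - s ≤ _) ?_
      convert h3 using 1
      abel

lemma IsStableFlag.derivedSeries_eq_bot {H : Type*} [Group H] {ρ : H →* GL m k}
    (hF : IsStableFlag d F (Set.range ρ)) (hρ : Function.Injective ρ) :
    derivedSeries H d = ⊥ := by
  rw [eq_bot_iff]
  intro h hh
  rw [Subgroup.mem_bot]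
  apply hρ
  rw [map_one]
  apply glAct_injective
  refine LinearMap.ext fun v => ?_
  have h1 := hF.derivedSeries_le d hh d v (by rw [hF.top]; trivial)
  rw [Nat.sub_self, hF.zero, Submodule.mem_bot, sub_eq_zero] at h1
  simpa using h1

lemma exists_isStableFlag [IsAlgClosed k] {B : Subgroup (GL m k)}
    (hB : IsPreconnected (B : Set (GL m k))) [Group.IsSolvable B] :
    ∃ F : ℕ → Submodule k (m → k), IsStableFlag (Fintype.card m) F (B : Set (GL m k)) := by
  have hstep : ∀ F : {F : Submodule k (m → k) // ∀ b ∈ B, ∀ v ∈ F, glAct m k b v ∈ F},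
      ∃ F' : {F : Submodule k (m → k) // ∀ b ∈ B, ∀ v ∈ F, glAct m k b v ∈ F},
        F.1 ≤ F'.1 ∧ (∃ w ∈ F'.1, F'.1 ≤ F.1 ⊔ Submodule.span k {w}) ∧ (F.1 = ⊤ ∨ F.1 < F'.1) := by
    rintro ⟨F, hF⟩
    by_cases htop : F = ⊤
    · exact ⟨⟨F, hF⟩, le_rfl, ⟨0, F.zero_mem, le_sup_left⟩, Or.inl htop⟩
    · obtain ⟨w, -, hw, hev⟩ := exists_eigenvector_mod hB (U := ⊤) hF (fun _ _ _ _ => trivial)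
        (fun h => htop (top_le_iff.1 h))
      have hwm : w ∈ F ⊔ Submodule.span k {w} :=
        Submodule.mem_sup_right (Submodule.mem_span_singleton_self w)
      refine ⟨⟨F ⊔ Submodule.span k {w}, ?_⟩, le_sup_left, ⟨w, hwm, le_rfl⟩, Or.inr ?_⟩
      · intro b hb v hv
        obtain ⟨y, hy, z, hz, rfl⟩ := Submodule.mem_sup.1 hv
        obtain ⟨t, rfl⟩ := Submodule.mem_span_singleton.1 hz
        obtain ⟨c, hc⟩ := hev b hb
        have : glAct m k b (y + t • w)
            = (glAct m k b y + t • (glAct m k b w - c • w)) + (t * c) • w := by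
          rw [map_add, map_smul]; module
        rw [this]
        exact add_mem (Submodule.mem_sup_left (add_mem (hF b hb y hy) (F.smul_mem _ hc)))
          (Submodule.smul_mem _ _ hwm)
      · refine lt_of_le_of_ne le_sup_left fun h => hw ?_
        have h' : F = F ⊔ Submodule.span k {w} := h
        rw [h']
        exact hwm
  choose next h₁ h₂ h₃ using hstep
  let f : ℕ → {F : Submodule k (m → k) // ∀ b ∈ B, ∀ v ∈ F, glAct m k b v ∈ F} :=
    fun i => Nat.rec ⟨⊥, by simp⟩ (fun _ F => next F) i
  have hdim : ∀ i, (f i).1 = ⊤ ∨ i ≤ Module.finrank k (f i).1 := by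
    intro i
    induction i with
    | zero => exact Or.inr (Nat.zero_le _)
    | succ i ih =>
      rcases h₃ (f i) with h | h
      · exact Or.inl (top_le_iff.1 (h ▸ h₁ (f i)))
      · rcases ih with h' | h'
        · exact absurd h (by rw [h']; exact not_top_lt)
        · exact Or.inr (h'.trans_lt (Submodule.finrank_lt_finrank_of_lt h))
  refine ⟨fun i => (f i).1, ⟨rfl, ?_, fun i => h₁ (f i), fun i => h₂ (f i), fun g hg i => (f i).2 g hg⟩⟩
  rcases hdim (Fintype.card m) with h | h
  · exact h
  · apply Submodule.eq_top_of_finrank_eq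
    rw [Module.finrank_fintype_fun_eq_card]
    refine le_antisymm ?_ h
    have := Submodule.finrank_le (f (Fintype.card m)).1
    rwa [Module.finrank_fintype_fun_eq_card] at this

lemma IsStableFlag.closure {S : Set (GL m k)} (hF : IsStableFlag d F S) :
    IsStableFlag d F (closure S) where
  zero := hF.zero
  top := hF.top
  mono := hF.mono
  step := hF.step
  stable := by
    intro g hg i v hv
    by_contra hcon
    obtain ⟨φ, hφ, hφF⟩ := Submodule.exists_dual_map_eq_bot_of_notMem hcon inferInstance
    refine hφ ?_
    refine mem_closure_glReg_iff.1 hg _ (linear_glAct_mem φ v) fun s hs => ?_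
    have : φ (glAct m k s v) ∈ (F i).map φ := ⟨_, hF.stable s hs i v hv, rfl⟩
    rwa [hφF, Submodule.mem_bot] at this

end Flags

section BorelExistence

open scoped commutatorElement

variable {m : Type*} [DecidableEq m] [Fintype m]

lemma map_derivedSeries_mono {Γ : Type*} [Group Γ] {M M' : Subgroup Γ} (h : M ≤ M') (s : ℕ) :
    (derivedSeries M s).map M.subtype ≤ (derivedSeries M' s).map M'.subtype := by
  induction s with
  | zero =>
    rw [derivedSeries_zero, derivedSeries_zero, ← MonoidHom.range_eq_map,
      ← MonoidHom.range_eq_map, Subgroup.range_subtype, Subgroup.range_subtype]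
    exact h
  | succ s ih =>
    rw [derivedSeries_succ, derivedSeries_succ, Subgroup.map_commutator, Subgroup.map_commutator]
    exact Subgroup.commutator_mono ih ih

lemma derivedSeries_sSup_eq_bot {Γ : Type*} [Group Γ] {c : Set (Subgroup Γ)} (hne : c.Nonempty)
    (hc : IsChain (· ≤ ·) c) {d : ℕ} (hd : ∀ M ∈ c, derivedSeries M d = ⊥) :
    derivedSeries ↥(sSup c) d = ⊥ := by
  have key : ∀ s, ∀ x ∈ (derivedSeries ↥(sSup c) s).map (sSup c).subtype,
      ∃ M ∈ c, x ∈ (derivedSeries M s).map M.subtype := by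
    have hdir : ∀ s, DirectedOn (· ≤ ·)
        ((fun M : Subgroup Γ => (derivedSeries M s).map M.subtype) '' c) := by
      rintro s _ ⟨M, hM, rfl⟩ _ ⟨M', hM', rfl⟩
      obtain ⟨K, hK, h1, h2⟩ := hc.directedOn M hM M' hM'
      exact ⟨_, ⟨K, hK, rfl⟩, map_derivedSeries_mono h1 s, map_derivedSeries_mono h2 s⟩
    have hmem : ∀ s x, x ∈ sSup ((fun M : Subgroup Γ => (derivedSeries M s).map M.subtype) '' c) ↔
        ∃ M ∈ c, x ∈ (derivedSeries M s).map M.subtype := by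
      intro s x
      rw [Subgroup.mem_sSup_of_directedOn (hne.image _) (hdir s)]
      simp
    intro s
    induction s with
    | zero =>
      intro x hx
      rw [derivedSeries_zero, ← MonoidHom.range_eq_map, Subgroup.range_subtype,
        Subgroup.mem_sSup_of_directedOn hne hc.directedOn] at hx
      obtain ⟨M, hM, hx⟩ := hx
      refine ⟨M, hM, ?_⟩
      rwa [derivedSeries_zero, ← MonoidHom.range_eq_map, Subgroup.range_subtype]
    | succ s ih =>
      intro x hx
      rw [← hmem]
      rw [derivedSeries_succ, Subgroup.map_commutator] at hx
      refine (Subgroup.commutator_le.2 ?_ : _ ≤ sSup _) hx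
      intro p hp q hq
      obtain ⟨M, hM, hp'⟩ := ih p hp
      obtain ⟨M', hM', hq'⟩ := ih q hq
      obtain ⟨K, hK, h1, h2⟩ := hc.directedOn M hM M' hM'
      rw [hmem]
      refine ⟨K, hK, ?_⟩
      rw [derivedSeries_succ, Subgroup.map_commutator]
      exact Subgroup.commutator_mem_commutator (map_derivedSeries_mono h1 s hp')
        (map_derivedSeries_mono h2 s hq')
  rw [eq_bot_iff]
  intro x hx
  obtain ⟨M, hM, y, hy, hyx⟩ := key d x ⟨x, hx, rfl⟩
  rw [SetLike.mem_coe, hd M hM, Subgroup.mem_bot] at hy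
  rw [Subgroup.mem_bot]
  apply Subtype.ext
  rw [hy] at hyx
  simpa using hyx.symm

variable {G : Subgroup (GL m k)}

lemma continuous_mul_left_subgroup (a : G) : Continuous fun g : G => a * g :=
  Continuous.subtype_mk
    (((isRegMap_const (a : GL m k)).mul isRegMap_id).continuous.comp continuous_subtype_val) _

lemma continuous_mul_right_subgroup (a : G) : Continuous fun g : G => g * a :=
  Continuous.subtype_mk
    ((isRegMap_id.mul (isRegMap_const (a : GL m k))).continuous.comp continuous_subtype_val) _

lemma continuous_inv_subgroup : Continuous fun g : G => g⁻¹ :=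
  Continuous.subtype_mk (isRegMap_id.inv.continuous.comp continuous_subtype_val) _

/-- The Zariski closure of a subgroup. -/
def zariskiClosure (M : Subgroup G) : Subgroup G where
  carrier := closure (M : Set G)
  mul_mem' := by
    have h1 : ∀ a ∈ M, ∀ b ∈ closure (M : Set G), a * b ∈ closure (M : Set G) := fun a ha =>
      fun b hb => map_mem_closure (continuous_mul_left_subgroup a) hb fun x hx => mul_mem ha hx
    intro a b ha hb
    have h2 := map_mem_closure (continuous_mul_right_subgroup b) ha fun x hx => h1 x hx b hb
    rwa [closure_closure] at h2
  one_mem' := subset_closure M.one_mem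
  inv_mem' := fun ha =>
    map_mem_closure continuous_inv_subgroup ha fun x hx => M.inv_mem hx

/-- A flag adapted to a connected solvable subgroup. -/
lemma exists_isStableFlag_of_subgroup [IsAlgClosed k] {M : Subgroup G}
    (hM : IsPreconnected (M : Set G)) (hsol : Group.IsSolvable M) :
    ∃ F : ℕ → Submodule k (m → k),
      IsStableFlag (Fintype.card m) F ((↑) '' (M : Set G) : Set (GL m k)) := by
  have h1 : ((M.map G.subtype : Subgroup (GL m k)) : Set (GL m k)) = (↑) '' (M : Set G) := rfl
  have hcon : IsPreconnected ((M.map G.subtype : Subgroup (GL m k)) : Set (GL m k)) := by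
    rw [h1]
    exact hM.image _ continuous_subtype_val.continuousOn
  have : Group.IsSolvable (M.map G.subtype) :=
    Group.isSolvable_of_surjective (f := G.subtype.subgroupMap M) (G.subtype.subgroupMap_surjective M)
  rw [← h1]
  exact exists_isStableFlag hcon

lemma IsStableFlag.subgroup_derivedSeries_eq_bot {d : ℕ} {F : ℕ → Submodule k (m → k)}
    {M : Subgroup G} (hF : IsStableFlag d F ((↑) '' (M : Set G) : Set (GL m k))) :
    derivedSeries M d = ⊥ := by
  have h1 : Set.range (G.subtype.comp M.subtype) = (↑) '' (M : Set G) := by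
    ext x
    simp
  rw [← h1] at hF
  exact hF.derivedSeries_eq_bot (fun a b h => Subtype.ext (Subtype.ext h))

/-- Every connected solvable subgroup lies in a Borel subgroup. -/
lemma exists_isBorel_ge [IsAlgClosed k] {B₀ : Subgroup G}
    (hcon : IsPreconnected (B₀ : Set G)) (hsol : Group.IsSolvable B₀) :
    ∃ B : Subgroup G, IsBorel G B ∧ B₀ ≤ B := by
  obtain ⟨F₀, hF₀⟩ := exists_isStableFlag_of_subgroup hcon hsol
  obtain ⟨M, hM, hmax⟩ := zorn_le_nonempty₀
    {M : Subgroup G | IsPreconnected (M : Set G) ∧ derivedSeries M (Fintype.card m) = ⊥}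
    (by
      intro c hcS hc y hy
      refine ⟨sSup c, ⟨?_, derivedSeries_sSup_eq_bot ⟨y, hy⟩ hc fun M hM => (hcS hM).2⟩,
        fun z hz => le_sSup hz⟩
      have : ((sSup c : Subgroup G) : Set G) = ⋃₀ ((fun M : Subgroup G => (M : Set G)) '' c) := by
        ext x
        rw [SetLike.mem_coe, Subgroup.mem_sSup_of_directedOn ⟨y, hy⟩ hc.directedOn]
        simp
      rw [this]
      refine isPreconnected_sUnion 1 _ ?_ ?_
      · rintro _ ⟨M, _, rfl⟩
        exact M.one_mem
      · rintro _ ⟨M, hM, rfl⟩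
        exact (hcS hM).1) B₀ ⟨hcon, hF₀.subgroup_derivedSeries_eq_bot⟩
  have hMcon := hmax.prop.1
  have hMsol : Group.IsSolvable M := (Group.isSolvable_def M).2 ⟨_, hmax.prop.2⟩
  refine ⟨M, ⟨?_, ⟨⟨1, M.one_mem⟩, hMcon⟩, hMsol, ?_⟩, hM⟩
  · obtain ⟨F, hF⟩ := exists_isStableFlag_of_subgroup hMcon hMsol
    have hF' : IsStableFlag (Fintype.card m) F
        ((↑) '' (zariskiClosure M : Set G) : Set (GL m k)) :=
      { hF with
        stable := fun g hg => hF.closure.stable g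
          (image_closure_subset_closure_image continuous_subtype_val hg) }
    have hle : M ≤ zariskiClosure M := fun x hx => subset_closure hx
    have h1 := hmax.eq_of_le ⟨hMcon.closure, hF'.subgroup_derivedSeries_eq_bot⟩ hle
    have h2 : (M : Set G) = closure (M : Set G) := congrArg (fun K : Subgroup G => (K : Set G)) h1
    rw [h2]
    exact isClosed_closure
  · intro B' _ hB'con hB'sol hle
    obtain ⟨F, hF⟩ := exists_isStableFlag_of_subgroup hB'con.isPreconnected hB'sol
    exact (hmax.eq_of_le ⟨hB'con.isPreconnected, hF.subgroup_derivedSeries_eq_bot⟩ hle).symm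

end BorelExistence

section NilpotentPart

/-- The endomorphism `g - 1`. -/
def nilPart (g : GL (Fin n ⊕ Fin n) k) : Module.End k (Fin n ⊕ Fin n → k) := glAct _ k g - 1

lemma nilPart_apply (g : GL (Fin n ⊕ Fin n) k) (v : Fin n ⊕ Fin n → k) :
    nilPart g v = glAct _ k g v - v := rfl

lemma glAct_eq_add_nilPart (g : GL (Fin n ⊕ Fin n) k) (v : Fin n ⊕ Fin n → k) :
    glAct _ k g v = v + nilPart g v := by rw [nilPart_apply]; abel

lemma commute_glAct_inv_nilPart (g : GL (Fin n ⊕ Fin n) k) :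
    Commute (glAct _ k g⁻¹) (nilPart g) := by
  refine LinearMap.ext fun v => ?_
  simp only [Module.End.mul_apply, nilPart_apply, map_sub, glAct_inv_self, glAct_self_inv]

lemma polForm_nilPart_left {g : GL (Fin n ⊕ Fin n) k} (hg : g ∈ evenOrthGroup k n)
    (v w : Fin n ⊕ Fin n → k) :
    polForm k n (nilPart g v) w = - polForm k n v (glAct _ k g⁻¹ (nilPart g w)) := by
  simp only [nilPart_apply, map_sub, LinearMap.sub_apply, polForm_glAct_left hg, glAct_inv_self]
  ring

variable [CharP k 2]

lemma quadForm_nilPart {g : GL (Fin n ⊕ Fin n) k} (hg : g ∈ evenOrthGroup k n)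
    (v : Fin n ⊕ Fin n → k) : quadForm k n (nilPart g v) = polForm k n v (glAct _ k g v) := by
  have h1 := mem_evenOrthGroup.1 hg v
  rw [glAct_eq_add_nilPart, quadForm_add] at h1
  rw [glAct_eq_add_nilPart, map_add, polForm_self, zero_add]
  have h2 := CharTwo.add_self_eq_zero (polForm k n v (nilPart g v))
  linear_combination h1 - h2

lemma quadForm_nilPart' {g : GL (Fin n ⊕ Fin n) k} (hg : g ∈ evenOrthGroup k n)
    (v : Fin n ⊕ Fin n → k) : quadForm k n (nilPart g v) = polForm k n v (nilPart g v) := by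
  rw [quadForm_nilPart hg, glAct_eq_add_nilPart, map_add, polForm_self, zero_add]

lemma nilPart_nilPart (g : GL (Fin n ⊕ Fin n) k) (v : Fin n ⊕ Fin n → k) :
    nilPart g (nilPart g v) = glAct _ k g (glAct _ k g v) - v := by
  simp only [nilPart_apply, map_sub]
  have := vec_add_self (glAct _ k g v - v)
  linear_combination -this

lemma glAct_sub_inv (g : GL (Fin n ⊕ Fin n) k) (v : Fin n ⊕ Fin n → k) :
    glAct _ k g v - glAct _ k g⁻¹ v = glAct _ k g⁻¹ (nilPart g (nilPart g v)) := by
  rw [nilPart_nilPart, map_sub, glAct_inv_self]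

end NilpotentPart

section Nilpotent

variable {V : Type*} [AddCommGroup V] [Module k V]

lemma eq_zero_of_isNilpotent {N P : Module.End k V} (hN : IsNilpotent N) (hNP : Commute N P)
    {e : V} (he : e ≠ 0) {c : k} (h : N (P e) = c • e) : c = 0 := by
  obtain ⟨j, hj⟩ := hNP.isNilpotent_mul_right hN
  have h1 : ∀ j, ((N * P) ^ j) e = c ^ j • e := by
    intro j
    induction j with
    | zero => simp
    | succ j ih => rw [pow_succ', Module.End.mul_apply, ih, map_smul, Module.End.mul_apply, h,
        smul_smul, pow_succ]
  have h2 := h1 j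
  rw [hj, LinearMap.zero_apply] at h2
  exact eq_zero_of_pow_eq_zero ((smul_eq_zero.1 h2.symm).resolve_right he)

lemma exists_notMem_notMem {A B : Submodule k V} (hA : A ≠ ⊤) (hB : B ≠ ⊤) :
    ∃ x, x ∉ A ∧ x ∉ B := by
  obtain ⟨x, hx⟩ : ∃ x, x ∉ A := by
    by_contra! h
    exact hA (Submodule.eq_top_iff'.2 h)
  obtain ⟨y, hy⟩ : ∃ x, x ∉ B := by
    by_contra! h
    exact hB (Submodule.eq_top_iff'.2 h)
  by_cases h1 : x ∈ B
  · by_cases h2 : y ∈ A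
    · exact ⟨x + y, fun h => hx ((A.add_mem_iff_left h2).1 h),
        fun h => hy ((B.add_mem_iff_right h1).1 h)⟩
    · exact ⟨y, h2, hy⟩
  · exact ⟨x, hx, h1⟩

lemma finrank_le_finrank_range_pow_add [FiniteDimensional k V] (N : Module.End k V) (j : ℕ) :
    Module.finrank k V
      ≤ Module.finrank k (LinearMap.range (N ^ j)) + j * Module.finrank k (LinearMap.ker N) := by
  induction j with
  | zero =>
    rw [pow_zero, Module.End.one_eq_id, LinearMap.range_id, finrank_top]
    simp
  | succ j ih =>
    have h1 := (N.domRestrict (LinearMap.range (N ^ j))).finrank_range_add_finrank_ker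
    have h2 : LinearMap.range (N.domRestrict (LinearMap.range (N ^ j)))
        = LinearMap.range (N ^ (j + 1)) := by
      rw [LinearMap.range_domRestrict, ← LinearMap.range_comp, pow_succ']
      rfl
    have h3 : Module.finrank k (LinearMap.ker (N.domRestrict (LinearMap.range (N ^ j))))
        ≤ Module.finrank k (LinearMap.ker N) := by
      refine LinearMap.finrank_le_finrank_of_injective
        (f := ((LinearMap.range (N ^ j)).subtype.comp
          (LinearMap.ker (N.domRestrict (LinearMap.range (N ^ j)))).subtype).codRestrict
            (LinearMap.ker N) fun x => x.2) ?_
      intro x y hxy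
      exact Subtype.ext (Subtype.ext (congrArg (fun z : LinearMap.ker N => (z : V)) hxy))
    rw [h2] at h1
    have h4 : (j + 1) * Module.finrank k (LinearMap.ker N)
        = j * Module.finrank k (LinearMap.ker N) + Module.finrank k (LinearMap.ker N) := by ring
    omega

/-- A binary quadratic form over an algebraically closed field is isotropic. -/
lemma exists_isotropic_binary [IsAlgClosed k] (A B C : k) :
    ∃ a b : k, (a ≠ 0 ∨ b ≠ 0) ∧ A * a ^ 2 + B * a * b + C * b ^ 2 = 0 := by
  by_cases hA : A = 0
  · exact ⟨1, 0, Or.inl one_ne_zero, by simp [hA]⟩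
  by_cases hB : B = 0
  · obtain ⟨z, hz⟩ := IsAlgClosed.exists_eq_mul_self (-C / A)
    refine ⟨z, 1, Or.inr one_ne_zero, ?_⟩
    rw [hB, pow_two, ← hz]
    field_simp
    ring
  · obtain ⟨s, hs⟩ := exists_quadratic_root A hB C
    exact ⟨s, 1, Or.inr one_ne_zero, by linear_combination hs⟩

variable [CharP k 2]

lemma exists_singular_of_pow_ne_zero {g : GL (Fin n ⊕ Fin n) k} (hg : g ∈ evenOrthGroup k n)
    (hnil : IsNilpotent (nilPart g)) (h6 : nilPart g ^ 6 ≠ 0) :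
    ∃ e, quadForm k n e = 0 ∧ quadForm k n (nilPart g e) = 0 ∧ nilPart g (nilPart g e) ≠ 0 := by
  set N := nilPart g with hN
  have hpow : ∀ j v, (N ^ (j + 1)) v = N ((N ^ j) v) := fun j v => by rw [pow_succ']; rfl
  obtain ⟨m, hm⟩ : ∃ m, nilpotencyClass N = m + 6 + 1 := by
    refine ⟨nilpotencyClass N - 7, ?_⟩
    have : ¬ nilpotencyClass N ≤ 6 := fun h => h6 (pow_eq_zero_of_le h (pow_nilpotencyClass hnil))
    omega
  obtain ⟨hzero, hne⟩ := nilpotencyClass_eq_succ_iff.1 hm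
  have horth : ∀ a b x y, m + 7 ≤ a + b → polForm k n ((N ^ a) x) ((N ^ b) y) = 0 := by
    intro a
    induction a with
    | zero =>
      intro b x y hb
      rw [pow_eq_zero_of_le (by omega : m + 6 + 1 ≤ b) hzero, LinearMap.zero_apply, map_zero]
    | succ a ih =>
      intro b x y hb
      have h1 : glAct _ k g⁻¹ (N ((N ^ b) y)) = (N ^ (b + 1)) (glAct _ k g⁻¹ y) := by
        rw [← hpow]
        exact LinearMap.congr_fun ((commute_glAct_inv_nilPart g).pow_right (b + 1)).eq y
      rw [hpow, polForm_nilPart_left hg, ← hN, h1, ih _ _ _ (by omega), neg_zero]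
  obtain ⟨v, hv⟩ : ∃ v, (N ^ (m + 6)) v ≠ 0 := by
    by_contra! h
    exact hne (LinearMap.ext h)
  have hQ : ∀ j, m + 7 ≤ j + (j + 1) → quadForm k n ((N ^ (j + 1)) v) = 0 := fun j hj => by
    rw [hpow, hN, quadForm_nilPart' hg, ← hN, ← hpow, horth _ _ _ _ hj]
  refine ⟨(N ^ (m + 4)) v, hQ _ (by omega), ?_, ?_⟩
  · rw [← hpow]
    exact hQ _ (by omega)
  · rwa [← hpow, ← hpow]

lemma exists_singular_quadForm_nilPart_eq_zero [IsAlgClosed k] (hn : 4 ≤ n) {g : GL (Fin n ⊕ Fin n) k}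
    (hg : g ∈ evenOrthGroup k n) (hnil : IsNilpotent (nilPart g))
    (h2 : nilPart g ^ 2 ≠ 0) :
    ∃ e, quadForm k n e = 0 ∧ quadForm k n (nilPart g e) = 0 ∧ nilPart g (nilPart g e) ≠ 0 := by
  by_cases h6 : nilPart g ^ 6 = 0
  swap
  · exact exists_singular_of_pow_ne_zero hg hnil h6
  set N := nilPart g with hN
  have hker : 2 ≤ Module.finrank k (LinearMap.ker N) := by
    have h1 := finrank_le_finrank_range_pow_add N 6
    rw [h6, LinearMap.range_zero, finrank_bot, Module.finrank_fintype_fun_eq_card] at h1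
    simp at h1
    omega
  have hrank := N.finrank_range_add_finrank_ker
  have hproper : ∀ x, LinearMap.range N ⊔ Submodule.span k {x} ≠ ⊤ := by
    intro x htop
    have h1 := Submodule.finrank_add_le_finrank_add_finrank (LinearMap.range N)
      (Submodule.span k {x})
    have h3 := finrank_span_le_card (R := k) ({x} : Set (Fin n ⊕ Fin n → k))
    rw [htop, finrank_top] at h1
    simp at h3
    omega
  obtain ⟨x, hx, hx2⟩ := exists_notMem_notMem (A := LinearMap.range N) (B := LinearMap.ker (N ^ 2))
    (fun h => hproper 0 (by rw [h]; simp)) (fun h => h2 (LinearMap.ker_eq_top.1 h))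
  have hNNx : N (N x) ≠ 0 := hx2
  -- the alternating form attached to `g - g⁻¹`
  let ω := fun v w => polForm k n v (glAct _ k g w - glAct _ k g⁻¹ w)
  have hω0 : ∀ v w, N (N w) = 0 → ω v w = 0 := fun v w hw => by
    simp only [ω]
    rw [glAct_sub_inv, ← hN, hw, map_zero, map_zero]
  have hωadd : ∀ v a b y z, ω v (a • y + b • z) = a * ω v y + b * ω v z := fun v a b y z => by
    simp only [ω, map_add, map_smul, map_sub, smul_eq_mul]; ring
  have hωneg : ∀ v w, ω v w = - ω w v := fun v w => by
    simp only [ω, map_sub]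
    rw [polForm_comm v, polForm_comm v, polForm_glAct_left hg, polForm_glAct_left (inv_mem hg),
      inv_inv]
    ring
  have hωself : ∀ v, ω v v = 0 := fun v => by
    simp only [ω, map_sub]
    rw [polForm_comm v (glAct _ k g⁻¹ v), polForm_glAct_left (inv_mem hg), inv_inv, sub_self]
  obtain ⟨y, hy, hxy⟩ := exists_notMem_notMem
    (A := LinearMap.range N ⊔ Submodule.span k {x})
    (B := LinearMap.ker ((polForm k n).flip (glAct _ k g x - glAct _ k g⁻¹ x))) (hproper x) (by
      intro h
      rw [LinearMap.ker_eq_top] at h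
      refine hNNx ?_
      have h1 : glAct _ k g x - glAct _ k g⁻¹ x = 0 :=
        eq_zero_of_polForm fun w => by
          rw [polForm_comm]
          exact LinearMap.congr_fun h w
      rw [glAct_sub_inv] at h1
      have h3 := congrArg (glAct _ k g) h1
      rwa [glAct_self_inv, map_zero] at h3)
  have hωyx : ω y x ≠ 0 := hxy
  obtain ⟨a, b, hab, hq⟩ := exists_isotropic_binary (quadForm k n (N x)) (polForm k n (N x) (N y))
    (quadForm k n (N y))
  have hNe : quadForm k n (N (a • x + b • y)) = 0 := by
    rw [map_add, map_smul, map_smul, quadForm_add, quadForm_smul, quadForm_smul, map_smul,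
      map_smul, LinearMap.smul_apply, smul_eq_mul, smul_eq_mul]
    linear_combination hq
  have hNNe : N (N (a • x + b • y)) ≠ 0 := by
    intro h0
    have h3 := hω0 y _ h0
    have h4 := hω0 x _ h0
    rw [hωadd, hωself, mul_zero, add_zero] at h3
    rw [hωadd, hωself, hωneg, mul_zero, zero_add, mul_neg, neg_eq_zero] at h4
    rcases hab with ha | hb
    · exact (mul_ne_zero ha hωyx) h3
    · exact (mul_ne_zero hb hωyx) h4
  have hrange : a • x + b • y ∉ LinearMap.range N := by
    intro h0
    by_cases hb : b = 0
    · have ha : a ≠ 0 := hab.resolve_right (by simpa using hb)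
      rw [hb, zero_smul, add_zero] at h0
      exact hx ((Submodule.smul_mem_iff _ ha).1 h0)
    · refine hy ((Submodule.smul_mem_iff _ hb).1 ?_)
      have h3 := sub_mem (Submodule.mem_sup_left h0 :
        a • x + b • y ∈ LinearMap.range N ⊔ Submodule.span k {x})
        (Submodule.mem_sup_right (Submodule.smul_mem _ a (Submodule.mem_span_singleton_self x)))
      rwa [add_sub_cancel_left] at h3
  set e := a • x + b • y
  obtain ⟨w, hw, hwe⟩ := exists_polForm_ne hrange
  have hNw : N w = 0 := by
    refine eq_zero_of_polForm fun v => ?_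
    rw [polForm_comm, ← glAct_self_inv g v, polForm_glAct_left hg, ← neg_eq_zero,
      ← polForm_nilPart_left hg, polForm_comm]
    exact hw _ ⟨_, rfl⟩
  obtain ⟨s, hs⟩ := exists_quadratic_root (quadForm k n w) hwe (quadForm k n e)
  have hNs : N (e + s • w) = N e := by rw [map_add, map_smul, hNw, smul_zero, add_zero]
  refine ⟨e + s • w, ?_, ?_, ?_⟩
  · rw [quadForm_add, quadForm_smul, map_smul, smul_eq_mul, polForm_comm e]
    linear_combination hs
  · rwa [hNs]
  · rwa [hNs]

end Nilpotent

section SphericalClasses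

/-- The matrix coefficient `g ↦ β(v, g w)`. -/
def matCoef (v w : Fin n ⊕ Fin n → k) (g : GL (Fin n ⊕ Fin n) k) : k :=
  polForm k n v (glAct _ k g w)

lemma matCoef_mem (v w : Fin n ⊕ Fin n → k) : matCoef v w ∈ glReg (Fin n ⊕ Fin n) k :=
  linear_glAct_mem (polForm k n v) w

lemma matCoef_inv_mem (v w : Fin n ⊕ Fin n → k) :
    (fun g => matCoef v w g⁻¹) ∈ glReg (Fin n ⊕ Fin n) k :=
  isRegMap_id.inv.comp_mem (matCoef_mem v w)

lemma matCoef_conj {h : GL (Fin n ⊕ Fin n) k} (hh : h ∈ evenOrthGroup k n)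
    (v w : Fin n ⊕ Fin n → k) (g : GL (Fin n ⊕ Fin n) k) :
    matCoef v w (h * g * h⁻¹) = matCoef (glAct _ k h⁻¹ v) (glAct _ k h⁻¹ w) g := by
  rw [matCoef, matCoef, glAct_mul_apply, glAct_mul_apply, polForm_glAct_left (inv_mem hh), inv_inv]

lemma matCoef_inv {g : GL (Fin n ⊕ Fin n) k} (hg : g ∈ evenOrthGroup k n)
    (v w : Fin n ⊕ Fin n → k) : matCoef v w g⁻¹ = matCoef w v g := by
  rw [matCoef, matCoef, polForm_comm w, polForm_glAct_left hg]

/-- The coefficient `g ↦ β(v, (g - g⁻¹) w)`. -/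
def altCoef (v w : Fin n ⊕ Fin n → k) (g : GL (Fin n ⊕ Fin n) k) : k :=
  matCoef v w g - matCoef v w g⁻¹

lemma altCoef_mem (v w : Fin n ⊕ Fin n → k) : altCoef v w ∈ glReg (Fin n ⊕ Fin n) k :=
  sub_mem_glReg (matCoef_mem v w) (matCoef_inv_mem v w)

lemma altCoef_conj {h : GL (Fin n ⊕ Fin n) k} (hh : h ∈ evenOrthGroup k n)
    (v w : Fin n ⊕ Fin n → k) (g : GL (Fin n ⊕ Fin n) k) :
    altCoef v w (h * g * h⁻¹) = altCoef (glAct _ k h⁻¹ v) (glAct _ k h⁻¹ w) g := by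
  have : (h * g * h⁻¹)⁻¹ = h * g⁻¹ * h⁻¹ := by group
  rw [altCoef, altCoef, this, matCoef_conj hh, matCoef_conj hh]

lemma altCoef_eq {g : GL (Fin n ⊕ Fin n) k} (hg : g ∈ evenOrthGroup k n)
    (v w : Fin n ⊕ Fin n → k) : altCoef v w g = matCoef v w g - matCoef w v g := by
  rw [altCoef, matCoef_inv hg]

lemma matCoef_add_smul (a b c d : k) (v w v' w' : Fin n ⊕ Fin n → k)
    (g : GL (Fin n ⊕ Fin n) k) :
    matCoef (a • v + b • w) (c • v' + d • w') g = a * c * matCoef v v' g + a * d * matCoef v w' g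
      + b * c * matCoef w v' g + b * d * matCoef w w' g := by
  simp only [matCoef, map_add, map_smul, LinearMap.add_apply, LinearMap.smul_apply, smul_eq_mul]
  ring

lemma matCoef_smul (a c : k) (v v' : Fin n ⊕ Fin n → k)
    (g : GL (Fin n ⊕ Fin n) k) :
    matCoef (a • v) (c • v') g = a * c * matCoef v v' g := by
  simp only [matCoef, map_smul, LinearMap.smul_apply, smul_eq_mul]
  ring

/-- Every regular function vanishing on the `M`-orbit of `x` vanishes on the whole conjugacy
class of `x` under the special orthogonal group. -/
def IsDenseInClass (M : Subgroup (GL (Fin n ⊕ Fin n) k)) (x : GL (Fin n ⊕ Fin n) k) : Prop :=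
  ∀ f ∈ glReg (Fin n ⊕ Fin n) k, (∀ b ∈ M, f (b * x * b⁻¹) = 0) →
    ∀ h ∈ evenSOGroup k n, f (h * x * h⁻¹) = 0

variable {M : Subgroup (GL (Fin n ⊕ Fin n) k)} {x : GL (Fin n ⊕ Fin n) k}

lemma IsDenseInClass.mul_eq_mul (hd : IsDenseInClass M x) {f₁ f₂ : GL (Fin n ⊕ Fin n) k → k}
    (h₁ : f₁ ∈ glReg (Fin n ⊕ Fin n) k) (h₂ : f₂ ∈ glReg (Fin n ⊕ Fin n) k)
    (hc : ∀ b ∈ M, ∃ c, f₁ (b * x * b⁻¹) = c * f₁ x ∧ f₂ (b * x * b⁻¹) = c * f₂ x)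
    {h : GL (Fin n ⊕ Fin n) k} (hh : h ∈ evenSOGroup k n) :
    f₁ x * f₂ (h * x * h⁻¹) = f₂ x * f₁ (h * x * h⁻¹) := by
  rw [← sub_eq_zero]
  refine hd (fun g => f₁ x * f₂ g - f₂ x * f₁ g) (sub_mem_glReg
    (mul_mem_glReg (const_mem_glReg _) h₂) (mul_mem_glReg (const_mem_glReg _) h₁))
    (fun b hb => ?_) h hh
  obtain ⟨c, h1, h2⟩ := hc b hb
  rw [h1, h2]
  ring

lemma nilPart_nilPart_eq_zero_of_quadForm {g : GL (Fin n ⊕ Fin n) k} (hg : g ∈ evenOrthGroup k n)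
    (h : ∀ v, quadForm k n (nilPart g v) = 0) (v : Fin n ⊕ Fin n → k) :
    nilPart g (nilPart g v) = 0 := by
  have h1 : glAct _ k g⁻¹ (nilPart g (nilPart g v)) = 0 := by
    refine eq_zero_of_polForm fun w => ?_
    rw [polForm_comm, ← neg_eq_zero, ← polForm_nilPart_left hg]
    have h2 := h (w + v)
    rwa [map_add, quadForm_add, h, h, add_zero, zero_add] at h2
  rw [← glAct_self_inv g (nilPart g (nilPart g v)), h1, map_zero]

variable [CharP k 2]

/-- If `(g - g⁻¹) e` is orthogonal to `e^⊥`, then `(g - 1)² e = 0`. -/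
lemma nilPart_nilPart_eq_zero_of_altCoef {g : GL (Fin n ⊕ Fin n) k} (hg : g ∈ evenOrthGroup k n)
    (hnil : IsNilpotent (nilPart g)) {e : Fin n ⊕ Fin n → k} (he : e ≠ 0)
    (h : ∀ w, polForm k n w e = 0 → altCoef e w g = 0) : nilPart g (nilPart g e) = 0 := by
  obtain ⟨c, hc⟩ := mem_span_singleton_of_polForm (e := e)
    (y := glAct _ k g⁻¹ (nilPart g (nilPart g e))) (by
    intro w hw
    have h1 := h w hw
    rw [altCoef_eq hg, ← neg_eq_zero, neg_sub, ← altCoef_eq hg, altCoef, matCoef, matCoef,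
      ← map_sub, glAct_sub_inv] at h1
    exact h1)
  have hN : Commute (nilPart g) (glAct _ k g⁻¹ * nilPart g) :=
    (commute_glAct_inv_nilPart g).symm.mul_right (Commute.refl _)
  have h2 := (commute_glAct_inv_nilPart g).eq
  have h3 : nilPart g ((glAct _ k g⁻¹ * nilPart g) e) = c • e := by
    rw [← hc]
    exact (LinearMap.congr_fun h2 (nilPart g e)).symm
  rw [← glAct_self_inv g (nilPart g (nilPart g e)), hc, eq_zero_of_isNilpotent hnil hN he h3,
    zero_smul, map_zero]

variable [IsAlgClosed k]

lemma nilPart_nilPart_eq_zero_of_eigenvector (hx : x ∈ evenOrthGroup k n)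
    (hnil : IsNilpotent (nilPart x)) (hM : M ≤ evenOrthGroup k n) (hd : IsDenseInClass M x)
    {e : Fin n ⊕ Fin n → k} (he : quadForm k n e ≠ 0)
    (hev : ∀ b ∈ M, ∃ c : k, glAct _ k b e = c • e) (v : Fin n ⊕ Fin n → k) :
    nilPart x (nilPart x v) = 0 := by
  have hinf : Infinite k := IsAlgClosed.instInfinite (K := k)
  have h1 : ∀ h ∈ evenSOGroup k n, matCoef e e (h * x * h⁻¹) = matCoef e e x := by
    intro h hh
    rw [← sub_eq_zero]
    refine hd (fun g => matCoef e e g - matCoef e e x)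
      (sub_mem_glReg (matCoef_mem _ _) (const_mem_glReg _)) (fun b hb => ?_) h hh
    obtain ⟨c, hc⟩ := hev b⁻¹ (inv_mem hb)
    have h2 := mem_evenOrthGroup.1 (hM (inv_mem hb)) e
    rw [hc, quadForm_smul] at h2
    have h3 : c ^ 2 = 1 := mul_right_cancel₀ he (by rw [h2, one_mul])
    change matCoef e e (b * x * b⁻¹) - matCoef e e x = 0
    rw [matCoef_conj (hM hb), hc, matCoef_smul, ← pow_two, h3, one_mul, sub_self]
  obtain ⟨a, ha⟩ : ∃ a, ∀ v, quadForm k n v ≠ 0 →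
      quadForm k n (nilPart x v) = a * quadForm k n v := by
    refine ⟨matCoef e e x / quadForm k n e, fun v hv => ?_⟩
    obtain ⟨t, ht⟩ := IsAlgClosed.exists_eq_mul_self (quadForm k n e / quadForm k n v)
    have ht' : t ^ 2 * quadForm k n v = quadForm k n e := by
      rw [pow_two, ← ht]; field_simp
    have ht0 : t ≠ 0 := by
      rintro rfl
      apply he
      rw [← ht']; ring
    obtain ⟨h, hh, hhv⟩ := exists_evenSOGroup_map (v := t • v) (w := e)
      (by rw [quadForm_smul, ht']; exact he) (by rw [quadForm_smul, ht'])
    have h2 := h1 h hh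
    rw [matCoef_conj (evenSOGroup_le hh), ← hhv, glAct_inv_self, matCoef_smul, hhv, matCoef,
      ← quadForm_nilPart hx] at h2
    rw [← h2, ← ht']
    field_simp
  have ha0 : a = 0 := by
    by_contra ha0
    have h2 : ∀ j, quadForm k n ((nilPart x ^ j) e) ≠ 0 := by
      intro j
      induction j with
      | zero => exact he
      | succ j ih =>
        rw [pow_succ', Module.End.mul_apply, ha _ ih]
        exact mul_ne_zero ha0 ih
    obtain ⟨j, hj⟩ := hnil
    apply h2 j
    rw [hj, LinearMap.zero_apply, quadForm_zero]
  have hns : ∀ v, quadForm k n v ≠ 0 → quadForm k n (nilPart x v) = 0 := fun v hv => by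
    rw [ha v hv, ha0, zero_mul]
  refine nilPart_nilPart_eq_zero_of_quadForm hx (fun w => ?_) v
  by_cases hw : quadForm k n w = 0
  swap
  · exact hns w hw
  set b := polForm k n w e with hb
  have h2 : ∀ t, t ≠ 0 → t ≠ - b / quadForm k n e →
      quadForm k n (nilPart x w) + t * polForm k n (nilPart x w) (nilPart x e) = 0 := by
    intro t ht ht'
    have h3 := hns (w + t • e) (by
      rw [quadForm_add, hw, quadForm_smul, map_smul, smul_eq_mul, ← hb]
      intro h4
      apply ht'
      rw [eq_div_iff he]
      refine mul_left_cancel₀ ht ?_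
      linear_combination h4)
    rw [map_add, map_smul, quadForm_add, quadForm_smul, hns e he, map_smul, smul_eq_mul] at h3
    linear_combination h3
  obtain ⟨t₁, h₁, h₁', -⟩ := exists_ne_ne_ne 0 (- b / quadForm k n e) 0
  obtain ⟨t₂, h₂, h₂', h₂₁⟩ := exists_ne_ne_ne 0 (- b / quadForm k n e) t₁
  have h3 := h2 t₁ h₁ h₁'
  have h4 := h2 t₂ h₂ h₂'
  have h5 : polForm k n (nilPart x w) (nilPart x e) = 0 :=
    mul_left_cancel₀ (sub_ne_zero.2 h₂₁) (by linear_combination h4 - h3)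
  rwa [h5, mul_zero, add_zero] at h3

/-- The case of a stable flag `⟨e₁⟩ < ⟨e₁, e₂⟩` with `e₁` singular and `e₂` nonsingular. -/
lemma nilPart_nilPart_eq_zero_of_flag_nonsingular (hn : 4 ≤ n) (hx : x ∈ evenOrthGroup k n)
    (hnil : IsNilpotent (nilPart x)) (hM : M ≤ evenOrthGroup k n) (hd : IsDenseInClass M x)
    {e₁ e₂ : Fin n ⊕ Fin n → k} (he₁ : quadForm k n e₁ = 0) (he₁0 : e₁ ≠ 0)
    (he₂ : quadForm k n e₂ ≠ 0) (h₁₂ : polForm k n e₂ e₁ = 0)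
    (hev : ∀ b ∈ M, ∃ χ ψ τ : k, glAct _ k b e₁ = χ • e₁ ∧ glAct _ k b e₂ = ψ • e₂ + τ • e₁)
    {e : Fin n ⊕ Fin n → k} (he : quadForm k n e = 0) (he0 : e ≠ 0)
    (heN : quadForm k n (nilPart x e) = 0) : nilPart x (nilPart x e) = 0 := by
  have hweight : ∀ b ∈ M, ∃ c, matCoef e₁ e₁ (b * x * b⁻¹) = c * matCoef e₁ e₁ x ∧
      (altCoef e₁ e₂ (b * x * b⁻¹)) ^ 2 = c * (altCoef e₁ e₂ x) ^ 2 := by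
    intro b hb
    obtain ⟨χ, ψ, τ, h1, h2⟩ := hev b⁻¹ (inv_mem hb)
    have h3 := mem_evenOrthGroup.1 (hM (inv_mem hb)) e₂
    rw [h2, quadForm_add, quadForm_smul, quadForm_smul, he₁, map_smul, map_smul,
      LinearMap.smul_apply, h₁₂, smul_zero, smul_zero, mul_zero, add_zero, add_zero] at h3
    have h4 : ψ ^ 2 = 1 := mul_right_cancel₀ he₂ (by rw [h3, one_mul])
    refine ⟨χ ^ 2, ?_, ?_⟩
    · rw [matCoef_conj (hM hb), h1, matCoef_smul, pow_two]
    · have h5 : altCoef (χ • e₁) (ψ • e₂ + τ • e₁) x = χ * ψ * altCoef e₁ e₂ x := by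
        have h6 := matCoef_add_smul χ 0 ψ τ e₁ e₁ e₂ e₁ x
        have h7 := matCoef_add_smul ψ τ χ 0 e₂ e₁ e₁ e₁ x
        simp only [zero_smul, add_zero] at h6 h7
        rw [altCoef_eq hx, altCoef_eq hx, h6, h7]
        ring
      rw [altCoef_conj (hM hb), h1, h2, h5]
      linear_combination χ ^ 2 * altCoef e₁ e₂ x ^ 2 * h4
  have hnot : ∀ c : k, e₂ ≠ c • e₁ := by
    rintro c rfl
    apply he₂
    rw [quadForm_smul, he₁, mul_zero]
  have htrans : ∀ e w, quadForm k n e = 0 → e ≠ 0 → polForm k n w e = 0 →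
      quadForm k n w = quadForm k n e₂ →
      ∃ h ∈ evenSOGroup k n, glAct _ k h⁻¹ e₁ = e ∧ glAct _ k h⁻¹ e₂ = w := by
    intro e w he he0 hew hw
    obtain ⟨h, hh, h1, h2⟩ := exists_evenSOGroup_map_pair (by omega) he₁ he₁0 he he0 h₁₂ hew hnot
      (by
        rintro c rfl
        apply he₂
        rw [← hw, quadForm_smul, he, mul_zero]) hw.symm
    exact ⟨h⁻¹, inv_mem hh, by rwa [inv_inv], by rwa [inv_inv]⟩
  by_cases h0 : matCoef e₁ e₁ x = 0
  · have hall : ∀ e, quadForm k n e = 0 → quadForm k n (nilPart x e) = 0 := by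
      intro e he
      by_cases he0 : e = 0
      · rw [he0, map_zero, quadForm_zero]
      obtain ⟨z, hz⟩ := exists_nonsingular_perp (W := Submodule.span k {e})
        ((finrank_span_le_card _).trans_lt (by simp; omega))
      obtain ⟨t, ht⟩ := IsAlgClosed.exists_eq_mul_self (quadForm k n e₂ / quadForm k n z)
      obtain ⟨h, hh, h1, -⟩ := htrans e (t • z) he he0
        (by rw [map_smul, LinearMap.smul_apply, hz.1 e (Submodule.mem_span_singleton_self e),
          smul_zero])
        (by rw [quadForm_smul, pow_two, ← ht, div_mul_cancel₀ _ hz.2])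
      have h2 := hd _ (matCoef_mem e₁ e₁) (fun b hb => by
        obtain ⟨c, hc, -⟩ := hweight b hb
        rw [hc, h0, mul_zero]) h hh
      rwa [matCoef_conj (evenSOGroup_le hh), h1, matCoef, ← quadForm_nilPart hx] at h2
    have hlin : ∀ w, polForm k n w e = 0 → polForm k n (nilPart x w) (nilPart x e) = 0 := by
      intro w hw
      refine dual_eq_zero_of_singular he ((polForm k n).flip (nilPart x e) ∘ₗ nilPart x) ?_ hw
      intro w hw hwQ
      have h1 := hall (w + e) (by rw [quadForm_add, hwQ, he, hw, add_zero, add_zero])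
      rwa [map_add, quadForm_add, hall w hwQ, heN, zero_add, zero_add] at h1
    refine nilPart_nilPart_eq_zero_of_altCoef hx hnil he0 fun w hw => ?_
    have h1 := hlin w hw
    rw [polForm_nilPart_left hx, neg_eq_zero, ← glAct_sub_inv, map_sub] at h1
    rw [altCoef_eq hx, ← neg_eq_zero, neg_sub, ← altCoef_eq hx]
    exact h1
  · refine nilPart_nilPart_eq_zero_of_altCoef hx hnil he0 fun w hw => ?_
    have h1 : ∀ w, altCoef e w x
        = ((polForm k n e) ∘ₗ (glAct _ k x - glAct _ k x⁻¹)) w := fun w => by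
      simp [altCoef, matCoef]
    rw [h1]
    refine dual_eq_zero_of_nonsingular (by omega) _ ?_ hw
    intro w hw hwQ
    rw [← h1]
    obtain ⟨t, ht⟩ := IsAlgClosed.exists_eq_mul_self (quadForm k n e₂ / quadForm k n w)
    have ht' : t ^ 2 * quadForm k n w = quadForm k n e₂ := by
      rw [pow_two, ← ht, div_mul_cancel₀ _ hwQ]
    have ht0 : t ≠ 0 := by
      rintro rfl
      apply he₂
      rw [← ht']; ring
    obtain ⟨h, hh, h2, h3⟩ := htrans e (t • w) he he0
      (by rw [map_smul, LinearMap.smul_apply, hw, smul_zero])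
      (by rw [quadForm_smul, ht'])
    have h4 := hd.mul_eq_mul (matCoef_mem e₁ e₁) (pow_mem_glReg (altCoef_mem e₁ e₂) 2) hweight hh
    rw [matCoef_conj (evenSOGroup_le hh), altCoef_conj (evenSOGroup_le hh), h2, h3,
      matCoef, matCoef, ← quadForm_nilPart hx e, heN, mul_zero] at h4
    have h5 := eq_zero_of_pow_eq_zero ((mul_eq_zero.1 h4).resolve_left h0)
    rw [h1, map_smul, smul_eq_mul] at h5
    rw [h1]
    exact (mul_eq_zero.1 h5).resolve_left ht0

end SphericalClasses

section SphericalImpliesInvolution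

variable {M : Subgroup (GL (Fin n ⊕ Fin n) k)} {x : GL (Fin n ⊕ Fin n) k} [CharP k 2]

/-- If some nonzero combination of `g e` and `g⁻¹ e` is orthogonal to `e^⊥`, then
`(g - 1)² e = 0`. -/
lemma nilPart_nilPart_eq_zero_of_combination {g : GL (Fin n ⊕ Fin n) k}
    (hg : g ∈ evenOrthGroup k n) (hnil : IsNilpotent (nilPart g)) {e : Fin n ⊕ Fin n → k}
    (he : e ≠ 0) {a b : k} (hab : a ≠ 0 ∨ b ≠ 0)
    (h : ∀ w, polForm k n w e = 0 → a * matCoef e w g + b * matCoef w e g = 0) :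
    nilPart g (nilPart g e) = 0 := by
  obtain ⟨d, hd⟩ := mem_span_singleton_of_polForm (e := e)
    (y := a • glAct _ k g⁻¹ e + b • glAct _ k g e) (by
    intro w hw
    have h1 := h w hw
    rw [← inv_inv g, matCoef_inv (inv_mem hg), inv_inv] at h1
    rwa [map_add, map_smul, map_smul])
  have h2 : (a + b) • e + b • nilPart g (nilPart g e) = d • e + d • nilPart g e := by
    have h3 := congrArg (glAct _ k g) hd
    rw [map_add, map_smul, map_smul, map_smul, glAct_self_inv, glAct_eq_add_nilPart g e] at h3
    rw [nilPart_nilPart, ← smul_add, ← h3, glAct_eq_add_nilPart g e]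
    module
  have h4 : nilPart g ((d • 1 - b • nilPart g : Module.End k (Fin n ⊕ Fin n → k)) e)
      = (a + b - d) • e := by
    simp only [LinearMap.sub_apply, LinearMap.smul_apply, Module.End.one_apply, map_sub, map_smul]
    rw [sub_smul]
    linear_combination (exp := 1) -h2
  have hcomm : Commute (nilPart g) (d • 1 - b • nilPart g) :=
    (((Commute.one_right _).smul_right d).sub_right ((Commute.refl _).smul_right b))
  have h5 := eq_zero_of_isNilpotent hnil hcomm he h4
  have h6 : b • nilPart g (nilPart g e) = d • nilPart g e := by
    have h7 : a + b = d := sub_eq_zero.1 h5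
    rw [h7] at h2
    exact add_left_cancel h2
  by_cases hd0 : d = 0
  · rw [hd0, zero_smul] at h6
    refine (smul_eq_zero.1 h6).resolve_left ?_
    rintro rfl
    rw [hd0, sub_zero, add_zero] at h5
    simp [h5] at hab
  · by_cases hNe : nilPart g e = 0
    · rw [hNe, map_zero]
    · refine absurd (eq_zero_of_isNilpotent hnil (P := b • 1)
        ((Commute.one_right _).smul_right b) hNe ?_) hd0
      simpa using h6

variable [IsAlgClosed k]

/-- The case of a stable flag `⟨e₁⟩ < ⟨e₁, e₂⟩` with `e₁` and `e₂` singular. -/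
lemma nilPart_nilPart_eq_zero_of_flag_singular (hn : 4 ≤ n) (hx : x ∈ evenOrthGroup k n)
    (hnil : IsNilpotent (nilPart x)) (hM : M ≤ evenOrthGroup k n) (hd : IsDenseInClass M x)
    {e₁ e₂ : Fin n ⊕ Fin n → k} (he₁ : quadForm k n e₁ = 0) (he₁0 : e₁ ≠ 0)
    (he₂ : quadForm k n e₂ = 0) (hnot : ∀ c : k, e₂ ≠ c • e₁) (h₁₂ : polForm k n e₂ e₁ = 0)
    (hev : ∀ b ∈ M, ∃ χ ψ τ : k, glAct _ k b e₁ = χ • e₁ ∧ glAct _ k b e₂ = ψ • e₂ + τ • e₁)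
    {e : Fin n ⊕ Fin n → k} (he : quadForm k n e = 0) (he0 : e ≠ 0)
    (heN : quadForm k n (nilPart x e) = 0) : nilPart x (nilPart x e) = 0 := by
  let f₂ : GL (Fin n ⊕ Fin n) k → k := fun g =>
    matCoef e₁ e₁ g * matCoef e₂ e₂ g - matCoef e₁ e₂ g * matCoef e₂ e₁ g
  have hf₂ : f₂ ∈ glReg (Fin n ⊕ Fin n) k := sub_mem_glReg
    (mul_mem_glReg (matCoef_mem _ _) (matCoef_mem _ _))
    (mul_mem_glReg (matCoef_mem _ _) (matCoef_mem _ _))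
  have hweight : ∀ b ∈ M, ∃ c, (altCoef e₁ e₂ (b * x * b⁻¹)) ^ 2 = c * (altCoef e₁ e₂ x) ^ 2 ∧
      f₂ (b * x * b⁻¹) = c * f₂ x := by
    intro b hb
    obtain ⟨χ, ψ, τ, h1, h2⟩ := hev b⁻¹ (inv_mem hb)
    have h6 := matCoef_add_smul χ 0 ψ τ e₁ e₁ e₂ e₁ x
    have h7 := matCoef_add_smul ψ τ χ 0 e₂ e₁ e₁ e₁ x
    have h8 := matCoef_add_smul ψ τ ψ τ e₂ e₁ e₂ e₁ x
    simp only [zero_smul, add_zero] at h6 h7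
    refine ⟨χ ^ 2 * ψ ^ 2, ?_, ?_⟩
    · have h5 : altCoef (χ • e₁) (ψ • e₂ + τ • e₁) x = χ * ψ * altCoef e₁ e₂ x := by
        rw [altCoef_eq hx, altCoef_eq hx, h6, h7]
        ring
      rw [altCoef_conj (hM hb), h1, h2, h5]
      ring
    · simp only [f₂]
      rw [matCoef_conj (hM hb), matCoef_conj (hM hb), matCoef_conj (hM hb), matCoef_conj (hM hb),
        h1, h2, h6, h7, h8, matCoef_smul]
      ring
  have hee : altCoef e e x = 0 := by rw [altCoef_eq hx, sub_self]
  have htrans : ∀ w, polForm k n w e = 0 → quadForm k n w = 0 → (∀ c : k, w ≠ c • e) →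
      ∃ h ∈ evenSOGroup k n, glAct _ k h⁻¹ e₁ = e ∧ glAct _ k h⁻¹ e₂ = w := by
    intro w hew hw hwe
    obtain ⟨h, hh, h1, h2⟩ := exists_evenSOGroup_map_pair (by omega) he₁ he₁0 he he0 h₁₂ hew hnot
      hwe (by rw [he₂, hw])
    exact ⟨h⁻¹, inv_mem hh, by rwa [inv_inv], by rwa [inv_inv]⟩
  have heN' : matCoef e e x = 0 := by rw [matCoef, ← quadForm_nilPart hx, heN]
  by_cases h0 : altCoef e₁ e₂ x = 0
  · refine nilPart_nilPart_eq_zero_of_altCoef hx hnil he0 fun w hw => ?_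
    have h1 : ∀ w, altCoef e w x
        = ((polForm k n e) ∘ₗ (glAct _ k x - glAct _ k x⁻¹)) w := fun w => by
      simp [altCoef, matCoef]
    rw [h1]
    refine dual_eq_zero_of_singular he _ ?_ hw
    intro w hw hwQ
    by_cases hwe : ∃ c : k, w = c • e
    · obtain ⟨c, rfl⟩ := hwe
      rw [map_smul, ← h1, hee, smul_zero]
    push Not at hwe
    obtain ⟨h, hh, h2, h3⟩ := htrans w hw hwQ hwe
    have h4 := hd _ (altCoef_mem e₁ e₂) (fun b hb => by
      obtain ⟨c, hc, -⟩ := hweight b hb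
      rw [h0, zero_pow two_ne_zero, mul_zero] at hc
      exact eq_zero_of_pow_eq_zero hc) h hh
    rwa [altCoef_conj (evenSOGroup_le hh), h2, h3, h1] at h4
  · obtain ⟨c, hc⟩ : ∃ c, ∀ w, polForm k n w e = 0 → quadForm k n w = 0 →
        c * matCoef e w x ^ 2 + matCoef e w x * matCoef w e x + c * matCoef w e x ^ 2 = 0 := by
      refine ⟨f₂ x / altCoef e₁ e₂ x ^ 2, fun w hw hwQ => ?_⟩
      by_cases hwe : ∃ c : k, w = c • e
      · obtain ⟨c, rfl⟩ := hwe
        have h1 := matCoef_smul 1 c e e x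
        have h2 := matCoef_smul c 1 e e x
        rw [heN', mul_zero, one_smul] at h1 h2
        rw [h1, h2]
        ring
      push Not at hwe
      obtain ⟨h, hh, h2, h3⟩ := htrans w hw hwQ hwe
      have h4 := hd.mul_eq_mul (pow_mem_glReg (altCoef_mem e₁ e₂) 2) hf₂ hweight hh
      simp only [f₂] at h4 ⊢
      rw [altCoef_conj (evenSOGroup_le hh), matCoef_conj (evenSOGroup_le hh),
        matCoef_conj (evenSOGroup_le hh), matCoef_conj (evenSOGroup_le hh),
        matCoef_conj (evenSOGroup_le hh), h2, h3, heN', altCoef_eq hx e w] at h4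
      field_simp
      have h5 := CharTwo.two_eq_zero (R := k)
      linear_combination (-1 : k) * h4 + ((matCoef e₁ e₁ x * matCoef e₂ e₂ x
        - matCoef e₁ e₂ x * matCoef e₂ e₁ x) * matCoef e w x * matCoef w e x
        ) * h5
    obtain ⟨a, b, a', b', hab, hab', hfac⟩ : ∃ a b a' b' : k, (a ≠ 0 ∨ b ≠ 0) ∧ (a' ≠ 0 ∨ b' ≠ 0) ∧
        ∀ p q : k, (a * p + b * q) * (a' * p + b' * q) = c * p ^ 2 + p * q + c * q ^ 2 := by
      by_cases hc0 : c = 0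
      · exact ⟨1, 0, 0, 1, by simp, by simp, fun p q => by rw [hc0]; ring⟩
      · obtain ⟨s, hs⟩ := exists_quadratic_root c one_ne_zero c
        have hs0 : s ≠ 0 := by
          rintro rfl
          apply hc0
          linear_combination hs
        refine ⟨1, s, c, c / s, by simp, by simp [hc0], fun p q => ?_⟩
        field_simp
        have h5 := CharTwo.two_eq_zero (R := k)
        linear_combination p * q * hs - p * q * s * h5
    have hlin : ∀ a b w, a * matCoef e w x + b * matCoef w e x
        = ((polForm k n e) ∘ₗ (a • glAct _ k x + b • glAct _ k x⁻¹)) w := fun a b w => by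
      rw [← matCoef_inv hx e w]
      simp [matCoef]
    rcases dual_mul_eq_zero_of_singular (by omega) he
      ((polForm k n e) ∘ₗ (a • glAct _ k x + b • glAct _ k x⁻¹))
      ((polForm k n e) ∘ₗ (a' • glAct _ k x + b' • glAct _ k x⁻¹)) (by
        intro w hw hwQ
        rw [← hlin, ← hlin, hfac, hc w hw hwQ]) with h1 | h1
    · exact nilPart_nilPart_eq_zero_of_combination hx hnil he0 hab fun w hw => by
        rw [hlin, h1 w hw]
    · exact nilPart_nilPart_eq_zero_of_combination hx hnil he0 hab' fun w hw => by
        rw [hlin, h1 w hw]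

/-- A unipotent class on which a connected solvable group has a dense orbit consists of
involutions. -/
lemma nilPart_nilPart_eq_zero_of_isDenseInClass (hn : 4 ≤ n) (hx : x ∈ evenOrthGroup k n)
    (hnil : IsNilpotent (nilPart x)) (hM : M ≤ evenOrthGroup k n)
    (hMcon : IsPreconnected (M : Set (GL (Fin n ⊕ Fin n) k))) [Group.IsSolvable M]
    (hd : IsDenseInClass M x) (v : Fin n ⊕ Fin n → k) : nilPart x (nilPart x v) = 0 := by
  obtain ⟨e₁, -, he₁0, hev₁⟩ := exists_eigenvector_mod hMcon (F := ⊥) (U := ⊤)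
    (fun b _ v hv => by rw [Submodule.mem_bot] at hv ⊢; rw [hv, map_zero])
    (fun _ _ _ _ => trivial) (by
      intro h
      have h1 := h (Submodule.mem_top (x := eVec k (⟨0, by omega⟩ : Fin n)))
      rw [Submodule.mem_bot] at h1
      have h2 := congrFun h1 (Sum.inl ⟨0, by omega⟩)
      simp at h2)
  simp only [Submodule.mem_bot, sub_eq_zero] at he₁0 hev₁
  by_cases he₁ : quadForm k n e₁ = 0
  swap
  · exact nilPart_nilPart_eq_zero_of_eigenvector hx hnil hM hd he₁ hev₁ v
  have hspan : ∀ b ∈ M, ∀ v ∈ Submodule.span k {e₁}, glAct _ k b v ∈ Submodule.span k {e₁} := by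
    intro b hb v hv
    obtain ⟨t, rfl⟩ := Submodule.mem_span_singleton.1 hv
    obtain ⟨c, hc⟩ := hev₁ b hb
    rw [map_smul, hc]
    exact Submodule.smul_mem _ _ (Submodule.smul_mem _ _ (Submodule.mem_span_singleton_self _))
  obtain ⟨e₂, he₂, hnot, hev₂⟩ := exists_eigenvector_mod hMcon (F := Submodule.span k {e₁})
    (U := LinearMap.ker (polForm k n e₁)) hspan (by
      intro b hb v hv
      rw [LinearMap.mem_ker] at hv ⊢
      obtain ⟨c, hc⟩ := hev₁ b⁻¹ (inv_mem hb)
      rw [polForm_comm, polForm_glAct_left (hM hb), hc, map_smul, polForm_comm, hv, smul_zero]) (by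
      intro hle
      obtain ⟨z, hz, hzQ⟩ := exists_nonsingular_perp (W := Submodule.span k {e₁})
        ((finrank_span_le_card _).trans_lt (by simp; omega))
      have h1 := hle (x := z) (by
        rw [LinearMap.mem_ker, polForm_comm]
        exact hz _ (Submodule.mem_span_singleton_self _))
      obtain ⟨t, rfl⟩ := Submodule.mem_span_singleton.1 h1
      rw [quadForm_smul, he₁, mul_zero] at hzQ
      exact hzQ rfl)
  have h₁₂ : polForm k n e₂ e₁ = 0 := by rwa [polForm_comm]
  have hev : ∀ b ∈ M, ∃ χ ψ τ : k,
      glAct _ k b e₁ = χ • e₁ ∧ glAct _ k b e₂ = ψ • e₂ + τ • e₁ := by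
    intro b hb
    obtain ⟨χ, hχ⟩ := hev₁ b hb
    obtain ⟨ψ, hψ⟩ := hev₂ b hb
    obtain ⟨τ, hτ⟩ := Submodule.mem_span_singleton.1 hψ
    exact ⟨χ, ψ, τ, hχ, by rw [hτ]; abel⟩
  have key : ∀ e, quadForm k n e = 0 → e ≠ 0 → quadForm k n (nilPart x e) = 0 →
      nilPart x (nilPart x e) = 0 := by
    intro e he he0 heN
    by_cases h0 : quadForm k n e₂ = 0
    · exact nilPart_nilPart_eq_zero_of_flag_singular hn hx hnil hM hd he₁ he₁0 h0
        (fun c hc => hnot (Submodule.mem_span_singleton.2 ⟨c, hc.symm⟩)) h₁₂ hev he he0 heN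
    · exact nilPart_nilPart_eq_zero_of_flag_nonsingular hn hx hnil hM hd he₁ he₁0 h0 h₁₂ hev he
        he0 heN
  by_contra hv
  obtain ⟨e, he, heN, hNN⟩ := exists_singular_quadForm_nilPart_eq_zero hn hx hnil (fun h => hv (by
    have h1 := LinearMap.congr_fun h v
    rwa [pow_two] at h1))
  exact hNN (key e he (by rintro rfl; simp at hNN) heN)

end SphericalImpliesInvolution

/-! ### Block Gram matrices of symmetric bilinear forms -/

/-- The involution of `ℕ` which is the identity for `p = 1` and swaps `2 * m` and `2 * m + 1`
for `p = 2`. -/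
def blockSwap (p i : ℕ) : ℕ := 2 * (p * (i / p)) + p - 1 - i

section BlockSwap

variable {p : ℕ}

lemma blockSwap_one (i : ℕ) : blockSwap 1 i = i := by simp only [blockSwap]; omega

lemma blockSwap_blockSwap (hp : p = 1 ∨ p = 2) (i : ℕ) : blockSwap p (blockSwap p i) = i := by
  rcases hp with rfl | rfl <;> simp only [blockSwap] <;> omega

lemma eq_blockSwap_comm (hp : p = 1 ∨ p = 2) {i j : ℕ} :
    i = blockSwap p j ↔ j = blockSwap p i := by
  constructor <;> rintro rfl <;> rw [blockSwap_blockSwap hp]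

lemma blockSwap_lt (hp : p = 1 ∨ p = 2) {i b : ℕ} (hb : p ∣ b) (hi : i < b) :
    blockSwap p i < b := by
  rcases hp with rfl | rfl <;> simp only [blockSwap] <;> omega

lemma eq_blockSwap_self_iff (hp : p = 1 ∨ p = 2) (i : ℕ) : i = blockSwap p i ↔ p = 1 := by
  rcases hp with rfl | rfl
  · simp [blockSwap_one]
  · simp only [blockSwap]; omega

lemma eq_or_eq_blockSwap (hp : p = 1 ∨ p = 2) {i j : ℕ} (h : i / p = j / p) :
    i = j ∨ i = blockSwap p j := by
  rcases hp with rfl | rfl <;> simp only [blockSwap] <;> omega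

end BlockSwap

section Gram

variable {V : Type*} [AddCommGroup V] [Module k V] {γ : LinearMap.BilinForm k V}

/-- The Gram matrix of the first `m` vectors of a sequence. -/
def gramMatrix (γ : LinearMap.BilinForm k V) (v : ℕ → V) (m : ℕ) : Matrix (Fin m) (Fin m) k :=
  Matrix.of fun i j => γ (v i) (v j)

lemma gramMatrix_vecMul (v : ℕ → V) (m : ℕ) (c : Fin m → k) (j : Fin m) :
    (c ᵥ* gramMatrix γ v m) j = γ (∑ i, c i • v i) (v j) := by
  simp [gramMatrix, Matrix.vecMul, dotProduct]

lemma gramMatrix_det_ne_zero {v : ℕ → V} {m : ℕ}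
    (h : ∀ c : Fin m → k, (∀ j : Fin m, γ (∑ i, c i • v i) (v j) = 0) → c = 0) :
    (gramMatrix γ v m).det ≠ 0 := by
  intro h0
  obtain ⟨c, hc0, hc⟩ := Matrix.exists_vecMul_eq_zero_iff.2 h0
  exact hc0 (h c fun j => by rw [← gramMatrix_vecMul, hc]; rfl)

lemma eq_zero_of_gramMatrix {v : ℕ → V} {m : ℕ} (h : (gramMatrix γ v m).det ≠ 0)
    {c : Fin m → k} (hc : ∀ j : Fin m, γ (∑ i, c i • v i) (v j) = 0) : c = 0 := by
  by_contra hc0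
  exact h (Matrix.exists_vecMul_eq_zero_iff.1 ⟨c, hc0, funext fun j => by
    rw [gramMatrix_vecMul, hc]; rfl⟩)

lemma exists_gramMatrix_eq {v : ℕ → V} {m : ℕ} (h : (gramMatrix γ v m).det ≠ 0)
    (y : Fin m → k) : ∃ c : Fin m → k, ∀ j : Fin m, γ (∑ i, c i • v i) (v j) = y j := by
  refine ⟨y ᵥ* (gramMatrix γ v m)⁻¹, fun j => ?_⟩
  rw [← gramMatrix_vecMul, Matrix.vecMul_vecMul, Matrix.nonsing_inv_mul _ (isUnit_iff_ne_zero.2 h),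
    Matrix.vecMul_one]

lemma linearIndependent_of_gramMatrix {v : ℕ → V} {m : ℕ} (h : (gramMatrix γ v m).det ≠ 0) :
    LinearIndependent k fun i : Fin m => γ (v i) := by
  rw [Fintype.linearIndependent_iff]
  intro c hc i
  refine congrFun (eq_zero_of_gramMatrix h fun j => ?_) i
  have := LinearMap.congr_fun hc (v j)
  simpa using this

variable [FiniteDimensional k V]

lemma le_finrank_range_of_gramMatrix {v : ℕ → V} {m : ℕ} (h : (gramMatrix γ v m).det ≠ 0) :
    m ≤ Module.finrank k (LinearMap.range γ) := by
  have h1 := linearIndependent_of_gramMatrix h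
  have h2 := finrank_span_eq_card h1
  rw [Fintype.card_fin] at h2
  rw [← h2]
  refine Submodule.finrank_mono (Submodule.span_le.2 ?_)
  rintro _ ⟨i, rfl⟩
  exact ⟨v i, rfl⟩

lemma form_eq_zero_of_gramMatrix (hγ : ∀ x y, γ x y = γ y x) {v : ℕ → V} {m : ℕ}
    (h : (gramMatrix γ v m).det ≠ 0) (hm : m = Module.finrank k (LinearMap.range γ)) {w : V}
    (hw : ∀ i < m, γ w (v i) = 0) : γ w = 0 := by
  have h1 := linearIndependent_of_gramMatrix h
  have h2 := finrank_span_eq_card h1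
  rw [Fintype.card_fin, hm] at h2
  have h3 : Submodule.span k (Set.range fun i : Fin m => γ (v i)) = LinearMap.range γ := by
    refine Submodule.eq_of_le_of_finrank_eq (Submodule.span_le.2 ?_) (by rw [← h2, hm])
    rintro _ ⟨i, rfl⟩
    exact ⟨v i, rfl⟩
  have h4 : Submodule.span k (Set.range fun i : Fin m => γ (v i))
      ≤ LinearMap.ker (Module.Dual.eval k V w) := by
    rw [Submodule.span_le]
    rintro _ ⟨i, rfl⟩
    show γ (v i) w = 0
    rw [hγ, hw i i.2]
  refine LinearMap.ext fun x => ?_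
  have h5 : γ x ∈ LinearMap.ker (Module.Dual.eval k V w) := h4 (h3 ▸ ⟨x, rfl⟩)
  rw [hγ]
  exact h5

/-- The first `m` vectors of a sequence are permuted into a dual family by `blockSwap p`. -/
def IsBlockSystem (γ : LinearMap.BilinForm k V) (p m : ℕ) (v : ℕ → V) : Prop :=
  ∀ i < m, ∀ j < m, γ (v i) (v j) = if i = blockSwap p j then 1 else 0

variable {p : ℕ}

omit [FiniteDimensional k V] in
lemma IsBlockSystem.mono {m m' : ℕ} {v : ℕ → V} (h : IsBlockSystem γ p m v) (hm : m' ≤ m) :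
    IsBlockSystem γ p m' v := fun i hi j hj => h i (hi.trans_le hm) j (hj.trans_le hm)

omit [FiniteDimensional k V] in
lemma IsBlockSystem.det_ne_zero (hp : p = 1 ∨ p = 2) {m : ℕ} (hm : p ∣ m) {v : ℕ → V}
    (h : IsBlockSystem γ p m v) : (gramMatrix γ v m).det ≠ 0 := by
  refine gramMatrix_det_ne_zero fun c hc => funext fun i => ?_
  have h1 := hc ⟨blockSwap p i, blockSwap_lt hp hm i.2⟩
  simp only [map_sum, map_smul, LinearMap.sum_apply, LinearMap.smul_apply, smul_eq_mul] at h1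
  rw [Finset.sum_eq_single i] at h1
  · rw [h i i.2 _ (blockSwap_lt hp hm i.2), blockSwap_blockSwap hp, if_pos rfl, mul_one] at h1
    exact h1
  · intro j _ hj
    rw [h j j.2 _ (blockSwap_lt hp hm i.2), blockSwap_blockSwap hp,
      if_neg fun h => hj (Fin.ext h), mul_zero]
  · simp

omit [FiniteDimensional k V] in
lemma IsBlockSystem.exists_perp (hp : p = 1 ∨ p = 2) {m : ℕ} (hm : p ∣ m) {v : ℕ → V}
    (h : IsBlockSystem γ p m v) (x : V) :
    ∃ c : Fin m → k, ∀ j < m, γ (x - ∑ i, c i • v i) (v j) = 0 := by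
  obtain ⟨c, hc⟩ := exists_gramMatrix_eq (h.det_ne_zero hp hm) fun j => γ x (v j)
  exact ⟨c, fun j hj => by rw [map_sub, LinearMap.sub_apply, hc ⟨j, hj⟩, sub_self]⟩

lemma IsBlockSystem.exists_perp_pair (hp : p = 1 ∨ p = 2) {m : ℕ}
    (hm : p ∣ m) {v : ℕ → V} (h : IsBlockSystem γ p m v)
    (hr : m < Module.finrank k (LinearMap.range γ)) :
    ∃ a b, (∀ j < m, γ a (v j) = 0) ∧ (∀ j < m, γ b (v j) = 0) ∧ γ a b = 1 := by
  by_contra! hcon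
  have h1 : ∀ a b, (∀ j < m, γ a (v j) = 0) → (∀ j < m, γ b (v j) = 0) → γ a b = 0 := by
    intro a b ha hb
    by_contra h0
    refine hcon a ((γ a b)⁻¹ • b) ha (fun j hj => ?_) ?_
    · rw [map_smul, LinearMap.smul_apply, hb j hj, smul_zero]
    · rw [map_smul, smul_eq_mul, inv_mul_cancel₀ h0]
  have h2 : LinearMap.range γ ≤ Submodule.span k (Set.range fun i : Fin m => γ (v i)) := by
    rintro _ ⟨x, rfl⟩
    obtain ⟨c, hc⟩ := h.exists_perp hp hm x
    have h3 : γ (x - ∑ i, c i • v i) = 0 := by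
      refine LinearMap.ext fun y => ?_
      obtain ⟨d, hd⟩ := h.exists_perp hp hm y
      have h4 := h1 _ _ hc hd
      rw [map_sub, sub_eq_zero] at h4
      rw [h4, map_sum, LinearMap.zero_apply]
      refine Finset.sum_eq_zero fun i _ => ?_
      rw [map_smul, hc i i.2, smul_zero]
    rw [map_sub, sub_eq_zero] at h3
    rw [h3, map_sum]
    refine Submodule.sum_mem _ fun i _ => ?_
    rw [map_smul]
    exact Submodule.smul_mem _ _ (Submodule.subset_span ⟨i, rfl⟩)
  have h3 := (Submodule.finrank_mono h2).trans (finrank_range_le_card _)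
  rw [Fintype.card_fin] at h3
  omega

/-- An alternating form of rank `r` has a symplectic system of length `r`. -/
lemma exists_isBlockSystem_two [CharP k 2] (hγ : ∀ x y, γ x y = γ y x) (halt : ∀ x, γ x x = 0) :
    2 ∣ Module.finrank k (LinearMap.range γ) ∧
      ∃ v, IsBlockSystem γ 2 (Module.finrank k (LinearMap.range γ)) v := by
  set r := Module.finrank k (LinearMap.range γ) with hr
  have hstep : ∀ m, 2 * m ≤ r + 1 → ∃ v, IsBlockSystem γ 2 (2 * m) v := by
    intro m
    induction m with
    | zero => exact fun _ => ⟨fun _ => 0, fun i hi => by omega⟩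
    | succ m ih =>
      intro hm
      obtain ⟨v, hv⟩ := ih (by omega)
      obtain ⟨a, b, ha, hb, hab⟩ := hv.exists_perp_pair (Or.inr rfl) (dvd_mul_right 2 m)
        (by omega)
      refine ⟨fun i => if i = 2 * m then a else if i = 2 * m + 1 then b else v i, ?_⟩
      have hs0 : blockSwap 2 (2 * m) = 2 * m + 1 := by simp only [blockSwap]; omega
      have hs1 : blockSwap 2 (2 * m + 1) = 2 * m := by simp only [blockSwap]; omega
      have hlt : ∀ i < 2 * m, blockSwap 2 i < 2 * m :=
        fun i hi => blockSwap_lt (Or.inr rfl) (dvd_mul_right 2 m) hi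
      intro i hi j hj
      have hcase : ∀ l, l < 2 * (m + 1) → l = 2 * m ∨ l = 2 * m + 1 ∨ l < 2 * m := by omega
      rcases hcase i hi with rfl | rfl | hi' <;> rcases hcase j hj with rfl | rfl | hj'
      · simp [hs0, halt]
      · simp [hs1, hab]
      · have := hlt j hj'
        simp [hj'.ne, (hj'.trans (Nat.lt_succ_self _)).ne, ha j hj', this.ne']
      · simp [hs0, hγ b a, hab]
      · simp [hs1, halt]
      · have := hlt j hj'
        simp [hj'.ne, (hj'.trans (Nat.lt_succ_self _)).ne, hb j hj',
          (this.trans (Nat.lt_succ_self _)).ne']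
      · simp [hi'.ne, (hi'.trans (Nat.lt_succ_self _)).ne, hγ (v i) a, ha i hi', hs0]
      · simp [hi'.ne, (hi'.trans (Nat.lt_succ_self _)).ne, hγ (v i) b, hb i hi', hs1]
      · simp [hi'.ne, (hi'.trans (Nat.lt_succ_self _)).ne, hj'.ne,
          (hj'.trans (Nat.lt_succ_self _)).ne, hv i hi' j hj']
  obtain ⟨v, hv⟩ := hstep ((r + 1) / 2) (by omega)
  have h1 := le_finrank_range_of_gramMatrix (hv.det_ne_zero (Or.inr rfl) (dvd_mul_right 2 _))
  have h2 : 2 * ((r + 1) / 2) = r := by omega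
  exact ⟨⟨_, h2.symm⟩, v, by rwa [h2] at hv⟩

/-- Over an algebraically closed field a nonalternating symmetric form of rank `r` has an
orthonormal system of length `r`. -/
lemma exists_isBlockSystem_one [CharP k 2] [IsAlgClosed k] (hγ : ∀ x y, γ x y = γ y x)
    {x₀ : V} (hx₀ : γ x₀ x₀ ≠ 0) :
    ∃ v, IsBlockSystem γ 1 (Module.finrank k (LinearMap.range γ)) v := by
  set r := Module.finrank k (LinearMap.range γ) with hr
  have hnorm : ∀ x, γ x x ≠ 0 → ∃ c : k, γ (c • x) (c • x) = 1 := by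
    intro x hx
    obtain ⟨c, hc⟩ := IsAlgClosed.exists_pow_nat_eq (γ x x)⁻¹ zero_lt_two
    refine ⟨c, ?_⟩
    simp only [map_smul, LinearMap.smul_apply, smul_eq_mul]
    rw [← mul_assoc, ← pow_two, hc, inv_mul_cancel₀ hx]
  have happ : ∀ m v x, IsBlockSystem γ 1 m v → (∀ j < m, γ x (v j) = 0) → γ x x = 1 →
      IsBlockSystem γ 1 (m + 1) fun i => if i = m then x else v i := by
    intro m v x hv hx hx1 i hi j hj
    have hcase : ∀ l, l < m + 1 → l = m ∨ l < m := by omega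
    rw [blockSwap_one]
    rcases hcase i hi with rfl | hi' <;> rcases hcase j hj with rfl | hj'
    · simp [hx1]
    · simp [hj'.ne, hj'.ne', hx j hj']
    · simp [hi'.ne, hγ (v i) x, hx i hi']
    · simp [hi'.ne, hj'.ne, hv i hi' j hj', blockSwap_one]
  suffices hstep : ∀ m ≤ r, ∃ v, IsBlockSystem γ 1 m v from hstep r le_rfl
  intro m
  induction m with
  | zero => exact fun _ => ⟨fun _ => 0, fun i hi => by omega⟩
  | succ m ih =>
    intro hm
    obtain ⟨v, hv⟩ := ih (by omega)
    by_cases hx : ∃ x, (∀ j < m, γ x (v j) = 0) ∧ γ x x ≠ 0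
    · obtain ⟨x, hx, hx1⟩ := hx
      obtain ⟨c, hc⟩ := hnorm x hx1
      refine ⟨_, happ m v (c • x) hv (fun j hj => ?_) hc⟩
      rw [map_smul, LinearMap.smul_apply, hx j hj, smul_zero]
    push Not at hx
    obtain ⟨a, b, ha, hb, hab⟩ := hv.exists_perp_pair (Or.inl rfl) (one_dvd m) (by omega)
    rcases m with _ | m
    · exact absurd (hx x₀ fun j hj => by omega) hx₀
    have hva : γ (v m) a = 0 := by rw [hγ, ha m (by omega)]
    have hvb : γ (v m) b = 0 := by rw [hγ, hb m (by omega)]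
    have hvv : γ (v m) (v m) = 1 := by
      rw [hv m (by omega) m (by omega), blockSwap_one, if_pos rfl]
    have hperp : ∀ y, (∀ j < m + 1, γ y (v j) = 0) → ∀ j < m, γ (v m + y) (v j) = 0 := by
      intro y hy j hj
      rw [map_add, LinearMap.add_apply, hy j (by omega), hv m (by omega) j (by omega),
        blockSwap_one, if_neg (by omega), add_zero]
    refine ⟨_, happ (m + 1) _ (v m + b) (happ m v (v m + a)
      (hv.mono (Nat.le_succ m)) (hperp a ha) ?_)
      (fun j hj => ?_) ?_⟩
    · simp only [map_add, LinearMap.add_apply, hvv, hva, ha m (Nat.lt_succ_self m), hx a ha, add_zero]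
    · rcases (show j = m ∨ j < m by omega) with rfl | hj'
      · simp only [if_true, map_add, LinearMap.add_apply, hvv, hva, hb j (Nat.lt_succ_self j),
          hγ b a, hab, add_zero, zero_add]
        exact CharTwo.add_self_eq_zero 1
      · simp only [hj'.ne, if_false]
        exact hperp b hb j hj'
    · simp only [map_add, LinearMap.add_apply, hvv, hvb, hb m (Nat.lt_succ_self m), hx b hb, add_zero]

/-- Triangular Gram-Schmidt process with respect to nonzero leading minors. -/
lemma exists_triangular_isBlockSystem [IsAlgClosed k] (hγ : ∀ x y, γ x y = γ y x)
    (hp : p = 1 ∨ p = 2) (halt : p = 2 → ∀ x, γ x x = 0) {r : ℕ}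
    (hr : r = Module.finrank k (LinearMap.range γ)) (hpr : p ∣ r) {e : ℕ → V}
    (hdet : ∀ b ≤ r, p ∣ b → (gramMatrix γ e b).det ≠ 0) :
    ∃ e' : ℕ → V, (∀ i, ∃ s : k, s ≠ 0 ∧ e' i - s • e i ∈ Submodule.span k (e '' Set.Iio i)) ∧
      IsBlockSystem γ p r e' ∧ ∀ i, r ≤ i → γ (e' i) = 0 := by
  have hp0 : 0 < p := by omega
  have hex : ∀ i, ∃ c : ℕ → k, ∀ j < if i < r then p * (i / p) else r,
      γ (e i - ∑ l ∈ Finset.range (if i < r then p * (i / p) else r), c l • e l) (e j) = 0 := by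
    intro i
    set b := if i < r then p * (i / p) else r with hb
    have hbr : b ≤ r ∧ p ∣ b := by
      rw [hb]
      split_ifs with h
      · exact ⟨(Nat.mul_div_le i p).trans h.le, dvd_mul_right _ _⟩
      · exact ⟨le_rfl, hpr⟩
    obtain ⟨c, hc⟩ := exists_gramMatrix_eq (hdet b hbr.1 hbr.2) fun j => γ (e i) (e j)
    refine ⟨fun l => if h : l < b then c ⟨l, h⟩ else 0, fun j hj => ?_⟩
    rw [Finset.sum_range, map_sub, LinearMap.sub_apply]
    simp only [Fin.is_lt, dif_pos]
    rw [hc ⟨j, hj⟩, sub_self]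
  choose c hc using hex
  set w : ℕ → V := fun i =>
    e i - ∑ l ∈ Finset.range (if i < r then p * (i / p) else r), c i l • e l with hw
  have hwe : ∀ i < r, ∀ j < p * (i / p), γ (w i) (e j) = 0 := fun i hi j hj =>
    hc i j (by rwa [if_pos hi])
  have hww : ∀ i < r, ∀ j < r, i / p = j / p → γ (w i) (w j) = γ (w i) (e j) := by
    intro i hi j hj hij
    simp only [hw, if_pos hj]
    rw [map_sub, sub_eq_self, map_sum]
    refine Finset.sum_eq_zero fun l hl => ?_
    rw [map_smul, hwe i hi l (by rw [hij]; exact Finset.mem_range.1 hl), smul_zero]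
  have hlow : ∀ i < r, ∀ j < r, j / p < i / p → γ (w i) (w j) = 0 := by
    intro i hi j hj hij
    have hji : j < p * (i / p) := by
      have h1 := Nat.lt_mul_div_succ j hp0
      exact h1.trans_le (Nat.mul_le_mul_left p hij)
    simp only [hw, if_pos hj]
    rw [map_sub, hwe i hi j hji, map_sum, zero_sub, neg_eq_zero]
    refine Finset.sum_eq_zero fun l hl => ?_
    have h2 := Nat.mul_div_le j p
    rw [map_smul, hwe i hi l (((Finset.mem_range.1 hl).trans_le h2).trans hji), smul_zero]
  have hoff : ∀ i < r, ∀ j < r, i ≠ blockSwap p j → γ (w i) (w j) = 0 := by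
    intro i hi j hj hij
    rcases lt_trichotomy (i / p) (j / p) with h | h | h
    · rw [hγ, hlow j hj i hi h]
    · rcases eq_or_eq_blockSwap hp h with rfl | h'
      · rcases hp with rfl | rfl
        · exact absurd (blockSwap_one i).symm hij
        · exact halt rfl _
      · exact absurd h' hij
    · exact hlow i hi j hj h
  have hne : ∀ i < r, γ (w i) (w (blockSwap p i)) ≠ 0 := by
    intro i hi h0
    set B := p * (i / p + 1) with hB
    have hBr : B ≤ r := by
      obtain ⟨q, rfl⟩ := hpr
      exact Nat.mul_le_mul_left p (Nat.div_lt_of_lt_mul hi)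
    have hiB : i < B := Nat.lt_mul_div_succ i hp0
    have hbi : p * (i / p) ≤ i := Nat.mul_div_le i p
    have h1 : ∀ l < B, γ (w i) (e l) = 0 := by
      intro l hl
      by_cases hl' : l < p * (i / p)
      · exact hwe i hi l hl'
      have hli : i / p = l / p := by
        refine le_antisymm ?_ (Nat.lt_succ_iff.1 (Nat.div_lt_of_lt_mul hl))
        rw [Nat.le_div_iff_mul_le hp0, mul_comm]
        exact not_lt.1 hl'
      rw [← hww i hi l (hl.trans_le hBr) hli]
      by_cases h : i = blockSwap p l
      · rwa [(eq_blockSwap_comm hp).1 h]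
      · exact hoff i hi l (hl.trans_le hBr) h
    have h2 : w i = ∑ l : Fin B, ((if (l : ℕ) = i then 1 else 0)
        - (if (l : ℕ) < p * (i / p) then c i l else 0) : k) • e l := by
      rw [← Finset.sum_range fun l => ((if l = i then 1 else 0)
        - (if l < p * (i / p) then c i l else 0) : k) • e l]
      simp only [sub_smul, Finset.sum_sub_distrib, ite_smul, one_smul, zero_smul,
        Finset.sum_ite_eq', Finset.mem_range, hiB, if_true, hw, if_pos hi]
      rw [← Finset.sum_filter]
      congr 2
      ext l
      simp only [Finset.mem_range, Finset.mem_filter]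
      omega
    have h3 := eq_zero_of_gramMatrix (hdet B hBr (dvd_mul_right _ _))
      (c := fun l : Fin B => ((if (l : ℕ) = i then 1 else 0)
        - (if (l : ℕ) < p * (i / p) then c i l else 0) : k)) (fun j => by
        rw [← h2]; exact h1 j j.2)
    have h4 := congrFun h3 ⟨i, hiB⟩
    simp [not_lt.2 hbi] at h4
  have hsq : ∀ a : k, ∃ s : k, s ^ 2 = a⁻¹ := fun a => IsAlgClosed.exists_pow_nat_eq _ zero_lt_two
  choose q hq using hsq
  refine ⟨fun i => (if i < r then q (γ (w i) (w (blockSwap p i))) else 1) • w i, fun i => ?_,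
    fun i hi j hj => ?_, fun i hi => ?_⟩
  · refine ⟨if i < r then q (γ (w i) (w (blockSwap p i))) else 1, ?_, ?_⟩
    · split_ifs with hi
      · intro h
        have h1 := hq (γ (w i) (w (blockSwap p i)))
        rw [h, zero_pow two_ne_zero] at h1
        exact inv_ne_zero (hne i hi) h1.symm
      · exact one_ne_zero
    · rw [← smul_sub]
      refine Submodule.smul_mem _ _ ?_
      simp only [hw, sub_sub_cancel_left]
      refine Submodule.neg_mem _ (Submodule.sum_mem _ fun l hl => Submodule.smul_mem _ _
        (Submodule.subset_span ⟨l, ?_, rfl⟩))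
      have h1 := Finset.mem_range.1 hl
      have h2 := Nat.mul_div_le i p
      rw [Set.mem_Iio]
      split_ifs at h1 <;> omega
  · simp only [if_pos hi, if_pos hj, map_smul, LinearMap.smul_apply, smul_eq_mul]
    split_ifs with h
    · have h' := (eq_blockSwap_comm hp).1 h
      rw [← h, ← h', hγ (w j) (w i), ← mul_assoc, ← pow_two, hq, inv_mul_cancel₀]
      have h1 := hne i hi
      rwa [← h'] at h1
    · rw [hoff i hi j hj h, mul_zero, mul_zero]
  · simp only [if_neg (not_lt.2 hi), one_smul]
    refine form_eq_zero_of_gramMatrix hγ (hdet r le_rfl hpr) hr fun j hj => ?_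
    exact hc i j (by rwa [if_neg (not_lt.2 hi)])

end Gram

/-! ### A connected solvable subgroup of the special orthogonal group -/

section StandardBorel

lemma IsPolyFun.det {m : Type*} [DecidableEq m] [Fintype m] {M : k → Matrix m m k}
    (hM : ∀ i j, IsPolyFun fun t => M t i j) : IsPolyFun fun t => (M t).det := by
  simp only [Matrix.det_apply']
  exact IsPolyFun.sum _ fun σ _ => (isPolyFun_const _).mul (IsPolyFun.prod _ fun i _ => hM _ _)

lemma IsPolyFun.adjugate {m : Type*} [DecidableEq m] [Fintype m] {M : k → Matrix m m k}
    (hM : ∀ i j, IsPolyFun fun t => M t i j) (i j : m) :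
    IsPolyFun fun t => (M t).adjugate i j := by
  simp only [Matrix.adjugate_apply]
  refine IsPolyFun.det fun a b => ?_
  by_cases h : a = j
  · subst h
    simpa only [Matrix.updateRow_self] using isPolyFun_const _
  · simpa only [Matrix.updateRow_ne h] using hM a b

/-- The element of the stabiliser of the span of the `e i` with Levi part `P` and unipotent part
`A`. -/
def blockGL {P : Matrix (Fin n) (Fin n) k} (hP : P.det ≠ 0) (A : Matrix (Fin n) (Fin n) k) :
    GL (Fin n ⊕ Fin n) k where
  val := Matrix.fromBlocks P (P * A) 0 (P⁻¹)ᵀ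
  inv := Matrix.fromBlocks P⁻¹ (-(A * Pᵀ)) 0 Pᵀ
  val_inv := by
    have hu := isUnit_iff_ne_zero.2 hP
    rw [Matrix.fromBlocks_multiply, Matrix.mul_nonsing_inv _ hu, ← Matrix.transpose_mul,
      Matrix.mul_nonsing_inv _ hu]
    simp [Matrix.mul_assoc]
  inv_val := by
    have hu := isUnit_iff_ne_zero.2 hP
    have ht : Pᵀ * (P⁻¹)ᵀ = 1 := by
      rw [← Matrix.transpose_mul, Matrix.nonsing_inv_mul _ hu, Matrix.transpose_one]
    rw [Matrix.fromBlocks_multiply, Matrix.nonsing_inv_mul _ hu, ← Matrix.mul_assoc P⁻¹,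
      Matrix.nonsing_inv_mul _ hu, Matrix.neg_mul]
    simp [Matrix.mul_assoc, ht]

/-- Matrices of quadratic forms `y ↦ y ⬝ᵥ A y` which vanish identically. -/
def IsAltMatrix (A : Matrix (Fin n) (Fin n) k) : Prop := ∀ y, (A *ᵥ y) ⬝ᵥ y = 0

lemma IsAltMatrix.smul {A : Matrix (Fin n) (Fin n) k} (hA : IsAltMatrix A) (t : k) :
    IsAltMatrix (t • A) := fun y => by
  rw [Matrix.smul_mulVec, smul_dotProduct, hA, smul_zero]

lemma quadForm_sumElim (x y : Fin n → k) : quadForm k n (Sum.elim x y) = x ⬝ᵥ y := rfl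

lemma dotProduct_mulVec_inv_transpose {P : Matrix (Fin n) (Fin n) k} (hP : P.det ≠ 0)
    (x y : Fin n → k) : (P *ᵥ x) ⬝ᵥ ((P⁻¹)ᵀ *ᵥ y) = x ⬝ᵥ y := by
  rw [Matrix.dotProduct_mulVec, Matrix.vecMul_transpose, Matrix.mulVec_mulVec,
    Matrix.nonsing_inv_mul _ (isUnit_iff_ne_zero.2 hP), Matrix.one_mulVec]

lemma blockGL_mem {P A : Matrix (Fin n) (Fin n) k} (hP : P.det ≠ 0) (hA : IsAltMatrix A) :
    blockGL hP A ∈ evenOrthGroup k n := by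
  refine mem_evenOrthGroup.2 fun v => ?_
  have hv : v = Sum.elim (v ∘ Sum.inl) (v ∘ Sum.inr) := (Sum.elim_comp_inl_inr v).symm
  rw [hv]
  change quadForm k n (Matrix.fromBlocks P (P * A) 0 (P⁻¹)ᵀ *ᵥ _) = _
  rw [Matrix.fromBlocks_mulVec, quadForm_sumElim, quadForm_sumElim]
  simp only [Sum.elim_comp_inl, Sum.elim_comp_inr, Matrix.zero_mulVec, zero_add]
  rw [add_dotProduct, ← Matrix.mulVec_mulVec, dotProduct_mulVec_inv_transpose hP,
    dotProduct_mulVec_inv_transpose hP, hA, add_zero]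

/-- The generators of the standard connected solvable subgroup. -/
def triangularSet (k : Type*) [Field k] (n : ℕ) : Set (GL (Fin n ⊕ Fin n) k) :=
  {g | ∃ (P : Matrix (Fin n) (Fin n) k) (hP : P.det ≠ 0) (A : Matrix (Fin n) (Fin n) k),
    P.BlockTriangular id ∧ IsAltMatrix A ∧ g = blockGL hP A}

/-- An orthogonal matrix with vanishing lower left block and upper triangular upper left block
lies in the standard connected solvable subgroup. -/
lemma mem_triangularSet {g : GL (Fin n ⊕ Fin n) k} (hg : g ∈ evenOrthGroup k n)
    (h₂₁ : (g : Matrix (Fin n ⊕ Fin n) (Fin n ⊕ Fin n) k).toBlocks₂₁ = 0)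
    (h₁₁ : (g : Matrix (Fin n ⊕ Fin n) (Fin n ⊕ Fin n) k).toBlocks₁₁.BlockTriangular id) : g ∈ triangularSet k n := by
  set P := (g : Matrix (Fin n ⊕ Fin n) (Fin n ⊕ Fin n) k).toBlocks₁₁ with hPdef
  set X := (g : Matrix (Fin n ⊕ Fin n) (Fin n ⊕ Fin n) k).toBlocks₁₂ with hX
  set D := (g : Matrix (Fin n ⊕ Fin n) (Fin n ⊕ Fin n) k).toBlocks₂₂ with hD
  have hgm : (g : Matrix (Fin n ⊕ Fin n) (Fin n ⊕ Fin n) k) = Matrix.fromBlocks P X 0 D := by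
    rw [← h₂₁]
    exact (Matrix.fromBlocks_toBlocks _).symm
  have hQ : ∀ x y : Fin n → k, (P *ᵥ x + X *ᵥ y) ⬝ᵥ (D *ᵥ y) = x ⬝ᵥ y := by
    intro x y
    have h := mem_evenOrthGroup.1 hg (Sum.elim x y)
    rw [glAct_apply, hgm, Matrix.fromBlocks_mulVec, quadForm_sumElim] at h
    simpa [quadForm_sumElim] using h
  have hXD : ∀ y : Fin n → k, (X *ᵥ y) ⬝ᵥ (D *ᵥ y) = 0 := fun y => by simpa using hQ 0 y
  have hPD : Pᵀ * D = 1 := by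
    refine Matrix.toBilin'.injective ?_
    refine LinearMap.ext fun x => LinearMap.ext fun y => ?_
    have h := hQ x y
    rw [add_dotProduct, hXD, add_zero] at h
    rw [Matrix.toBilin'_apply', Matrix.toBilin'_apply', Matrix.one_mulVec, ← h,
      ← Matrix.mulVec_mulVec, Matrix.dotProduct_mulVec x, Matrix.vecMul_transpose]
  have hP : P.det ≠ 0 := by
    have h := congrArg Matrix.det hPD
    rw [Matrix.det_mul, Matrix.det_transpose, Matrix.det_one] at h
    exact left_ne_zero_of_mul_eq_one h
  have hu := isUnit_iff_ne_zero.2 hP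
  have hDP : D = (P⁻¹)ᵀ := by
    rw [Matrix.transpose_nonsing_inv]
    exact (Matrix.inv_eq_right_inv hPD).symm
  refine ⟨P, hP, P⁻¹ * X, h₁₁, fun y => ?_, Units.ext ?_⟩
  · rw [← Matrix.mulVec_mulVec, ← dotProduct_mulVec_inv_transpose hP, Matrix.mulVec_mulVec,
      Matrix.mul_nonsing_inv _ hu, Matrix.one_mulVec, ← hDP, hXD]
  · rw [hgm, hDP]
    change _ = Matrix.fromBlocks P (P * (P⁻¹ * X)) 0 (P⁻¹)ᵀ
    rw [← Matrix.mul_assoc, Matrix.mul_nonsing_inv _ hu, Matrix.one_mul]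

/-- The standard connected solvable subgroup. -/
def triangularGroup (k : Type*) [Field k] (n : ℕ) : Subgroup (GL (Fin n ⊕ Fin n) k) :=
  Subgroup.closure (triangularSet k n)

lemma exists_curve_triangularSet [Infinite k] {g : GL (Fin n ⊕ Fin n) k}
    (hg : g ∈ triangularSet k n) :
    ∃ C ⊆ triangularSet k n, 1 ∈ C ∧ g ∈ C ∧ IsPreconnected C := by
  classical
  obtain ⟨P, hP, A, hPt, hA, rfl⟩ := hg
  let Pt : k → Matrix (Fin n) (Fin n) k := fun t => (1 - t) • 1 + t • P
  have hPt0 : Pt 0 = 1 := by simp [Pt]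
  have hPt1 : Pt 1 = P := by simp [Pt]
  have hentry : ∀ i j, IsPolyFun fun t => Pt t i j := fun i j =>
    (((isPolyFun_const 1).sub isPolyFun_id).mul (isPolyFun_const _)).add
      (isPolyFun_id.mul (isPolyFun_const _))
  obtain ⟨d, hd⟩ : ∃ d : Polynomial k, ∀ t, (Pt t).det = d.eval t := IsPolyFun.det hentry
  have hd0 : d ≠ 0 := by
    rintro rfl
    have := hd 0
    simp [hPt0] at this
  let c : k → GL (Fin n ⊕ Fin n) k := fun t =>
    if h : (Pt t).det ≠ 0 then blockGL h (t • A) else 1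
  have hc : ∀ t, d.eval t ≠ 0 → ∃ h : (Pt t).det ≠ 0, c t = blockGL h (t • A) := fun t ht =>
    ⟨by rwa [hd t], dif_pos _⟩
  have hinv : ∀ t i j, d.eval t ≠ 0 →
      (Pt t)⁻¹ i j * d.eval t = (Pt t).adjugate i j := by
    intro t i j ht
    rw [Matrix.inv_def, Ring.inverse_eq_inv, hd, Matrix.smul_apply, smul_eq_mul]
    field_simp
  have hmulA : ∀ i j, IsPolyFun fun t => (Pt t * (t • A)) i j := fun i j => by
    simp only [Matrix.mul_apply]
    exact IsPolyFun.sum _ fun l _ => (hentry i l).mul (isPolyFun_id.mul (isPolyFun_const _))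
  have hAmul : ∀ i j, IsPolyFun fun t => (-((t • A) * (Pt t)ᵀ)) i j := fun i j => by
    obtain ⟨R, hR⟩ : IsPolyFun fun t => ((t • A) * (Pt t)ᵀ) i j := by
      simp only [Matrix.mul_apply]
      exact IsPolyFun.sum _ fun l _ => (isPolyFun_id.mul (isPolyFun_const _)).mul (hentry j l)
    exact ⟨-R, fun t => by rw [Polynomial.eval_neg, ← hR]; rfl⟩
  have hpd : IsPolyFun fun t => d.eval t := ⟨d, fun _ => rfl⟩
  have hirr := isPreirreducible_rational_curve c d hd0 (by
    rintro (⟨i | i, j | j⟩ | ⟨i | i, j | j⟩)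
    · obtain ⟨R, hR⟩ := (hentry i j).mul hpd
      refine ⟨R, fun t ht => ?_⟩
      obtain ⟨h, e⟩ := hc t ht
      rw [e]
      exact hR t
    · obtain ⟨R, hR⟩ := (hmulA i j).mul hpd
      refine ⟨R, fun t ht => ?_⟩
      obtain ⟨h, e⟩ := hc t ht
      rw [e]
      exact hR t
    · refine ⟨0, fun t ht => ?_⟩
      obtain ⟨h, e⟩ := hc t ht
      rw [e, Polynomial.eval_zero]
      exact zero_mul _
    · obtain ⟨R, hR⟩ : ∃ R : Polynomial k, ∀ t, (Pt t).adjugate j i = R.eval t :=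
        IsPolyFun.adjugate hentry j i
      refine ⟨R, fun t ht => ?_⟩
      obtain ⟨h, e⟩ := hc t ht
      rw [e, ← hR, ← hinv t j i ht]
      rfl
    · obtain ⟨R, hR⟩ : ∃ R : Polynomial k, ∀ t, (Pt t).adjugate i j = R.eval t :=
        IsPolyFun.adjugate hentry i j
      refine ⟨R, fun t ht => ?_⟩
      obtain ⟨h, e⟩ := hc t ht
      rw [e, ← hR, ← hinv t i j ht]
      rfl
    · obtain ⟨R, hR⟩ := (hAmul i j).mul hpd
      refine ⟨R, fun t ht => ?_⟩
      obtain ⟨h, e⟩ := hc t ht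
      rw [e]
      exact hR t
    · refine ⟨0, fun t ht => ?_⟩
      obtain ⟨h, e⟩ := hc t ht
      rw [e, Polynomial.eval_zero]
      exact zero_mul _
    · obtain ⟨R, hR⟩ := (hentry j i).mul hpd
      refine ⟨R, fun t ht => ?_⟩
      obtain ⟨h, e⟩ := hc t ht
      rw [e]
      exact hR t)
  refine ⟨c '' {t | d.eval t ≠ 0}, ?_, ⟨0, ?_, ?_⟩, ⟨1, ?_, ?_⟩, hirr.isPreconnected⟩
  · rintro _ ⟨t, ht, rfl⟩
    obtain ⟨h, e⟩ := hc t ht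
    refine ⟨Pt t, h, t • A, ?_, hA.smul t, e⟩
    have h1 : (1 : Matrix (Fin n) (Fin n) k).BlockTriangular id := Matrix.blockTriangular_one
    intro i j hij
    change (1 - t) * (1 : Matrix (Fin n) (Fin n) k) i j + t * P i j = 0
    rw [h1 hij, hPt hij, mul_zero, mul_zero, add_zero]
  · simp [← hd 0, hPt0]
  · obtain ⟨h, e⟩ := hc 0 (by simp [← hd 0, hPt0])
    rw [e]
    refine Units.ext ?_
    change Matrix.fromBlocks (Pt 0) (Pt 0 * ((0 : k) • A)) 0 ((Pt 0)⁻¹)ᵀ = 1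
    rw [hPt0]
    simp
  · simpa [← hd 1, hPt1] using hP
  · obtain ⟨h, e⟩ := hc 1 (by simpa [← hd 1, hPt1] using hP)
    rw [e]
    refine Units.ext ?_
    change Matrix.fromBlocks (Pt 1) (Pt 1 * ((1 : k) • A)) 0 ((Pt 1)⁻¹)ᵀ =
      Matrix.fromBlocks P (P * A) 0 (P⁻¹)ᵀ
    rw [hPt1, one_smul]

lemma isPreconnected_triangularGroup [Infinite k] :
    IsPreconnected (triangularGroup k n : Set (GL (Fin n ⊕ Fin n) k)) :=
  isPreconnected_closure_of_generators fun g hg => by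
    obtain ⟨C, hC, h1, hgC, hpre⟩ := exists_curve_triangularSet hg
    exact ⟨C, hC.trans Subgroup.subset_closure, h1, hgC, hpre⟩

lemma triangularGroup_le_evenOrthGroup : triangularGroup k n ≤ evenOrthGroup k n := by
  rw [triangularGroup, Subgroup.closure_le]
  rintro _ ⟨P, hP, A, -, hA, rfl⟩
  exact blockGL_mem hP hA

lemma triangularGroup_le_evenSOGroup [Infinite k] : triangularGroup k n ≤ evenSOGroup k n :=
  subset_evenSOGroup isPreconnected_triangularGroup (one_mem _) triangularGroup_le_evenOrthGroup

/-- The position of a coordinate in the order `e 1, …, e n, f n, …, f 1`. -/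
def flagIndex : Fin n ⊕ Fin n → ℕ := Sum.elim (fun i => i) fun i => 2 * n - 1 - i

lemma flagIndex_injective : Function.Injective (flagIndex (n := n)) := by
  rintro (i | i) (j | j) h <;> simp only [flagIndex, Sum.elim_inl, Sum.elim_inr] at h
  · exact congrArg _ (Fin.ext h)
  · omega
  · omega
  · exact congrArg _ (Fin.ext (by omega))

/-- The standard complete flag. -/
def stdFlag (k : Type*) [Field k] (n : ℕ) (s : ℕ) : Submodule k (Fin n ⊕ Fin n → k) where
  carrier := {v | ∀ x, s ≤ flagIndex x → v x = 0}
  add_mem' := fun ha hb x hx => by rw [Pi.add_apply, ha x hx, hb x hx, add_zero]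
  zero_mem' := fun x _ => rfl
  smul_mem' := fun c v hv x hx => by rw [Pi.smul_apply, hv x hx, smul_zero]

lemma stdFlag_step (s : ℕ) : ∃ w ∈ stdFlag k n (s + 1),
    stdFlag k n (s + 1) ≤ stdFlag k n s ⊔ Submodule.span k {w} := by
  by_cases h : ∃ x : Fin n ⊕ Fin n, flagIndex x = s
  · obtain ⟨x, hx⟩ := h
    refine ⟨Pi.single x 1, fun y hy => ?_, fun v hv => ?_⟩
    · rw [Pi.single_eq_of_ne]
      rintro rfl
      omega
    · rw [Submodule.mem_sup]
      refine ⟨v - v x • Pi.single x 1, fun y hy => ?_, v x • Pi.single x 1,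
        Submodule.smul_mem _ _ (Submodule.mem_span_singleton_self _), sub_add_cancel _ _⟩
      rcases eq_or_ne y x with rfl | hyx
      · simp
      · have h1 : flagIndex y ≠ s := fun h => hyx (flagIndex_injective (h.trans hx.symm))
        simp [hyx, hv y (by omega)]
  · refine ⟨0, zero_mem _, fun v hv => Submodule.mem_sup_left fun y hy => hv y ?_⟩
    have h1 : flagIndex y ≠ s := fun h' => h ⟨y, h'⟩
    omega

lemma fromBlocks_mulVec_mem_stdFlag {P X D : Matrix (Fin n) (Fin n) k} (hP : P.BlockTriangular id)
    (hD : Dᵀ.BlockTriangular id) {s : ℕ} {v : Fin n ⊕ Fin n → k} (hv : v ∈ stdFlag k n s) :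
    Matrix.fromBlocks P X 0 D *ᵥ v ∈ stdFlag k n s := by
  have h : ∀ x y : Fin n ⊕ Fin n, flagIndex y < flagIndex x → Matrix.fromBlocks P X 0 D x y = 0 := by
    rintro (i | i) (j | j) hij <;> simp only [flagIndex, Sum.elim_inl, Sum.elim_inr] at hij
    · exact hP (show j < i from hij)
    · omega
    · rfl
    · exact hD (show i < j by omega)
  intro x hx
  change ∑ y, Matrix.fromBlocks P X 0 D x y * v y = 0
  refine Finset.sum_eq_zero fun y _ => ?_
  rcases lt_or_ge (flagIndex y) s with hy | hy
  · rw [h x y (hy.trans_le hx), zero_mul]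
  · rw [hv y hy, mul_zero]

lemma isStableFlag_stdFlag :
    IsStableFlag (2 * n) (stdFlag k n) (triangularGroup k n : Set (GL (Fin n ⊕ Fin n) k)) where
  zero := (Submodule.eq_bot_iff _).2 fun v hv => funext fun x => hv x (Nat.zero_le _)
  top := by
    refine (Submodule.eq_top_iff').2 fun v x hx => ?_
    rcases x with i | i <;> simp only [flagIndex, Sum.elim_inl, Sum.elim_inr] at hx <;> omega
  mono := fun s v hv x hx => hv x (by omega)
  step := stdFlag_step
  stable := by
    intro g hg
    refine (Subgroup.closure_induction (p := fun g _ =>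
      (∀ s, ∀ v ∈ stdFlag k n s, glAct _ k g v ∈ stdFlag k n s) ∧
        ∀ s, ∀ v ∈ stdFlag k n s, glAct _ k g⁻¹ v ∈ stdFlag k n s) ?_ ?_ ?_ ?_ hg).1
    · rintro _ ⟨P, hP, A, hPt, -, rfl⟩
      have := Matrix.invertibleOfIsUnitDet P (isUnit_iff_ne_zero.2 hP)
      have hPi : (P⁻¹).BlockTriangular id := Matrix.blockTriangular_inv_of_blockTriangular hPt
      exact ⟨fun s v hv => fromBlocks_mulVec_mem_stdFlag hPt hPi hv,
        fun s v hv => fromBlocks_mulVec_mem_stdFlag hPi hPt hv⟩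
    · simp
    · intro a b _ _ ha hb
      refine ⟨fun s v hv => ?_, fun s v hv => ?_⟩
      · rw [glAct_mul_apply]
        exact ha.1 s _ (hb.1 s v hv)
      · rw [mul_inv_rev, glAct_mul_apply]
        exact hb.2 s _ (ha.2 s v hv)
    · intro a _ ha
      exact ⟨ha.2, by rw [inv_inv]; exact ha.1⟩

end StandardBorel

/-! ### Involutions -/

section Involutions

/-- The bilinear form `(v, w) ↦ β(v, (g - 1) w)`. -/
def nilForm (g : GL (Fin n ⊕ Fin n) k) : LinearMap.BilinForm k (Fin n ⊕ Fin n → k) :=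
  (polForm k n).compl₂ (nilPart g)

lemma nilForm_apply (g : GL (Fin n ⊕ Fin n) k) (v w : Fin n ⊕ Fin n → k) :
    nilForm g v w = polForm k n v (nilPart g w) := rfl

/-- Orthogonal elements `g` with `(g - 1)² = 0`, where `r` is the rank of `g - 1` and `p`
distinguishes whether the associated bilinear form is alternating. -/
structure IsInvolutionOfType (p r : ℕ) (g : GL (Fin n ⊕ Fin n) k) : Prop where
  mem : g ∈ evenOrthGroup k n
  sq : ∀ v, nilPart g (nilPart g v) = 0
  rank : r = Module.finrank k (LinearMap.range (nilForm g))
  type : (p = 1 ∧ ∃ v, quadForm k n (nilPart g v) ≠ 0) ∨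
    (p = 2 ∧ ∀ v, quadForm k n (nilPart g v) = 0)

lemma nilPart_conj (h g : GL (Fin n ⊕ Fin n) k) (v : Fin n ⊕ Fin n → k) :
    nilPart (h * g * h⁻¹) v = glAct _ k h (nilPart g (glAct _ k h⁻¹ v)) := by
  rw [nilPart_apply, nilPart_apply, glAct_mul_apply, glAct_mul_apply, map_sub, glAct_self_inv]

lemma nilForm_conj {h : GL (Fin n ⊕ Fin n) k} (hh : h ∈ evenOrthGroup k n)
    (g : GL (Fin n ⊕ Fin n) k) (v w : Fin n ⊕ Fin n → k) :
    nilForm (h * g * h⁻¹) v w = nilForm g (glAct _ k h⁻¹ v) (glAct _ k h⁻¹ w) := by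
  rw [nilForm_apply, nilForm_apply, nilPart_conj, polForm_comm, polForm_glAct_left hh, polForm_comm]

lemma eq_of_eVec_fVec {S T : Module.End k (Fin n ⊕ Fin n → k)}
    (he : ∀ i, S (eVec k i) = T (eVec k i)) (hf : ∀ i, S (fVec k i) = T (fVec k i)) : S = T := by
  refine LinearMap.ext fun v => ?_
  rw [eq_sum_eVec_fVec v]
  simp only [map_add, map_sum, map_smul, he, hf]

lemma quadForm_sum_eq_zero {ι : Type*} (s : Finset ι) (x : ι → Fin n ⊕ Fin n → k) (c : ι → k)
    (hQ : ∀ i ∈ s, quadForm k n (x i) = 0)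
    (hx : ∀ i ∈ s, ∀ j ∈ s, polForm k n (x i) (x j) = 0) :
    quadForm k n (∑ i ∈ s, c i • x i) = 0 := by
  classical
  induction s using Finset.induction_on with
  | empty => simp
  | insert a s ha ih =>
    rw [Finset.sum_insert ha, quadForm_add, quadForm_smul, hQ a (Finset.mem_insert_self a s),
      ih (fun i hi => hQ i (Finset.mem_insert_of_mem hi))
        (fun i hi j hj => hx i (Finset.mem_insert_of_mem hi) j (Finset.mem_insert_of_mem hj)),
      map_sum, Finset.sum_eq_zero, mul_zero, add_zero, add_zero]
    intro i hi
    rw [map_smul, map_smul, LinearMap.smul_apply,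
      hx a (Finset.mem_insert_self a s) i (Finset.mem_insert_of_mem hi), smul_zero, smul_zero]

/-- Hyperbolic frames are the images of the standard one under the orthogonal group. -/
lemma exists_evenOrthGroup_frame {e f : Fin n → Fin n ⊕ Fin n → k}
    (heQ : ∀ i, quadForm k n (e i) = 0) (hfQ : ∀ i, quadForm k n (f i) = 0)
    (hee : ∀ i j, polForm k n (e i) (e j) = 0) (hff : ∀ i j, polForm k n (f i) (f j) = 0)
    (hef : ∀ i j, polForm k n (e i) (f j) = if i = j then 1 else 0) :
    ∃ b ∈ evenOrthGroup k n, (∀ i, glAct _ k b (eVec k i) = e i) ∧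
      ∀ i, glAct _ k b (fVec k i) = f i := by
  let T : Module.End k (Fin n ⊕ Fin n → k) :=
    ∑ i, (LinearMap.proj (Sum.inl i)).smulRight (e i)
      + ∑ i, (LinearMap.proj (Sum.inr i)).smulRight (f i)
  have hT : ∀ v, T v = ∑ i, v (Sum.inl i) • e i + ∑ i, v (Sum.inr i) • f i := fun v => by
    simp [T]
  obtain ⟨b, hb, hbT⟩ := exists_mem_evenOrthGroup T (fun v => by
    rw [hT, quadForm_add, quadForm_sum_eq_zero _ _ _ (fun i _ => heQ i) fun i _ j _ => hee i j,
      quadForm_sum_eq_zero _ _ _ (fun i _ => hfQ i) fun i _ j _ => hff i j, zero_add, zero_add]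
    simp only [map_sum, map_smul, LinearMap.sum_apply, LinearMap.smul_apply, hef, smul_eq_mul,
      mul_ite, mul_one, mul_zero, Finset.sum_ite_eq', Finset.mem_univ, if_true, quadForm]
    exact Finset.sum_congr rfl fun i _ => mul_comm _ _)
  refine ⟨b, hb, fun i => ?_, fun i => ?_⟩ <;> rw [hbT, hT] <;> simp

/-- The vectors `e i` extended by zero to all natural numbers. -/
def eSeq (k : Type*) [Field k] (n : ℕ) (i : ℕ) : Fin n ⊕ Fin n → k :=
  if h : i < n then eVec k ⟨i, h⟩ else 0

/-- The vectors `f i` extended by zero to all natural numbers. -/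
def fSeq (k : Type*) [Field k] (n : ℕ) (i : ℕ) : Fin n ⊕ Fin n → k :=
  if h : i < n then fVec k ⟨i, h⟩ else 0

@[simp] lemma eSeq_val (i : Fin n) : eSeq k n i = eVec k i := dif_pos i.2

lemma eSeq_of_lt {i : ℕ} (h : i < n) : eSeq k n i = eVec k ⟨i, h⟩ := dif_pos h

lemma fSeq_of_lt {i : ℕ} (h : i < n) : fSeq k n i = fVec k ⟨i, h⟩ := dif_pos h

lemma span_eSeq_apply {i : ℕ} {v : Fin n ⊕ Fin n → k}
    (hv : v ∈ Submodule.span k (eSeq k n '' Set.Iio i)) :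
    (∀ j, v (Sum.inr j) = 0) ∧ ∀ j : Fin n, i ≤ j → v (Sum.inl j) = 0 := by
  induction hv using Submodule.span_induction with
  | mem x hx =>
    obtain ⟨l, hl, rfl⟩ := hx
    rw [eSeq]
    split_ifs with h
    · refine ⟨fun j => eVec_inr _ _, fun j hj => ?_⟩
      rw [eVec_inl, if_neg]
      rintro rfl
      exact absurd hl (not_lt.2 hj)
    · exact ⟨fun j => rfl, fun j _ => rfl⟩
  | zero => exact ⟨fun j => rfl, fun j _ => rfl⟩
  | add x y _ _ hx hy =>
    exact ⟨fun j => by rw [Pi.add_apply, hx.1, hy.1, add_zero],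
      fun j hj => by rw [Pi.add_apply, hx.2 j hj, hy.2 j hj, add_zero]⟩
  | smul c x _ hx =>
    exact ⟨fun j => by rw [Pi.smul_apply, hx.1, smul_zero],
      fun j hj => by rw [Pi.smul_apply, hx.2 j hj, smul_zero]⟩

variable [CharP k 2] {p r : ℕ} {g : GL (Fin n ⊕ Fin n) k}

section SquareZero

variable (hg : g ∈ evenOrthGroup k n) (h2 : ∀ v, nilPart g (nilPart g v) = 0)
include hg h2

lemma polForm_nilPart_comm (v w : Fin n ⊕ Fin n → k) :
    polForm k n (nilPart g v) w = polForm k n v (nilPart g w) := by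
  have h1 : glAct _ k g⁻¹ (nilPart g w) = nilPart g w := by
    have h3 : glAct _ k g (nilPart g w) = nilPart g w := by
      rw [glAct_eq_add_nilPart, h2, add_zero]
    nth_rw 1 [← h3]
    exact glAct_inv_self _ _
  rw [polForm_nilPart_left hg, h1, CharTwo.neg_eq]

lemma nilForm_comm (v w : Fin n ⊕ Fin n → k) : nilForm g v w = nilForm g w v := by
  rw [nilForm_apply, nilForm_apply, ← polForm_nilPart_comm hg h2, polForm_comm]

lemma polForm_nilPart_nilPart (v w : Fin n ⊕ Fin n → k) :
    polForm k n (nilPart g v) (nilPart g w) = 0 := by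
  rw [polForm_nilPart_comm hg h2, h2, map_zero]

lemma nilPart_eq_zero_of_nilForm {v : Fin n ⊕ Fin n → k} (h : nilForm g v = 0) :
    nilPart g v = 0 :=
  eq_zero_of_polForm fun w => by
    rw [polForm_nilPart_comm hg h2, ← nilForm_apply, h, LinearMap.zero_apply]

lemma finrank_range_nilForm_le : Module.finrank k (LinearMap.range (nilForm g)) ≤ n := by
  have h3 : LinearMap.range (nilPart g) ≤ LinearMap.ker (nilForm g) := by
    rintro _ ⟨v, rfl⟩
    rw [LinearMap.mem_ker]
    exact LinearMap.ext fun w => polForm_nilPart_nilPart hg h2 v w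
  have h4 : LinearMap.ker (nilForm g) ≤ LinearMap.ker (nilPart g) := fun v hv =>
    nilPart_eq_zero_of_nilForm hg h2 hv
  have h5 := LinearMap.finrank_range_add_finrank_ker (nilForm g)
  have h6 := LinearMap.finrank_range_add_finrank_ker (nilPart g)
  have h7 := Submodule.finrank_mono h3
  have h8 := Submodule.finrank_mono h4
  have h9 : Module.finrank k (Fin n ⊕ Fin n → k) = n + n := by simp
  have h10 : LinearMap.ker (nilPart g) ≤ LinearMap.ker (nilForm g) := fun v hv =>
    LinearMap.ext fun w => by
      rw [nilForm_apply, ← polForm_nilPart_comm hg h2, LinearMap.mem_ker.1 hv, map_zero]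
  have h11 := Submodule.finrank_mono h10
  omega

end SquareZero

omit [CharP k 2] in
lemma exists_isInvolutionOfType (hg : g ∈ evenOrthGroup k n)
    (h2 : ∀ v, nilPart g (nilPart g v) = 0) : ∃ p r, IsInvolutionOfType p r g := by
  by_cases h : ∃ v, quadForm k n (nilPart g v) ≠ 0
  · exact ⟨1, _, hg, h2, rfl, Or.inl ⟨rfl, h⟩⟩
  · push Not at h
    exact ⟨2, _, hg, h2, rfl, Or.inr ⟨rfl, h⟩⟩

namespace IsInvolutionOfType

section Basic

variable (hi : IsInvolutionOfType p r g)
include hi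

omit [CharP k 2] in
lemma eq_one_or_eq_two : p = 1 ∨ p = 2 := hi.type.imp And.left And.left

lemma le : r ≤ n := hi.rank ▸ finrank_range_nilForm_le hi.mem hi.sq

lemma nilForm_self (v : Fin n ⊕ Fin n → k) : nilForm g v v = quadForm k n (nilPart g v) :=
  (quadForm_nilPart' hi.mem v).symm

lemma nilForm_self_eq_zero (hp : p = 2) (v : Fin n ⊕ Fin n → k) : nilForm g v v = 0 := by
  rcases hi.type with ⟨h, -⟩ | ⟨-, h⟩
  · omega
  · rw [hi.nilForm_self, h]

lemma exists_blockSystem [IsAlgClosed k] : p ∣ r ∧ ∃ v, IsBlockSystem (nilForm g) p r v := by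
  have hsymm := nilForm_comm hi.mem hi.sq
  rw [hi.rank]
  rcases hi.type with ⟨rfl, v, hv⟩ | ⟨rfl, h⟩
  · exact ⟨one_dvd _, exists_isBlockSystem_one hsymm (by rwa [hi.nilForm_self])⟩
  · exact exists_isBlockSystem_two hsymm (hi.nilForm_self_eq_zero rfl)

omit [CharP k 2] in
lemma conj {h : GL (Fin n ⊕ Fin n) k} (hh : h ∈ evenOrthGroup k n) :
    IsInvolutionOfType p r (h * g * h⁻¹) where
  mem := mul_mem (mul_mem hh hi.mem) (inv_mem hh)
  sq v := by rw [nilPart_conj, nilPart_conj, glAct_inv_self, hi.sq, map_zero]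
  rank := by
    have h1 : ∀ h g : GL (Fin n ⊕ Fin n) k, h ∈ evenOrthGroup k n →
        LinearMap.ker (nilForm g)
          ≤ (LinearMap.ker (nilForm (h * g * h⁻¹))).comap (glAct _ k h) := by
      intro h g hh v hv
      rw [Submodule.mem_comap, LinearMap.mem_ker]
      refine LinearMap.ext fun w => ?_
      rw [nilForm_conj hh, glAct_inv_self, LinearMap.mem_ker.1 hv]
      rfl
    have h2 : ∀ h g : GL (Fin n ⊕ Fin n) k, h ∈ evenOrthGroup k n →
        Module.finrank k (LinearMap.ker (nilForm g))
          ≤ Module.finrank k (LinearMap.ker (nilForm (h * g * h⁻¹))) := by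
      intro h g hh
      have hinj : Function.Injective (glAct _ k h) := fun v w hvw => by
        rw [← glAct_inv_self h v, hvw, glAct_inv_self]
      rw [(Submodule.equivMapOfInjective _ hinj _).finrank_eq]
      exact Submodule.finrank_mono (Submodule.map_le_iff_le_comap.2 (h1 h g hh))
    have h3 := h2 h g hh
    have h4 := h2 h⁻¹ (h * g * h⁻¹) (inv_mem hh)
    rw [show h⁻¹ * (h * g * h⁻¹) * h⁻¹⁻¹ = g by group] at h4
    have h5 := LinearMap.finrank_range_add_finrank_ker (nilForm g)
    have h6 := LinearMap.finrank_range_add_finrank_ker (nilForm (h * g * h⁻¹))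
    have h7 := hi.rank
    omega
  type := by
    refine hi.type.imp (fun h' => ⟨h'.1, ?_⟩) fun h' => ⟨h'.1, fun v => ?_⟩
    · obtain ⟨v, hv⟩ := h'.2
      refine ⟨glAct _ k h v, ?_⟩
      rwa [nilPart_conj, glAct_inv_self, mem_evenOrthGroup.1 hh]
    · rw [nilPart_conj, mem_evenOrthGroup.1 hh, h'.2]

end Basic

end IsInvolutionOfType

end Involutions

/-! ### Normal forms of involutions under the triangular group -/

section NormalForm

/-- A totally singular sequence on which the form attached to `g` is standard. -/
structure IsAdapted (g : GL (Fin n ⊕ Fin n) k) (p r : ℕ) (e : ℕ → Fin n ⊕ Fin n → k) : Prop where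
  block : IsBlockSystem (nilForm g) p r e
  null : ∀ i, r ≤ i → nilForm g (e i) = 0
  quad : ∀ i, quadForm k n (e i) = 0
  pol : ∀ i j, polForm k n (e i) (e j) = 0

/-- The vectors dual to the first members of an adapted sequence. -/
def dualVec (g : GL (Fin n ⊕ Fin n) k) (p : ℕ) (e : ℕ → Fin n ⊕ Fin n → k) (l : ℕ) :
    Fin n ⊕ Fin n → k :=
  nilPart g (e (blockSwap p l)) + (p : k) • e l

variable [CharP k 2] {p r : ℕ} {g : GL (Fin n ⊕ Fin n) k}

namespace IsAdapted

variable {e : ℕ → Fin n ⊕ Fin n → k} (he : IsAdapted g p r e) (hi : IsInvolutionOfType p r g)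
  (hpr : p ∣ r)
include he hi hpr

omit [CharP k 2] in
lemma polForm_dualVec (j : ℕ) {l : ℕ} (hl : l < r) :
    polForm k n (e j) (dualVec g p e l) = if j = l then 1 else 0 := by
  have hp := hi.eq_one_or_eq_two
  rw [dualVec, map_add, map_smul, he.pol, smul_zero, add_zero, ← nilForm_apply]
  rcases lt_or_ge j r with hj | hj
  · rw [he.block j hj _ (blockSwap_lt hp hpr hl), blockSwap_blockSwap hp]
  · rw [he.null j hj, LinearMap.zero_apply, if_neg (by omega)]

lemma polForm_dualVec_dualVec {l m : ℕ} (hl : l < r) (hm : m < r) :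
    polForm k n (dualVec g p e l) (dualVec g p e m) = 0 := by
  have h1 := he.polForm_dualVec hi hpr l hm
  have h2 := he.polForm_dualVec hi hpr m hl
  rw [dualVec, map_add, map_smul, he.pol, smul_zero, add_zero] at h2
  rw [dualVec, map_add, LinearMap.add_apply, map_smul, LinearMap.smul_apply, h1, dualVec, map_add,
    polForm_nilPart_nilPart hi.mem hi.sq, map_smul, zero_add, polForm_comm, h2]
  by_cases h : m = l
  · rw [if_pos h, if_pos h.symm]
    exact CharTwo.add_self_eq_zero _
  · rw [if_neg h, if_neg (Ne.symm h), smul_zero, add_zero]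

lemma quadForm_dualVec {l : ℕ} (hl : l < r) : quadForm k n (dualVec g p e l) = 0 := by
  have hp := hi.eq_one_or_eq_two
  have hl' := blockSwap_lt hp hpr hl
  rw [dualVec, quadForm_add, quadForm_smul, he.quad, mul_zero, add_zero, map_smul,
    polForm_nilPart_comm hi.mem hi.sq, ← nilForm_apply, he.block _ hl' _ hl, if_pos rfl,
    ← hi.nilForm_self, he.block _ hl' _ hl', blockSwap_blockSwap hp]
  rcases hp with rfl | rfl
  · rw [blockSwap_one, if_pos rfl, Nat.cast_one, smul_eq_mul, mul_one]
    exact CharTwo.add_self_eq_zero _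
  · rw [if_neg, Nat.cast_two, CharTwo.two_eq_zero, zero_smul, add_zero]
    intro h
    have := (eq_blockSwap_self_iff (Or.inr rfl) l).1 h.symm
    omega

omit he hpr in
lemma nilPart_eq (l : ℕ) :
    nilPart g (e l) = dualVec g p e (blockSwap p l) + (p : k) • e (blockSwap p l) := by
  rw [dualVec, blockSwap_blockSwap hi.eq_one_or_eq_two, add_assoc, vec_add_self, add_zero]

omit he hpr in
lemma nilPart_dualVec (l : ℕ) : nilPart g (dualVec g p e l)
    = (p : k) • (dualVec g p e (blockSwap p l) + (p : k) • e (blockSwap p l)) := by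
  rw [← nilPart_eq hi, dualVec, map_add, hi.sq, zero_add, map_smul]

/-- An adapted sequence together with any hyperbolic completion yields a completion on which `g`
acts in a normal form. -/
lemma exists_completion (hrn : r ≤ n) {f : Fin n → Fin n ⊕ Fin n → k}
    (hfQ : ∀ i, quadForm k n (f i) = 0) (hff : ∀ i j, polForm k n (f i) (f j) = 0)
    (hef : ∀ i j : Fin n, polForm k n (e i) (f j) = if i = j then 1 else 0) :
    ∃ f' : Fin n → Fin n ⊕ Fin n → k,
      (∀ i, quadForm k n (f' i) = 0) ∧ (∀ i j, polForm k n (f' i) (f' j) = 0) ∧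
      (∀ i j : Fin n, polForm k n (e i) (f' j) = if i = j then 1 else 0) ∧
      (∀ i : Fin n, (i : ℕ) < r → f' i = dualVec g p e i) ∧
      ∀ i : Fin n, r ≤ i → nilPart g (f' i) = 0 := by
  have hp := hi.eq_one_or_eq_two
  let c : Fin n → Fin n ⊕ Fin n → k := fun i =>
    ∑ l ∈ Finset.range r, polForm k n (f i) (dualVec g p e l) • e l
  have hec : ∀ (j : ℕ) (i : Fin n), polForm k n (e j) (c i) = 0 := fun j i => by
    simp only [c, map_sum, map_smul, he.pol, smul_zero, Finset.sum_const_zero]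
  have hcc : ∀ i j, polForm k n (c i) (c j) = 0 := fun i j => by
    rw [show c i = ∑ l ∈ Finset.range r, polForm k n (f i) (dualVec g p e l) • e l from rfl]
    simp only [map_sum, map_smul, LinearMap.sum_apply, LinearMap.smul_apply, hec, smul_zero,
      Finset.sum_const_zero]
  have hcQ : ∀ i, quadForm k n (c i) = 0 := fun i =>
    quadForm_sum_eq_zero _ _ _ (fun l _ => he.quad l) fun l _ m _ => he.pol l m
  have hfc : ∀ i j : Fin n, r ≤ j → polForm k n (f j) (c i) = 0 := fun i j hj => by
    simp only [c, map_sum, map_smul]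
    refine Finset.sum_eq_zero fun l hl => ?_
    have hl := Finset.mem_range.1 hl
    have h1 := hef ⟨l, by omega⟩ j
    rw [if_neg (fun h => by rw [← h] at hj; exact absurd hl (not_lt.2 hj))] at h1
    rw [polForm_comm (f j), h1, smul_zero]
  have hcF : ∀ (i : Fin n) (m : ℕ), m < r →
      polForm k n (c i) (dualVec g p e m) = polForm k n (f i) (dualVec g p e m) := by
    intro i m hm
    simp only [c, map_sum, map_smul, LinearMap.sum_apply, LinearMap.smul_apply, smul_eq_mul]
    rw [Finset.sum_eq_single m]
    · rw [he.polForm_dualVec hi hpr m hm, if_pos rfl, mul_one]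
    · intro l _ hl
      rw [he.polForm_dualVec hi hpr l hm, if_neg hl, mul_zero]
    · exact fun h => absurd (Finset.mem_range.2 hm) h
  have hdF : ∀ (i : Fin n) (m : ℕ), m < r →
      polForm k n (f i + c i) (dualVec g p e m) = 0 := fun i m hm => by
    rw [map_add, LinearMap.add_apply, hcF i m hm]
    exact CharTwo.add_self_eq_zero _
  have hdd : ∀ i j : Fin n, r ≤ i → r ≤ j → polForm k n (f i + c i) (f j + c j) = 0 := by
    intro i j h1 h2
    rw [map_add, map_add, LinearMap.add_apply, LinearMap.add_apply, hff, hfc j i h1, hcc,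
      polForm_comm (c i), hfc i j h2]
    simp
  have hed : ∀ i j : Fin n, polForm k n (e i) (f j + c j) = if i = j then 1 else 0 := by
    intro i j
    rw [map_add, hec, add_zero, hef]
  refine ⟨fun i => if (i : ℕ) < r then dualVec g p e i else f i + c i, fun i => ?_, fun i j => ?_,
    fun i j => ?_, fun i h => if_pos h, fun i h => ?_⟩
  · dsimp only
    split_ifs with h
    · exact he.quadForm_dualVec hi hpr h
    · rw [quadForm_add, hfQ, hcQ, hfc i i (not_lt.1 h)]
      simp
  · dsimp only
    split_ifs with h1 h2 h2
    · exact he.polForm_dualVec_dualVec hi hpr h1 h2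
    · rw [polForm_comm, hdF j i h1]
    · exact hdF i j h2
    · exact hdd i j (not_lt.1 h1) (not_lt.1 h2)
  · dsimp only
    split_ifs with h1 h2 h2
    · rw [he.polForm_dualVec hi hpr i h1, if_pos (by rw [h2])]
    · rw [he.polForm_dualVec hi hpr i h1, if_neg (fun h => h2 (Fin.ext h))]
    · rw [hed, if_pos h2]
    · rw [hed, if_neg h2]
  · dsimp only
    rw [if_neg (not_lt.2 h)]
    refine nilPart_eq_zero_of_nilForm hi.mem hi.sq
      (form_eq_zero_of_gramMatrix (nilForm_comm hi.mem hi.sq) (he.block.det_ne_zero hp hpr) hi.rank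
        fun l hl => ?_)
    have hl' := blockSwap_lt hp hpr hl
    have h1 := hed ⟨blockSwap p l, by omega⟩ i
    rw [if_neg (fun h' => by rw [← h'] at h; exact absurd hl' (not_lt.2 h))] at h1
    rw [nilForm_apply, nilPart_eq hi, map_add, hdF i _ hl', map_smul, polForm_comm, h1, smul_zero,
      add_zero]

end IsAdapted

/-- The normal form of an involution of given type. -/
def IsNormalForm (p r : ℕ) (g : GL (Fin n ⊕ Fin n) k) : Prop :=
  (∀ i : Fin n, nilPart g (eVec k i) = if (i : ℕ) < r then
    fSeq k n (blockSwap p i) + (p : k) • eSeq k n (blockSwap p i) else 0) ∧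
  ∀ i : Fin n, nilPart g (fVec k i) = if (i : ℕ) < r then
    (p : k) • (fSeq k n (blockSwap p i) + (p : k) • eSeq k n (blockSwap p i)) else 0

omit [CharP k 2] in
lemma IsNormalForm.eq {h : GL (Fin n ⊕ Fin n) k} (hg : IsNormalForm p r g)
    (hh : IsNormalForm p r h) : g = h := by
  refine glAct_ext fun v => ?_
  rw [glAct_eq_add_nilPart, glAct_eq_add_nilPart, eq_of_eVec_fVec (S := nilPart g) (T := nilPart h)
    (fun i => by rw [hg.1, hh.1]) fun i => by rw [hg.2, hh.2]]

lemma exists_isNormalForm [IsAlgClosed k] (hi : IsInvolutionOfType p r g)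
    (hdet : ∀ b ≤ r, p ∣ b → (gramMatrix (nilForm g) (eSeq k n) b).det ≠ 0) :
    ∃ b ∈ triangularSet k n, IsNormalForm p r (b⁻¹ * g * b) := by
  have hp := hi.eq_one_or_eq_two
  have hpr := hi.exists_blockSystem.1
  have hrn := hi.le
  obtain ⟨e, htri, hblock, hnull⟩ := exists_triangular_isBlockSystem
    (nilForm_comm hi.mem hi.sq) hp hi.nilForm_self_eq_zero hi.rank hpr hdet
  choose s hs0 hs using htri
  have hlow : ∀ i, ∀ j : Fin n, e i (Sum.inr j) = 0 := fun i j => by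
    have h1 := (span_eSeq_apply (hs i)).1 j
    rw [Pi.sub_apply, Pi.smul_apply, sub_eq_zero] at h1
    rw [h1, eSeq]
    split_ifs
    · rw [eVec_inr, smul_zero]
    · exact smul_zero _
  have hup : ∀ i j : Fin n, i ≤ j → e i (Sum.inl j) = if j = i then s i else 0 := fun i j hij => by
    have h1 := (span_eSeq_apply (hs i)).2 j hij
    rw [Pi.sub_apply, Pi.smul_apply, sub_eq_zero, eSeq_val, eVec_inl, smul_eq_mul, mul_ite,
      mul_one, mul_zero] at h1
    exact h1
  have hadapted : IsAdapted g p r e := by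
    refine ⟨hblock, hnull, fun i => ?_, fun i j => ?_⟩
    · simp [quadForm, hlow]
    · simp [polForm_apply, hlow]
  let P : Matrix (Fin n) (Fin n) k := Matrix.of fun a i => e i (Sum.inl a)
  have hPtri : P.BlockTriangular id := fun a i hai => by
    change e i (Sum.inl a) = 0
    rw [hup i a (le_of_lt hai), if_neg (ne_of_gt (show i < a from hai))]
  have hP : P.det ≠ 0 := by
    rw [Matrix.det_of_isUpperTriangular hPtri]
    refine Finset.prod_ne_zero_iff.2 fun i _ => ?_
    change e i (Sum.inl i) ≠ 0
    rw [hup i i le_rfl, if_pos rfl]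
    exact hs0 i
  have hb₀ : blockGL hP 0 ∈ evenOrthGroup k n := blockGL_mem hP fun y => by simp
  have hb₀e : ∀ i, glAct _ k (blockGL hP 0) (eVec k i) = e i := fun i => by
    ext a
    rw [eVec, ← glAct_entry]
    rcases a with a | a
    · rfl
    · exact (hlow i a).symm
  obtain ⟨f, hfQ, hff, hef, hfr, hfn⟩ := hadapted.exists_completion hi hpr hrn
    (f := fun i => glAct _ k (blockGL hP 0) (fVec k i))
    (fun i => by rw [mem_evenOrthGroup.1 hb₀, quadForm_fVec])
    (fun i j => by rw [polForm_glAct hb₀, polForm_fVec, fVec_inl])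
    (fun i j => by rw [← hb₀e, polForm_glAct hb₀, polForm_fVec, eVec_inl]; simp only [eq_comm])
  obtain ⟨b, hb, hbe, hbf⟩ := exists_evenOrthGroup_frame (e := fun i => e i)
    (fun i => hadapted.quad i) hfQ (fun i j => hadapted.pol i j) hff hef
  have hbe' : ∀ i < n, glAct _ k b (eSeq k n i) = e i := fun i h => by
    rw [eSeq_of_lt h, hbe]
  have hbf' : ∀ i < r, glAct _ k b (fSeq k n i) = dualVec g p e i := fun i h => by
    rw [fSeq_of_lt (h.trans_le hrn), hbf, hfr _ h]
  have hconj : ∀ v w, nilPart g (glAct _ k b v) = glAct _ k b w → nilPart (b⁻¹ * g * b) v = w := by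
    intro v w h
    have := nilPart_conj b⁻¹ g v
    rw [inv_inv, h, glAct_inv_self] at this
    exact this
  refine ⟨b, mem_triangularSet hb ?_ ?_, fun i => hconj _ _ ?_, fun i => hconj _ _ ?_⟩
  · ext a i
    change (b : Matrix (Fin n ⊕ Fin n) (Fin n ⊕ Fin n) k) (Sum.inr a) (Sum.inl i) = 0
    rw [glAct_entry]
    exact (congrFun (hbe i) _).trans (hlow i a)
  · intro a i hai
    change (b : Matrix (Fin n ⊕ Fin n) (Fin n ⊕ Fin n) k) (Sum.inl a) (Sum.inl i) = 0
    rw [glAct_entry]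
    refine (congrFun (hbe i) _).trans ?_
    rw [hup i a (le_of_lt hai), if_neg (ne_of_gt (show i < a from hai))]
  · rw [hbe]
    split_ifs with h
    · have h' := blockSwap_lt hp hpr h
      rw [map_add, map_smul, hbe' _ (h'.trans_le hrn), hbf' _ h', IsAdapted.nilPart_eq hi]
    · rw [map_zero]
      exact nilPart_eq_zero_of_nilForm hi.mem hi.sq (hnull i (not_lt.1 h))
  · rw [hbf]
    split_ifs with h
    · have h' := blockSwap_lt hp hpr h
      rw [map_smul, map_add, map_smul, hbe' _ (h'.trans_le hrn), hbf' _ h', hfr i h,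
        IsAdapted.nilPart_dualVec hi]
    · rw [map_zero, hfn i (not_lt.1 h)]

/-- Involutions of the same type in general position are conjugate under the triangular group. -/
lemma exists_triangularGroup_conj [IsAlgClosed k] {h : GL (Fin n ⊕ Fin n) k}
    (hi : IsInvolutionOfType p r g) (hi' : IsInvolutionOfType p r h)
    (hdet : ∀ b ≤ r, p ∣ b → (gramMatrix (nilForm g) (eSeq k n) b).det ≠ 0)
    (hdet' : ∀ b ≤ r, p ∣ b → (gramMatrix (nilForm h) (eSeq k n) b).det ≠ 0) :
    ∃ t ∈ triangularGroup k n, h = t * g * t⁻¹ := by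
  obtain ⟨b, hb, hbg⟩ := exists_isNormalForm hi hdet
  obtain ⟨c, hc, hcg⟩ := exists_isNormalForm hi' hdet'
  refine ⟨c * b⁻¹, mul_mem (Subgroup.subset_closure hc) (inv_mem (Subgroup.subset_closure hb)), ?_⟩
  have h1 := hbg.eq hcg
  rw [show c * b⁻¹ * g * (c * b⁻¹)⁻¹ = c * (b⁻¹ * g * b) * c⁻¹ by group, h1]
  group

end NormalForm

/-! ### Involutions in general position -/

section GeneralPosition

variable [CharP k 2] [IsAlgClosed k] {p r : ℕ} {g : GL (Fin n ⊕ Fin n) k}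

/-- A totally singular block system, together with a dual system. -/
lemma IsInvolutionOfType.exists_singular_blockSystem (hi : IsInvolutionOfType p r g) :
    ∃ v z : ℕ → Fin n ⊕ Fin n → k, IsBlockSystem (nilForm g) p r v ∧
      (∀ i < r, quadForm k n (v i) = 0) ∧ (∀ i < r, ∀ j < r, polForm k n (v i) (v j) = 0) ∧
      ∀ i < r, ∀ j < r, polForm k n (v i) (z j) = if i = j then 1 else 0 := by
  have hp := hi.eq_one_or_eq_two
  obtain ⟨hpr, v, hv⟩ := hi.exists_blockSystem
  have hsymm := nilForm_comm hi.mem hi.sq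
  let z : ℕ → Fin n ⊕ Fin n → k := fun j => nilPart g (v (blockSwap p j))
  have hvz : ∀ i < r, ∀ j < r, polForm k n (v i) (z j) = if i = j then 1 else 0 := by
    intro i h1 j h2
    change nilForm g (v i) (v (blockSwap p j)) = _
    rw [hv i h1 _ (blockSwap_lt hp hpr h2), blockSwap_blockSwap hp]
  have hzz : ∀ i j, polForm k n (z i) (z j) = 0 := fun i j =>
    polForm_nilPart_nilPart hi.mem hi.sq _ _
  have hz0 : ∀ i, nilForm g (z i) = 0 := fun i => LinearMap.ext fun x =>
    polForm_nilPart_nilPart hi.mem hi.sq _ _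
  let c : ℕ → Fin n ⊕ Fin n → k := fun i =>
    ∑ l ∈ Finset.range i, polForm k n (v i) (v l) • z l
  have hcz : ∀ i j, polForm k n (c i) (z j) = 0 := fun i j => by
    simp only [c, map_sum, map_smul, LinearMap.sum_apply, LinearMap.smul_apply, hzz, smul_zero,
      Finset.sum_const_zero]
  have hcc : ∀ i j, polForm k n (c i) (c j) = 0 := fun i j => by
    rw [show c j = ∑ l ∈ Finset.range j, polForm k n (v j) (v l) • z l from rfl]
    simp only [map_sum, map_smul, hcz, smul_zero, Finset.sum_const_zero]
  have hc0 : ∀ i, nilForm g (c i) = 0 := fun i => by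
    simp only [c, map_sum, map_smul, hz0, smul_zero, Finset.sum_const_zero]
  have hvc : ∀ i < r, ∀ j < r,
      polForm k n (v i) (c j) = if i < j then polForm k n (v i) (v j) else 0 := by
    intro i h1 j h2
    simp only [c, map_sum, map_smul, smul_eq_mul]
    rw [Finset.sum_congr rfl fun l hl => by
      rw [hvz i h1 l ((Finset.mem_range.1 hl).trans h2), mul_ite, mul_one, mul_zero],
      Finset.sum_ite_eq]
    simp only [Finset.mem_range]
    split_ifs
    · exact polForm_comm _ _
    · rfl
  have hww : ∀ i < r, ∀ j < r, polForm k n (v i + c i) (v j + c j) = 0 := by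
    intro i h1 j h2
    rw [map_add, map_add, LinearMap.add_apply, LinearMap.add_apply, hcc, add_zero, hvc i h1 j h2,
      polForm_comm (c i), hvc j h2 i h1]
    rcases lt_trichotomy i j with h | rfl | h
    · rw [if_pos h, if_neg (lt_asymm h), add_zero]
      exact CharTwo.add_self_eq_zero _
    · rw [polForm_self]
      simp
    · rw [if_pos h, if_neg (lt_asymm h), add_zero, polForm_comm (v j)]
      exact CharTwo.add_self_eq_zero _
  have hwz : ∀ i < r, ∀ j < r, polForm k n (v i + c i) (z j) = if i = j then 1 else 0 := by
    intro i h1 j h2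
    rw [map_add, LinearMap.add_apply, hcz, add_zero, hvz i h1 j h2]
  choose s hs using fun i => exists_quadratic_root (quadForm k n (z i)) (one_ne_zero (α := k))
    (quadForm k n (v i + c i))
  refine ⟨fun i => v i + c i + s i • z i, z, fun i h1 j h2 => ?_, fun i h => ?_,
    fun i h1 j h2 => ?_, fun i h1 j h2 => ?_⟩
  · have h3 : ∀ i, nilForm g (v i + c i + s i • z i) = nilForm g (v i) := fun i => by
      rw [map_add, map_add, map_smul, hz0, hc0, smul_zero, add_zero, add_zero]
    rw [h3, hsymm, h3, hsymm, hv i h1 j h2]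
  · rw [quadForm_add, quadForm_smul, map_smul, hwz i h i h, if_pos rfl, smul_eq_mul]
    linear_combination hs i
  · rw [map_add, map_add (polForm k n), LinearMap.add_apply, LinearMap.add_apply, hww i h1 j h2,
      map_smul (polForm k n), LinearMap.smul_apply, LinearMap.smul_apply, polForm_comm (z i),
      hwz j h2 i h1, map_smul, hwz i h1 j h2, map_smul, hzz]
    by_cases h : i = j
    · subst h
      simp only [if_true, smul_zero, add_zero, zero_add]
      exact CharTwo.add_self_eq_zero _
    · simp [h, Ne.symm h]
  · rw [map_add, LinearMap.add_apply, hwz i h1 j h2, map_smul, LinearMap.smul_apply, hzz,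
      smul_zero, add_zero]

/-- A form of Witt's theorem. -/
lemma exists_map_eSeq {v z : ℕ → Fin n ⊕ Fin n → k} (hrn : r ≤ n)
    (hQ : ∀ i < r, quadForm k n (v i) = 0) (hvv : ∀ i < r, ∀ j < r, polForm k n (v i) (v j) = 0)
    (hvz : ∀ i < r, ∀ j < r, polForm k n (v i) (z j) = if i = j then 1 else 0) :
    ∃ h ∈ evenOrthGroup k n, ∀ i < r, glAct _ k h (v i) = eSeq k n i := by
  suffices H : ∀ m ≤ r, ∃ h ∈ evenOrthGroup k n, ∀ i < m, glAct _ k h (v i) = eSeq k n i from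
    H r le_rfl
  intro m
  induction m with
  | zero => exact fun _ => ⟨1, one_mem _, fun i hi => absurd hi (Nat.not_lt_zero i)⟩
  | succ m ih =>
    intro hm
    obtain ⟨h, hh, hhv⟩ := ih (by omega)
    have hmn : m < n := by omega
    obtain ⟨h', hh', hfix, hmap⟩ := exists_reflGroup_map (S := eSeq k n '' Set.Iio m)
      (v := glAct _ k h (v m)) (e := eSeq k n m) (y := glAct _ k h (z m)) (y' := fSeq k n m)
      (by rw [mem_evenOrthGroup.1 hh, hQ m (by omega), eSeq_of_lt hmn, quadForm_eVec])
      (by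
        rintro _ ⟨j, hj, rfl⟩
        have hj : j < m := hj
        rw [← hhv j hj, polForm_glAct hh, hvv m (by omega) j (by omega)])
      (by
        rintro _ ⟨j, hj, rfl⟩
        have hj : j < m := hj
        rw [eSeq_of_lt hmn, eSeq_of_lt (hj.trans hmn), polForm_eVec, eVec_inr])
      (by
        rintro _ ⟨j, hj, rfl⟩
        have hj : j < m := hj
        rw [← hhv j hj, polForm_glAct hh, polForm_comm, hvz j (by omega) m (by omega),
          if_neg hj.ne])
      (by
        rintro _ ⟨j, hj, rfl⟩
        have hj : j < m := hj
        rw [fSeq_of_lt hmn, eSeq_of_lt (hj.trans hmn), polForm_eVec, fVec_inr, if_neg]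
        intro h
        exact hj.ne (Fin.mk.inj h))
      (by
        rw [polForm_glAct hh, hvz m (by omega) m (by omega), if_pos rfl]
        exact one_ne_zero)
      (by
        rw [fSeq_of_lt hmn, eSeq_of_lt hmn, polForm_fVec, eVec_inl, if_pos rfl]
        exact one_ne_zero)
    refine ⟨h' * h, mul_mem (reflGroup_le hh') hh, fun i hi => ?_⟩
    rw [glAct_mul_apply]
    rcases Nat.lt_succ_iff_lt_or_eq.1 hi with hi | rfl
    · rw [hhv i hi]
      exact hfix _ ⟨i, hi, rfl⟩
    · exact hmap

lemma IsInvolutionOfType.exists_conj_gramMatrix (hi : IsInvolutionOfType p r g) :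
    ∃ h ∈ evenOrthGroup k n, ∀ b ≤ r, p ∣ b →
      (gramMatrix (nilForm (h * g * h⁻¹)) (eSeq k n) b).det ≠ 0 := by
  obtain ⟨v, z, hv, hQ, hvv, hvz⟩ := hi.exists_singular_blockSystem
  obtain ⟨h, hh, hhv⟩ := exists_map_eSeq hi.le hQ hvv hvz
  have hblock : IsBlockSystem (nilForm (h * g * h⁻¹)) p r (eSeq k n) := by
    intro i h1 j h2
    rw [nilForm_conj hh, ← hhv i h1, ← hhv j h2, glAct_inv_self, glAct_inv_self, hv i h1 j h2]
  exact ⟨h, hh, fun b hb hpb => (hblock.mono hb).det_ne_zero hi.eq_one_or_eq_two hpb⟩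

end GeneralPosition

/-! ### Spherical classes and involutions -/

section Spherical

lemma mem_closure_subgroup_iff {m : Type*} [DecidableEq m] [Fintype m]
    {G : Subgroup (GL m k)} {S : Set G} {x : G} :
    x ∈ closure S ↔ ∀ f ∈ glReg m k, (∀ s ∈ S, f (s : GL m k) = 0) → f x = 0 := by
  rw [Topology.IsInducing.subtypeVal.closure_eq_preimage_closure_image, Set.mem_preimage,
    mem_closure_glReg_iff]
  simp only [Set.forall_mem_image]
  exact Iff.rfl

lemma isSolvable_triangularGroup : Group.IsSolvable (triangularGroup k n) := by
  refine (Group.isSolvable_def _).2 ⟨2 * n, ?_⟩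
  refine IsStableFlag.derivedSeries_eq_bot (ρ := (triangularGroup k n).subtype)
    (F := stdFlag k n) ?_ (Subgroup.subtype_injective _)
  rw [← MonoidHom.coe_range, Subgroup.range_subtype]
  exact isStableFlag_stdFlag

/-- Every conjugate of the triangular group under the orthogonal group lies in a Borel subgroup. -/
lemma exists_isBorel_triangularGroup_conj [IsAlgClosed k] {h : GL (Fin n ⊕ Fin n) k}
    (hh : h ∈ evenOrthGroup k n) :
    ∃ B : Subgroup (evenSOGroup k n), IsBorel (evenSOGroup k n) B ∧
      ∀ t ∈ triangularGroup k n, ∃ b ∈ B, (b : GL (Fin n ⊕ Fin n) k) = h * t * h⁻¹ := by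
  have := IsAlgClosed.instInfinite (K := k)
  set C := (triangularGroup k n).map (MulAut.conj h).toMonoidHom with hC
  have hCG : C ≤ evenSOGroup k n := by
    rintro _ ⟨t, ht, rfl⟩
    exact conj_mem_evenSOGroup hh (triangularGroup_le_evenSOGroup ht)
  have himg : ((↑) '' ((C.subgroupOf (evenSOGroup k n) : Subgroup _) : Set (evenSOGroup k n)) :
      Set (GL (Fin n ⊕ Fin n) k)) = C := by
    ext x
    constructor
    · rintro ⟨y, hy, rfl⟩
      exact hy
    · exact fun hx => ⟨⟨x, hCG hx⟩, hx, rfl⟩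
  have hcon : IsPreconnected (C.subgroupOf (evenSOGroup k n) : Set (evenSOGroup k n)) := by
    rw [← Topology.IsInducing.subtypeVal.isPreconnected_image]
    refine (congrArg IsPreconnected himg).mpr ?_
    exact isPreconnected_triangularGroup.image _
      (((isRegMap_const h).mul isRegMap_id).mul (isRegMap_const h⁻¹)).continuous.continuousOn
  have hsol : Group.IsSolvable (C.subgroupOf (evenSOGroup k n)) := by
    have h1 := isSolvable_triangularGroup (k := k) (n := n)
    have h2 : Group.IsSolvable C := Group.isSolvable_of_surjective
      ((MulAut.conj h).toMonoidHom.subgroupMap_surjective (triangularGroup k n))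
    exact Group.isSolvable_of_surjective (f := (Subgroup.subgroupOfEquivOfLe hCG).symm.toMonoidHom)
      (Subgroup.subgroupOfEquivOfLe hCG).symm.surjective
  obtain ⟨B, hB, hle⟩ := exists_isBorel_ge hcon hsol
  exact ⟨B, hB, fun t ht => ⟨⟨h * t * h⁻¹, hCG ⟨t, ht, rfl⟩⟩, hle ⟨t, ht, rfl⟩, rfl⟩⟩

lemma det_gramMatrix_nilForm_mem (e : ℕ → Fin n ⊕ Fin n → k) (b : ℕ) :
    (fun g => (gramMatrix (nilForm g) e b).det) ∈ glReg (Fin n ⊕ Fin n) k := by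
  simp only [Matrix.det_apply']
  refine sum_mem_glReg _ fun σ _ => mul_mem_glReg (const_mem_glReg _) (prod_mem_glReg _ fun i _ => ?_)
  change (fun g => polForm k n (e (σ i)) (nilPart g (e i))) ∈ glReg (Fin n ⊕ Fin n) k
  simp only [nilPart_apply, map_sub]
  exact sub_mem_glReg (linear_glAct_mem _ _) (const_mem_glReg _)

variable [CharP k 2] [IsAlgClosed k]

/-- The class of an involution is spherical. -/
lemma isSphericalClass_of_nilPart_sq {u : evenSOGroup k n}
    (h2 : ∀ v, nilPart (u : GL (Fin n ⊕ Fin n) k) (nilPart (u : GL (Fin n ⊕ Fin n) k) v) = 0) :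
    IsSphericalClass (evenSOGroup k n) (conjClass u) := by
  obtain ⟨p, r, hi⟩ := exists_isInvolutionOfType (evenSOGroup_le u.2) h2
  obtain ⟨h, hh, hdet⟩ := hi.exists_conj_gramMatrix
  obtain ⟨B, hB, hBt⟩ := exists_isBorel_triangularGroup_conj (inv_mem hh)
  refine ⟨B, hB, u, IsConj.refl u, ?_⟩
  rintro w hw
  obtain ⟨c, rfl⟩ := isConj_iff.1 hw
  refine mem_closure_subgroup_iff.2 fun f hf hfB => ?_
  classical
  let s := (Finset.range (r + 1)).filter (p ∣ ·)
  let φ : GL (Fin n ⊕ Fin n) k → GL (Fin n ⊕ Fin n) k := fun x => x * u * x⁻¹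
  have hφ : IsRegMap φ := (isRegMap_id.mul (isRegMap_const _)).mul isRegMap_id.inv
  let ψ : GL (Fin n ⊕ Fin n) k → GL (Fin n ⊕ Fin n) k := fun x => h * φ x * h⁻¹
  have hψ : IsRegMap ψ := ((isRegMap_const h).mul hφ).mul (isRegMap_const h⁻¹)
  refine Subgroup.glReg_eq_zero_or isPreconnected_evenSOGroup (hφ.comp_mem hf)
    (prod_mem_glReg s fun b _ => hψ.comp_mem (det_gramMatrix_nilForm_mem (eSeq k n) b))
    (fun x hx => ?_) (one_mem _) ?_ c c.2
  · by_cases h0 : ∏ b ∈ s, (gramMatrix (nilForm (ψ x)) (eSeq k n) b).det = 0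
    · exact mul_eq_zero_of_right _ h0
    · refine mul_eq_zero_of_left ?_ _
      have hdet' : ∀ b ≤ r, p ∣ b → (gramMatrix (nilForm (ψ x)) (eSeq k n) b).det ≠ 0 :=
        fun b hb hpb => Finset.prod_ne_zero_iff.1 h0 b
          (Finset.mem_filter.2 ⟨Finset.mem_range.2 (Nat.lt_succ_of_le hb), hpb⟩)
      obtain ⟨t, ht, htx⟩ := exists_triangularGroup_conj (hi.conj hh)
        ((hi.conj (evenSOGroup_le hx)).conj hh) hdet hdet'
      obtain ⟨b, hb, hbt⟩ := hBt t ht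
      have h1 : φ x = b * u * (b : GL (Fin n ⊕ Fin n) k)⁻¹ := by
        rw [hbt, show φ x = h⁻¹ * (h * (x * u * x⁻¹) * h⁻¹) * h by simp only [φ]; group, htx]
        group
      have h2 := hfB (b * u * b⁻¹) ⟨b, hb, rfl⟩
      rwa [Subgroup.coe_mul, Subgroup.coe_mul, Subgroup.coe_inv, ← h1] at h2
  · refine Finset.prod_ne_zero_iff.2 fun b hb => ?_
    obtain ⟨h1, h3⟩ := Finset.mem_filter.1 hb
    have h4 : ψ 1 = h * u * h⁻¹ := by simp [ψ, φ]
    rw [h4]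
    exact hdet b (Nat.lt_succ_iff.1 (Finset.mem_range.1 h1)) h3

/-- Unipotent elements of spherical classes are involutions. -/
lemma nilPart_sq_of_isSphericalClass (hn : 4 ≤ n) {u : evenSOGroup k n}
    (hunip : IsNilpotent
      (((u : GL (Fin n ⊕ Fin n) k) : Matrix (Fin n ⊕ Fin n) (Fin n ⊕ Fin n) k) - 1))
    (hs : IsSphericalClass (evenSOGroup k n) (conjClass u)) :
    ∃ x ∈ conjClass u, ∀ v, nilPart (x : GL (Fin n ⊕ Fin n) k)
      (nilPart (x : GL (Fin n ⊕ Fin n) k) v) = 0 := by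
  obtain ⟨B, ⟨-, hcon, hsol, -⟩, x, hx, hdense⟩ := hs
  refine ⟨x, hx, ?_⟩
  have hnil : IsNilpotent (nilPart (x : GL (Fin n ⊕ Fin n) k)) := by
    obtain ⟨c, rfl⟩ := isConj_iff.1 hx
    have h1 : ((((c * u * c⁻¹ : evenSOGroup k n) : GL (Fin n ⊕ Fin n) k) :
        Matrix (Fin n ⊕ Fin n) (Fin n ⊕ Fin n) k) - 1)
        = (c : GL (Fin n ⊕ Fin n) k) * (((u : GL (Fin n ⊕ Fin n) k) :
          Matrix (Fin n ⊕ Fin n) (Fin n ⊕ Fin n) k) - 1)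
            * ((c : GL (Fin n ⊕ Fin n) k)⁻¹ : GL (Fin n ⊕ Fin n) k) := by
      simp [mul_sub, sub_mul]
    have h2 : IsNilpotent ((((c * u * c⁻¹ : evenSOGroup k n) : GL (Fin n ⊕ Fin n) k) :
        Matrix (Fin n ⊕ Fin n) (Fin n ⊕ Fin n) k) - 1) := by
      obtain ⟨m, hm⟩ := hunip
      exact ⟨m, by rw [h1, Units.conj_pow, hm, mul_zero, zero_mul]⟩
    have h3 : nilPart ((c * u * c⁻¹ : evenSOGroup k n) : GL (Fin n ⊕ Fin n) k) =
        Matrix.toLinAlgEquiv' ((((c * u * c⁻¹ : evenSOGroup k n) : GL (Fin n ⊕ Fin n) k) :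
        Matrix (Fin n ⊕ Fin n) (Fin n ⊕ Fin n) k) - 1) := by
      refine LinearMap.ext fun v => ?_
      rw [nilPart_apply, glAct_apply, Matrix.toLinAlgEquiv'_apply, Matrix.sub_mulVec,
        Matrix.one_mulVec]
    rw [h3]
    exact h2.map Matrix.toLinAlgEquiv'
  have hM : Group.IsSolvable (B.map (evenSOGroup k n).subtype) :=
    have : Group.IsSolvable B := hsol
    Group.isSolvable_of_surjective ((evenSOGroup k n).subtype.subgroupMap_surjective B)
  refine nilPart_nilPart_eq_zero_of_isDenseInClass hn (evenSOGroup_le x.2) hnil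
    (M := B.map (evenSOGroup k n).subtype) ?_ ?_ ?_
  · rintro _ ⟨b, -, rfl⟩
    exact evenSOGroup_le b.2
  · exact hcon.isPreconnected.image _ continuous_subtype_val.continuousOn
  · intro f hf hfB h hh
    have h1 : (⟨h, hh⟩ * x * ⟨h, hh⟩⁻¹ : evenSOGroup k n) ∈ conjClass u :=
      IsConj.trans hx (isConj_iff.2 ⟨_, rfl⟩)
    refine mem_closure_subgroup_iff.1 (hdense h1) f hf ?_
    rintro _ ⟨b, hb, rfl⟩
    exact hfB b ⟨b, hb, rfl⟩

end Spherical

end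

/-- Let `k` be an algebraically closed field of characteristic 2 and let
`G = SO(2n, k)` with `n ≥ 4`. A non-trivial unipotent conjugacy class `O` of `G` is
spherical if and only if `O` consists of involutions, i.e. iff every `u ∈ O` satisfies
`u² = 1`. -/
theorem spherical_iff_involutions_special_orthogonal_char_two
    (k : Type*) [Field k] [IsAlgClosed k] (hchar : ringChar k = 2)
    (n : ℕ) (hn : 4 ≤ n)
    (u : evenSOGroup k n) (hu : u ≠ 1)
    (hunip : IsNilpotent
      (((u : GL (Fin n ⊕ Fin n) k) : Matrix (Fin n ⊕ Fin n) (Fin n ⊕ Fin n) k) - 1)) :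
    IsSphericalClass (evenSOGroup k n) (conjClass u) ↔ ∀ v ∈ conjClass u, v ^ 2 = 1 := by
  have : CharP k 2 := ringChar.of_eq hchar
  constructor
  · intro hs v hv
    obtain ⟨x, hx, hx2⟩ := nilPart_sq_of_isSphericalClass hn hunip hs
    obtain ⟨c, rfl⟩ := isConj_iff.1 (hx.symm.trans hv : IsConj x v)
    refine Subtype.ext (glAct_ext fun w => ?_)
    rw [sq, Subgroup.coe_mul, glAct_mul_apply, Subgroup.coe_one, ← sub_eq_zero, map_one,
      Module.End.one_apply, ← nilPart_nilPart, Subgroup.coe_mul, Subgroup.coe_mul,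
      Subgroup.coe_inv, nilPart_conj, nilPart_conj, glAct_inv_self, hx2, map_zero]
  · intro h
    refine isSphericalClass_of_nilPart_sq fun v => ?_
    have h1 := congrArg Subtype.val (h u (IsConj.refl u))
    rw [sq, Subgroup.coe_mul, Subgroup.coe_one] at h1
    rw [nilPart_nilPart, ← glAct_mul_apply, h1, map_one, Module.End.one_apply, sub_self]
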